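/- arXiv:1409.8649 — 2 statements merged into one kernel-verified Lean document; each statement's English description precedes it below -/
import Mathlib

section
/- Let σ > 0 and β > 0 be given. There exists a parameter ρ > 1 such that the Lorenz system with parameters (σ, ρ, β) possesses a homoclinic trajectory to the origin if and only if 2β + 1 < 3σ. -/
open Filter Topology

/-- Right-hand side of the Lorenz system with parameters `σ ρ β`:
`ẋ = σ(y − x), ẏ = ρx − y − xz, ż = −βz + xy`. -/
def lorenzRHS (σ ρ β : ℝ) (p : ℝ × ℝ × ℝ) : ℝ × ℝ × ℝ :=
  (σ * (p.2.1 - p.1), ρ * p.1 - p.2.1 - p.1 * p.2.2, -β * p.2.2 + p.1 * p.2.1)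

theorem strictMonoOn_exp_mul_of_deriv {f f' : ℝ → ℝ} {a t₀ T : ℝ}
    (hf : ∀ t ∈ Set.Icc t₀ T, HasDerivAt f (f' t) t)
    (hpos : ∀ t ∈ Set.Ioo t₀ T, 0 < f' t + a * f t) :
    StrictMonoOn (fun t => Real.exp (a * t) * f t) (Set.Icc t₀ T) := by
  have hd : ∀ t ∈ Set.Icc t₀ T, HasDerivAt (fun t => Real.exp (a * t) * f t)
      (Real.exp (a * t) * (f' t + a * f t)) t := by
    intro t ht
    have h1 : HasDerivAt (fun t : ℝ => Real.exp (a * t)) (Real.exp (a * t) * a) t := by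
      simpa using ((hasDerivAt_id t).const_mul a).exp
    exact (h1.mul (hf t ht)).congr_deriv (by ring)
  refine strictMonoOn_of_deriv_pos (convex_Icc _ _)
    (fun t ht => (hd t ht).continuousAt.continuousWithinAt) fun t ht => ?_
  rw [interior_Icc] at ht
  rw [(hd t (Set.Ioo_subset_Icc_self ht)).deriv]
  exact mul_pos (Real.exp_pos _) (hpos t ht)

theorem monotoneOn_exp_mul_of_deriv {f f' : ℝ → ℝ} {a t₀ T : ℝ}
    (hf : ∀ t ∈ Set.Icc t₀ T, HasDerivAt f (f' t) t)
    (hpos : ∀ t ∈ Set.Ioo t₀ T, 0 ≤ f' t + a * f t) :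
    MonotoneOn (fun t => Real.exp (a * t) * f t) (Set.Icc t₀ T) := by
  have hd : ∀ t ∈ Set.Icc t₀ T, HasDerivAt (fun t => Real.exp (a * t) * f t)
      (Real.exp (a * t) * (f' t + a * f t)) t := by
    intro t ht
    have h1 : HasDerivAt (fun t : ℝ => Real.exp (a * t)) (Real.exp (a * t) * a) t := by
      simpa using ((hasDerivAt_id t).const_mul a).exp
    exact (h1.mul (hf t ht)).congr_deriv (by ring)
  refine monotoneOn_of_deriv_nonneg (convex_Icc _ _)
    (fun t ht => (hd t ht).continuousAt.continuousWithinAt)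
    (fun t ht => (hd t (interior_subset ht)).differentiableAt.differentiableWithinAt) fun t ht => ?_
  rw [interior_Icc] at ht
  rw [(hd t (Set.Ioo_subset_Icc_self ht)).deriv]
  exact mul_nonneg (Real.exp_pos _).le (hpos t ht)

/-- A comparison principle for `f' + a f ≥ 0` on an interval. -/
theorem nonneg_of_deriv_add_nonneg {f f' : ℝ → ℝ} {a t₀ T : ℝ} (hT : t₀ ≤ T)
    (hf : ∀ t ∈ Set.Icc t₀ T, HasDerivAt f (f' t) t)
    (hpos : ∀ t ∈ Set.Ioo t₀ T, 0 ≤ f' t + a * f t) (h0 : 0 ≤ f t₀) : 0 ≤ f T := by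
  have h := monotoneOn_exp_mul_of_deriv hf hpos (Set.left_mem_Icc.2 hT) (Set.right_mem_Icc.2 hT) hT
  have h1 : 0 ≤ Real.exp (a * T) * f T := le_trans (mul_nonneg (Real.exp_pos _).le h0) h
  exact nonneg_of_mul_nonneg_right h1 (Real.exp_pos _)

theorem pos_of_deriv_add_nonneg {f f' : ℝ → ℝ} {a t₀ T : ℝ} (hT : t₀ ≤ T)
    (hf : ∀ t ∈ Set.Icc t₀ T, HasDerivAt f (f' t) t)
    (hpos : ∀ t ∈ Set.Ioo t₀ T, 0 ≤ f' t + a * f t) (h0 : 0 < f t₀) : 0 < f T := by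
  have h := monotoneOn_exp_mul_of_deriv hf hpos (Set.left_mem_Icc.2 hT) (Set.right_mem_Icc.2 hT) hT
  have h1 : 0 < Real.exp (a * T) * f T := lt_of_lt_of_le (mul_pos (Real.exp_pos _) h0) h
  exact pos_of_mul_pos_right h1 (Real.exp_pos _).le

theorem pos_of_deriv_add_pos {f f' : ℝ → ℝ} {a t₀ T : ℝ} (hT : t₀ < T)
    (hf : ∀ t ∈ Set.Icc t₀ T, HasDerivAt f (f' t) t)
    (hpos : ∀ t ∈ Set.Ioo t₀ T, 0 < f' t + a * f t) (h0 : 0 ≤ f t₀) : 0 < f T := by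
  have h := strictMonoOn_exp_mul_of_deriv hf hpos (Set.left_mem_Icc.2 hT.le)
    (Set.right_mem_Icc.2 hT.le) hT
  have h1 : 0 < Real.exp (a * T) * f T := lt_of_le_of_lt (mul_nonneg (Real.exp_pos _).le h0) h
  exact pos_of_mul_pos_right h1 (Real.exp_pos _).le

theorem tendsto_exp_mul_atBot_zero {f : ℝ → ℝ} {a : ℝ} (ha : 0 ≤ a)
    (h0 : Tendsto f atBot (𝓝 0)) : Tendsto (fun t => Real.exp (a * t) * f t) atBot (𝓝 0) := by
  refine squeeze_zero_norm' ?_ (tendsto_zero_iff_norm_tendsto_zero.1 h0)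
  filter_upwards [eventually_le_atBot 0] with t ht
  rw [norm_mul]
  refine mul_le_of_le_one_left (norm_nonneg _) ?_
  rw [Real.norm_of_nonneg (Real.exp_pos _).le, Real.exp_le_one_iff]
  exact mul_nonpos_of_nonneg_of_nonpos ha ht

/-- A comparison principle for `f' + a f ≥ 0` with `f → 0` at `-∞`. -/
theorem nonneg_of_deriv_add_nonneg_atBot {f f' : ℝ → ℝ} {a T : ℝ} (ha : 0 ≤ a)
    (hf : ∀ t ≤ T, HasDerivAt f (f' t) t) (h0 : Tendsto f atBot (𝓝 0))
    (hpos : ∀ t < T, 0 ≤ f' t + a * f t) : 0 ≤ f T := by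
  have h1 : 0 ≤ Real.exp (a * T) * f T := by
    refine le_of_tendsto (tendsto_exp_mul_atBot_zero ha h0) ?_
    filter_upwards [eventually_le_atBot T] with s hs
    exact monotoneOn_exp_mul_of_deriv (fun t ht => hf t ht.2) (fun t ht => hpos t ht.2)
      (Set.left_mem_Icc.2 hs) (Set.right_mem_Icc.2 hs) hs
  exact nonneg_of_mul_nonneg_right h1 (Real.exp_pos _)

theorem pos_of_deriv_add_pos_atBot {f f' : ℝ → ℝ} {a T : ℝ} (ha : 0 ≤ a)
    (hf : ∀ t ≤ T, HasDerivAt f (f' t) t) (h0 : Tendsto f atBot (𝓝 0))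
    (hpos : ∀ t < T, 0 < f' t + a * f t) : 0 < f T := by
  refine pos_of_deriv_add_pos (t₀ := T - 1) (by linarith) (fun t ht => hf t ht.2)
    (fun t ht => hpos t ht.2) ?_
  exact nonneg_of_deriv_add_nonneg_atBot ha (fun t ht => hf t (by linarith)) h0
    fun t ht => (hpos t (by linarith)).le

/-- Solutions of `f' = -a f + φ` with `a > 0` and `φ → 0` tend to zero. -/
theorem tendsto_zero_of_linear_forced {f φ : ℝ → ℝ} {a : ℝ} (ha : 0 < a)
    (hf : ∀ t, HasDerivAt f (-a * f t + φ t) t) (hφ : Tendsto φ atTop (𝓝 0)) :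
    Tendsto f atTop (𝓝 0) := by
  rw [Metric.tendsto_atTop]
  intro ε hε
  obtain ⟨N, hN⟩ := (Metric.tendsto_atTop.1 hφ) (a * (ε / 2)) (by positivity)
  have hlim : Tendsto (fun t : ℝ => Real.exp (-(a * (t - N))) * |f N|) atTop (𝓝 0) := by
    have h1 : Tendsto (fun t : ℝ => a * (t - N)) atTop atTop :=
      (tendsto_atTop_add_const_right _ (-N) tendsto_id).const_mul_atTop ha
    simpa using (Real.tendsto_exp_neg_atTop_nhds_zero.comp h1).mul_const |f N|
  obtain ⟨M, hM⟩ := (Metric.tendsto_atTop.1 hlim) (ε / 2) (by positivity)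
  refine ⟨max N M, fun t ht => ?_⟩
  have htN : N ≤ t := le_trans (le_max_left _ _) ht
  have htM := hM t (le_trans (le_max_right _ _) ht)
  have hφ' : ∀ s ∈ Set.Ioo N t, |φ s| < a * (ε / 2) := fun s hs => by
    simpa [Real.dist_eq] using hN s hs.1.le
  have hB : ∀ s, HasDerivAt (fun s => Real.exp (-(a * (s - N))) * |f N|)
      (-a * (Real.exp (-(a * (s - N))) * |f N|)) s := fun s => by
    have h1 : HasDerivAt (fun s => -(a * (s - N))) (-a) s := by
      simpa using (((hasDerivAt_id s).sub_const N).const_mul a).fun_neg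
    exact (h1.exp.mul_const _).congr_deriv (by ring)
  have up : 0 ≤ (Real.exp (-(a * (t - N))) * |f N| + ε / 2) - f t := by
    refine nonneg_of_deriv_add_nonneg (a := a) (f := fun s =>
      (Real.exp (-(a * (s - N))) * |f N| + ε / 2) - f s) htN
      (fun s _ => ((hB s).add_const _).sub (hf s)) (fun s hs => ?_) ?_
    · have := abs_lt.1 (hφ' s hs)
      linarith
    · simp; linarith [le_abs_self (f N)]
  have lo : 0 ≤ (Real.exp (-(a * (t - N))) * |f N| + ε / 2) + f t := by
    refine nonneg_of_deriv_add_nonneg (a := a) (f := fun s =>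
      (Real.exp (-(a * (s - N))) * |f N| + ε / 2) + f s) htN
      (fun s _ => ((hB s).add_const _).add (hf s)) (fun s hs => ?_) ?_
    · have := abs_lt.1 (hφ' s hs)
      linarith
    · simp; linarith [neg_abs_le (f N)]
  rw [Real.dist_eq, sub_zero, abs_lt] at *
  constructor <;> linarith [htM.2]

theorem tendsto_nhds_of_eq {α : Type*} {l : Filter α} {f : α → ℝ} {a b : ℝ}
    (h : Tendsto f l (𝓝 a)) (e : a = b) : Tendsto f l (𝓝 b) := e ▸ h

/-- The Lorenz system in the coordinates `x`, `p = x'`, `w = z - x ^ 2 / (2 σ)`. -/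
structure ReducedFlow (σ β κ g : ℝ) (x p w : ℝ → ℝ) : Prop where
  dx : ∀ t, HasDerivAt x (p t) t
  dp : ∀ t, HasDerivAt p (-(σ + 1) * p t + x t * (g - x t ^ 2 / 2 - σ * w t)) t
  dw : ∀ t, HasDerivAt w (κ * x t ^ 2 - β * w t) t

namespace ReducedFlow

/-- The stiffness `G` in `p' = -(σ + 1) p + x G`. -/
noncomputable def G (σ g : ℝ) (x w : ℝ → ℝ) (t : ℝ) : ℝ := g - x t ^ 2 / 2 - σ * w t

/-- The derivative of `w`. -/
noncomputable def Q (β κ : ℝ) (x w : ℝ → ℝ) (t : ℝ) : ℝ := κ * x t ^ 2 - β * w t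

/-- The numerator of the derivative of `p / x`. -/
noncomputable def J (σ g : ℝ) (x p w : ℝ → ℝ) (t : ℝ) : ℝ :=
  x t * (-(σ + 1) * p t + x t * G σ g x w t) - p t ^ 2

/-- The derivative of `G`. -/
noncomputable def K (σ β κ : ℝ) (x p w : ℝ → ℝ) (t : ℝ) : ℝ := -(x t * p t) - σ * Q β κ x w t

/-- An energy function related to `J` by `J = -2 F - x ^ 4 / 4`. -/
noncomputable def F (σ g : ℝ) (x p w : ℝ → ℝ) (t : ℝ) : ℝ :=
  p t ^ 2 / 2 + (σ + 1) / 2 * (x t * p t) - g * x t ^ 2 / 2 + x t ^ 4 / 8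
    + σ / 2 * (x t ^ 2 * w t)

variable {σ β κ g : ℝ} {x p w : ℝ → ℝ}

theorem J_eq (t : ℝ) : J σ g x p w t = -2 * F σ g x p w t - x t ^ 4 / 4 := by
  unfold J F G; ring

theorem hasDerivAt_G (S : ReducedFlow σ β κ g x p w) (t : ℝ) :
    HasDerivAt (G σ g x w) (K σ β κ x p w t) t := by
  have h := (((S.dx t).fun_pow 2).div_const 2).const_sub g |>.fun_sub ((S.dw t).const_mul σ)
  refine h.congr_deriv ?_
  unfold K Q; push_cast; ring

theorem hasDerivAt_Q (S : ReducedFlow σ β κ g x p w) (t : ℝ) :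
    HasDerivAt (Q β κ x w) (-β * Q β κ x w t + 2 * κ * (x t * p t)) t := by
  have h := (((S.dx t).fun_pow 2).const_mul κ).fun_sub ((S.dw t).const_mul β)
  refine h.congr_deriv ?_
  unfold Q; push_cast; ring

theorem hasDerivAt_J (S : ReducedFlow σ β κ g x p w) (t : ℝ) :
    HasDerivAt (J σ g x p w) (-(σ + 1) * J σ g x p w t + x t ^ 2 * K σ β κ x p w t) t := by
  have h := ((S.dx t).fun_mul (((S.dp t).const_mul (-(σ + 1))).fun_add
    ((S.dx t).fun_mul (S.hasDerivAt_G t)))).fun_sub ((S.dp t).fun_pow 2)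
  refine h.congr_deriv ?_
  unfold J G; push_cast; ring

theorem hasDerivAt_K (S : ReducedFlow σ β κ g x p w) (hκ : 2 * σ * κ = 2 * σ - β) (t : ℝ) :
    HasDerivAt (K σ β κ x p w)
      (-β * K σ β κ x p w t - J σ g x p w t - 2 * p t * (p t + σ * x t)) t := by
  have h := ((S.dx t).fun_mul (S.dp t)).fun_neg.fun_sub ((S.hasDerivAt_Q t).const_mul σ)
  refine h.congr_deriv ?_
  unfold K J Q G
  linear_combination (-(x t * p t)) * hκ

theorem hasDerivAt_F (S : ReducedFlow σ β κ g x p w) (hκ : 2 * σ * κ = 2 * σ - β) (t : ℝ) :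
    HasDerivAt (F σ g x p w) (-(σ + 1) * F σ g x p w t + (3 * σ - 2 * β - 1) / 8 * x t ^ 4
      - σ * β / 2 * (x t ^ 2 * w t)) t := by
  have h := ((((((S.dp t).fun_pow 2).div_const 2).fun_add
    (((S.dx t).fun_mul (S.dp t)).const_mul ((σ + 1) / 2))).fun_sub
    ((((S.dx t).fun_pow 2).const_mul g).div_const 2)).fun_add
    (((S.dx t).fun_pow 4).div_const 8)).fun_add
    ((((S.dx t).fun_pow 2).fun_mul (S.dw t)).const_mul (σ / 2))
  refine h.congr_deriv ?_
  unfold F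
  push_cast
  linear_combination (x t ^ 4 / 4) * hκ

theorem hasDerivAt_slope (S : ReducedFlow σ β κ g x p w) {t : ℝ} (hx : x t ≠ 0) :
    HasDerivAt (fun s => p s / x s) (J σ g x p w t / x t ^ 2) t := by
  refine ((S.dp t).fun_div (S.dx t) hx).congr_deriv ?_
  unfold J G; ring

theorem continuous_x (S : ReducedFlow σ β κ g x p w) : Continuous x :=
  continuous_iff_continuousAt.2 fun t => (S.dx t).continuousAt

theorem continuous_p (S : ReducedFlow σ β κ g x p w) : Continuous p :=
  continuous_iff_continuousAt.2 fun t => (S.dp t).continuousAt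

theorem continuous_J (S : ReducedFlow σ β κ g x p w) : Continuous (J σ g x p w) :=
  continuous_iff_continuousAt.2 fun t => (S.hasDerivAt_J t).continuousAt

theorem continuous_G (S : ReducedFlow σ β κ g x p w) : Continuous (G σ g x w) :=
  continuous_iff_continuousAt.2 fun t => (S.hasDerivAt_G t).continuousAt

theorem w_nonneg (S : ReducedFlow σ β κ g x p w) (hβ : 0 < β) (hκ : 0 ≤ κ)
    (hw : Tendsto w atBot (𝓝 0)) (t : ℝ) : 0 ≤ w t :=
  nonneg_of_deriv_add_nonneg_atBot hβ.le (fun s _ => S.dw s) hw fun s _ => by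
    have := mul_nonneg hκ (sq_nonneg (x s))
    linarith

theorem w_pos_of_lt (S : ReducedFlow σ β κ g x p w) (hβ : 0 < β) (hκ : 0 < κ)
    (hw : Tendsto w atBot (𝓝 0)) {t s : ℝ} (hts : t < s) (hx : x t ≠ 0) : 0 < w s := by
  have hmono : 0 < w t → 0 < w s := fun h =>
    pos_of_deriv_add_nonneg hts.le (a := β) (fun r _ => S.dw r) (fun r _ => by
      have := mul_nonneg hκ.le (sq_nonneg (x r))
      linarith) h
  by_contra hs
  have h1 : w t = 0 := le_antisymm (not_lt.1 fun h => hs (hmono h)) (S.w_nonneg hβ hκ.le hw t)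
  have hmin : IsLocalMin w t := Eventually.of_forall fun r => by
    rw [h1]; exact S.w_nonneg hβ hκ.le hw r
  have h2 := hmin.hasDerivAt_eq_zero (S.dw t)
  have : 0 < κ * x t ^ 2 := by positivity
  rw [h1] at h2
  linarith

end ReducedFlow

open ReducedFlow in
/-- The branch with `x > 0` of the unstable manifold of the origin, where `lam` is the unstable
eigenvalue. -/
structure IsSeparatrix (σ β κ lam : ℝ) (x p w : ℝ → ℝ) : Prop where
  flow : ReducedFlow σ β κ (lam ^ 2 + (σ + 1) * lam) x p w
  x_bot : Tendsto x atBot (𝓝 0)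
  p_bot : Tendsto p atBot (𝓝 0)
  w_bot : Tendsto w atBot (𝓝 0)
  x_pos : ∀ t ≤ 0, 0 < x t
  p_pos : ∀ t ≤ 0, 0 < p t
  slope_bot : Tendsto (fun t => p t / x t) atBot (𝓝 lam)
  bdd : ∃ M, ∀ t, 0 ≤ t → |x t| ≤ M

namespace IsSeparatrix

open ReducedFlow

variable {σ β κ lam : ℝ} {x p w : ℝ → ℝ}

local notation "g" => lam ^ 2 + (σ + 1) * lam

theorem w_pos (S : IsSeparatrix σ β κ lam x p w) (hβ : 0 < β) (hκ : 0 < κ) (t : ℝ) : 0 < w t :=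
  S.flow.w_pos_of_lt hβ hκ S.w_bot (t := min t 0 - 1) (by linarith [min_le_left t 0])
    (S.x_pos _ (by linarith [min_le_right t 0])).ne'

theorem Q_bot (S : IsSeparatrix σ β κ lam x p w) : Tendsto (Q β κ x w) atBot (𝓝 0) := by
  have h := ((S.x_bot.pow 2).const_mul κ).sub (S.w_bot.const_mul β)
  exact tendsto_nhds_of_eq h (by ring)

theorem J_bot (S : IsSeparatrix σ β κ lam x p w) : Tendsto (J σ g x p w) atBot (𝓝 0) := by
  have h := (S.x_bot.mul ((S.p_bot.const_mul (-(σ + 1))).add (S.x_bot.mul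
    ((((S.x_bot.pow 2).div_const 2).const_sub g).sub (S.w_bot.const_mul σ))))).sub (S.p_bot.pow 2)
  exact tendsto_nhds_of_eq h (by ring)

theorem F_bot (S : IsSeparatrix σ β κ lam x p w) : Tendsto (F σ g x p w) atBot (𝓝 0) := by
  have h := (((((S.p_bot.pow 2).div_const 2).add
    ((S.x_bot.mul S.p_bot).const_mul ((σ + 1) / 2))).sub
    (((S.x_bot.pow 2).const_mul g).div_const 2)).add ((S.x_bot.pow 4).div_const 8)).add
    (((S.x_bot.pow 2).mul S.w_bot).const_mul (σ / 2))
  exact tendsto_nhds_of_eq h (by ring)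

theorem G_bot (S : IsSeparatrix σ β κ lam x p w) : Tendsto (G σ g x w) atBot (𝓝 g) := by
  have h := (((S.x_bot.pow 2).div_const 2).const_sub g).sub (S.w_bot.const_mul σ)
  exact tendsto_nhds_of_eq h (by ring)

theorem Q_pos (S : IsSeparatrix σ β κ lam x p w) (hβ : 0 < β) (hκ : 0 < κ) {T : ℝ}
    (h : ∀ t < T, 0 < x t ∧ 0 < p t) : 0 < Q β κ x w T :=
  pos_of_deriv_add_pos_atBot hβ.le (fun t _ => S.flow.hasDerivAt_Q t) S.Q_bot fun t ht => by
    have := mul_pos hκ (mul_pos (h t ht).1 (h t ht).2)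
    linarith

theorem K_neg (S : IsSeparatrix σ β κ lam x p w) (hσ : 0 < σ) (hβ : 0 < β) (hκ : 0 < κ) {T : ℝ}
    (h : ∀ t < T, 0 < x t ∧ 0 < p t) (hT : 0 ≤ x T * p T) : K σ β κ x p w T < 0 := by
  have := mul_pos hσ (S.Q_pos hβ hκ h)
  unfold K; linarith

theorem J_neg_of_rise (S : IsSeparatrix σ β κ lam x p w) (hσ : 0 < σ) (hβ : 0 < β) (hκ : 0 < κ)
    {T : ℝ} (h : ∀ t < T, 0 < x t ∧ 0 < p t) : J σ g x p w T < 0 := by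
  have key := pos_of_deriv_add_pos_atBot (a := σ + 1) (f := fun t => -J σ g x p w t) (T := T)
    (by linarith) (fun t _ => (S.flow.hasDerivAt_J t).fun_neg) (by simpa using S.J_bot.neg)
    (fun t ht => by
      have h1 := S.K_neg hσ hβ hκ (T := t) (fun s hs => h s (hs.trans ht))
        (mul_pos (h t ht).1 (h t ht).2).le
      have h2 := mul_pos (pow_pos (h t ht).1 2) (neg_pos.2 h1)
      linarith)
  linarith

theorem J_neg_of_nonpos (S : IsSeparatrix σ β κ lam x p w) (hσ : 0 < σ) (hβ : 0 < β) (hκ : 0 < κ)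
    {T : ℝ} (hT : T ≤ 0) : J σ g x p w T < 0 :=
  S.J_neg_of_rise hσ hβ hκ fun t ht => ⟨S.x_pos t (by linarith), S.p_pos t (by linarith)⟩

theorem slope_strictAntiOn (S : IsSeparatrix σ β κ lam x p w) {T : ℝ}
    (hx : ∀ t ≤ T, 0 < x t) (hJ : ∀ t < T, J σ g x p w t < 0) :
    StrictAntiOn (fun t => p t / x t) (Set.Iic T) := by
  refine strictAntiOn_of_deriv_neg (convex_Iic T)
    (fun t ht => (S.flow.hasDerivAt_slope (hx t ht).ne').continuousAt.continuousWithinAt)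
    fun t ht => ?_
  rw [interior_Iic] at ht
  have hxt := hx t (le_of_lt ht)
  rw [(S.flow.hasDerivAt_slope hxt.ne').deriv]
  exact div_neg_of_neg_of_pos (hJ t ht) (by positivity)

theorem p_pos_of_nonneg (S : IsSeparatrix σ β κ lam x p w) {T : ℝ}
    (hx : ∀ t ≤ T, 0 < x t) (hJ : ∀ t < T, J σ g x p w t < 0) (hp : 0 ≤ p T) :
    ∀ t < T, 0 < p t := fun t ht => by
  have h := S.slope_strictAntiOn hx hJ (Set.mem_Iic.2 ht.le) (Set.mem_Iic.2 le_rfl) ht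
  have h2 : 0 ≤ p T / x T := div_nonneg hp (hx T le_rfl).le
  have h3 : 0 < p t / x t := lt_of_le_of_lt h2 h
  exact (div_pos_iff_of_pos_right (hx t ht.le)).1 h3

theorem slope_lt (S : IsSeparatrix σ β κ lam x p w) {T : ℝ}
    (hx : ∀ t ≤ T, 0 < x t) (hJ : ∀ t < T, J σ g x p w t < 0) : p T < lam * x T := by
  have hanti := S.slope_strictAntiOn hx hJ
  have h1 : p (T - 1) / x (T - 1) ≤ lam := by
    refine ge_of_tendsto S.slope_bot ?_
    filter_upwards [eventually_le_atBot (T - 1)] with s hs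
    exact hanti.antitoneOn (Set.mem_Iic.2 (by linarith)) (Set.mem_Iic.2 (by linarith)) hs
  have h2 := hanti (Set.mem_Iic.2 (by linarith : T - 1 ≤ T)) (Set.mem_Iic.2 le_rfl) (by linarith)
  have h3 : p T / x T < lam := lt_of_lt_of_le h2 h1
  exact (div_lt_iff₀ (hx T le_rfl)).1 h3

/-- When the slope `p / x` stops decreasing, its derivative crosses zero transversally. -/
theorem K_pos_of_J_eq_zero (S : IsSeparatrix σ β κ lam x p w) (hσ : 0 < σ) (hβ : 0 < β)
    (hκ : 0 < κ) (hκ' : 2 * σ * κ = 2 * σ - β) {T : ℝ}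
    (hx : ∀ t ≤ T, 0 < x t) (hJ : ∀ t < T, J σ g x p w t < 0) (hT : J σ g x p w T = 0) :
    0 < K σ β κ x p w T := by
  have hxT := hx T le_rfl
  have hp : p T < 0 := by
    by_contra! hp
    have := S.J_neg_of_rise hσ hβ hκ (T := T) fun t ht =>
      ⟨hx t ht.le, S.p_pos_of_nonneg hx hJ hp t ht⟩
    linarith
  by_contra! hK
  have hKc : ContinuousAt (K σ β κ x p w) T := (S.flow.hasDerivAt_K hκ' T).continuousAt
  have hbefore : ∀ᶠ t in 𝓝[<] T, K σ β κ x p w t < 0 := by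
    rcases hK.eq_or_lt with h0 | h0
    · have hm : -(σ * κ * x T) < p T := by
        by_contra! hm
        have h1 : 0 ≤ x T * (-(σ * κ * x T) - p T) := mul_nonneg hxT.le (by linarith)
        have h2 := mul_pos (mul_pos hσ hβ) (S.w_pos hβ hκ T)
        unfold K Q at h0
        nlinarith
      have hd : 0 < -β * K σ β κ x p w T - J σ g x p w T - 2 * p T * (p T + σ * x T) := by
        rw [h0, hT]
        have h1 : 0 < p T + σ * x T := by nlinarith
        have := mul_pos (neg_pos.2 hp) h1
        linarith
      have h := (S.flow.hasDerivAt_K hκ' T).tendsto_slope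
      have h2 : ∀ᶠ t in 𝓝[≠] T, 0 < slope (K σ β κ x p w) T t := h.eventually (lt_mem_nhds hd)
      have h3 := h2.filter_mono (nhdsWithin_mono T (fun t (ht : t < T) => ht.ne) :
        𝓝[<] T ≤ 𝓝[≠] T)
      filter_upwards [h3, self_mem_nhdsWithin] with t ht ht2
      rw [slope_def_field, h0, sub_zero] at ht
      have ht2' : t - T < 0 := sub_neg.2 ht2
      by_contra! h5
      have := div_nonpos_of_nonneg_of_nonpos h5 ht2'.le
      linarith
    · exact (hKc.eventually (gt_mem_nhds h0)).filter_mono nhdsWithin_le_nhds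
  obtain ⟨l, hl, hl2⟩ := (mem_nhdsLT_iff_exists_Ioo_subset).1 hbefore
  have hl' : l < T := hl
  set t₀ := (l + T) / 2 with ht₀
  have key := pos_of_deriv_add_pos (a := σ + 1) (f := fun t => -J σ g x p w t) (T := T) (t₀ := t₀)
    (by linarith) (fun t _ => (S.flow.hasDerivAt_J t).fun_neg)
    (fun t ht => by
      have h1 : K σ β κ x p w t < 0 := hl2 ⟨by linarith [ht.1], ht.2⟩
      have h2 := mul_pos (pow_pos (hx t ht.2.le) 2) (neg_pos.2 h1)
      linarith) (by have := hJ t₀ (by linarith); linarith)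
  linarith

theorem exists_first_zero {f : ℝ → ℝ} (hf : Continuous f) {a b : ℝ} (hab : a ≤ b)
    (ha : f a < 0) (hb : 0 ≤ f b) :
    ∃ c, a < c ∧ c ≤ b ∧ f c = 0 ∧ ∀ t, a ≤ t → t < c → f t < 0 := by
  set s : Set ℝ := Set.Icc a b ∩ f ⁻¹' Set.Ici 0
  have hs : IsCompact s := isCompact_Icc.inter_right (isClosed_Ici.preimage hf)
  obtain ⟨c, hc, hmin⟩ := hs.exists_isLeast ⟨b, ⟨hab, le_rfl⟩, hb⟩
  have hlt : ∀ t, a ≤ t → t < c → f t < 0 := fun t hat htc => by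
    by_contra! h
    have := hmin ⟨⟨hat, by linarith [hc.1.2]⟩, h⟩
    linarith
  have hac : a < c := lt_of_le_of_ne hc.1.1 (by rintro rfl; exact absurd hc.2 (not_le.2 ha))
  refine ⟨c, hac, hc.1.2, le_antisymm ?_ hc.2, hlt⟩
  refine le_of_tendsto (hf.continuousAt.tendsto.mono_left nhdsWithin_le_nhds :
    Tendsto f (𝓝[<] c) (𝓝 (f c))) ?_
  filter_upwards [Ioo_mem_nhdsLT hac] with t ht
  exact (hlt t ht.1.le ht.2).le

end IsSeparatrix

namespace ReducedFlow

variable {σ β κ g : ℝ} {x p w : ℝ → ℝ}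

/-- The trajectory of the Lorenz system described by the reduced coordinates. -/
noncomputable def toLorenz (σ : ℝ) (x p w : ℝ → ℝ) (t : ℝ) : ℝ × ℝ × ℝ :=
  (x t, x t + p t / σ, x t ^ 2 / (2 * σ) + w t)

theorem hasDerivAt_toLorenz (S : ReducedFlow σ β κ g x p w) (hσ : 0 < σ)
    (hκ : 2 * σ * κ = 2 * σ - β) (t : ℝ) :
    HasDerivAt (toLorenz σ x p w) (lorenzRHS σ (1 + g / σ) β (toLorenz σ x p w t)) t := by
  have hκ' : κ = 1 - β / (2 * σ) := by field_simp; linarith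
  have h := (S.dx t).prodMk (((S.dx t).fun_add ((S.dp t).div_const σ)).prodMk
    ((((S.dx t).fun_pow 2).div_const (2 * σ)).fun_add (S.dw t)))
  refine h.congr_deriv ?_
  unfold lorenzRHS toLorenz
  refine Prod.ext ?_ (Prod.ext ?_ ?_)
  · simp; field_simp
  · simp; field_simp; ring
  · simp only [hκ']; field_simp; push_cast; ring

theorem tendsto_toLorenz {l : Filter ℝ} (hx : Tendsto x l (𝓝 0)) (hp : Tendsto p l (𝓝 0))
    (hw : Tendsto w l (𝓝 0)) : Tendsto (toLorenz σ x p w) l (𝓝 0) := by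
  have h := hx.prodMk_nhds ((hx.add (hp.div_const σ)).prodMk_nhds
    (((hx.pow 2).div_const (2 * σ)).add hw))
  have e : ((0 : ℝ), (0 : ℝ) + 0 / σ, (0 : ℝ) ^ 2 / (2 * σ) + 0) = 0 := by
    simp
  rw [e] at h
  exact h

end ReducedFlow

namespace IsSeparatrix

open ReducedFlow

variable {σ β κ lam : ℝ} {x p w : ℝ → ℝ}

local notation "g" => lam ^ 2 + (σ + 1) * lam

variable (σ lam x p w) in
/-- The separatrix reaches `x = 0` before the slope `p / x` stops decreasing. -/
def Crosses : Prop :=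
  ∃ τ, x τ < 0 ∧ ∀ t ≤ τ, J σ g x p w t < 0

variable (σ lam x p w) in
/-- The slope `p / x` stops decreasing while `x > 0`. -/
def Turns : Prop :=
  ∃ τ, 0 < J σ g x p w τ ∧ ∀ t ≤ τ, 0 < x t

theorem not_turns_of_crosses (hA : Crosses σ lam x p w) : ¬ Turns σ lam x p w := by
  rintro ⟨τ, h1, h2⟩
  obtain ⟨s, h3, h4⟩ := hA
  rcases le_total τ s with h | h
  · exact absurd (h4 τ h) (by linarith)
  · exact absurd (h2 s h) (by linarith)

theorem exists_homoclinic (S : IsSeparatrix σ β κ lam x p w) (hσ : 0 < σ) (hβ : 0 < β)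
    (hκ : 2 * σ * κ = 2 * σ - β) (hlam : 0 < lam) (hpos : ∀ t, 0 < x t)
    (hJ : ∀ t, J σ g x p w t < 0) {t₀ : ℝ} (ht₀ : p t₀ ≤ 0) :
    ∃ ρ : ℝ, 1 < ρ ∧ ∃ u : ℝ → ℝ × ℝ × ℝ,
      (∀ t : ℝ, HasDerivAt u (lorenzRHS σ ρ β (u t)) t) ∧
      (∃ t₁ t₂ : ℝ, u t₁ ≠ u t₂) ∧
      Tendsto u atTop (nhds 0) ∧ Tendsto u atBot (nhds 0) := by
  have hanti : ∀ s t, s < t → p t / x t < p s / x s := fun s t hst =>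
    S.slope_strictAntiOn (T := t) (fun r _ => hpos r) (fun r _ => hJ r) (Set.mem_Iic.2 hst.le)
      (Set.mem_Iic.2 le_rfl) hst
  obtain ⟨c, hc, hcle⟩ : ∃ c, 0 < c ∧ ∀ t, t₀ + 1 ≤ t → p t ≤ -c * x t := by
    refine ⟨-(p (t₀ + 1) / x (t₀ + 1)), ?_, fun t ht => ?_⟩
    · have h1 := hanti t₀ (t₀ + 1) (by linarith)
      have h2 := div_nonpos_of_nonpos_of_nonneg ht₀ (hpos t₀).le
      linarith
    · have h1 : p t / x t ≤ p (t₀ + 1) / x (t₀ + 1) := by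
        rcases ht.eq_or_lt with h | h
        · rw [h]
        · exact (hanti _ _ h).le
      rw [div_le_iff₀ (hpos t)] at h1
      linarith
  have hx : Tendsto x atTop (𝓝 0) := by
    have hb : ∀ t, t₀ + 1 ≤ t →
        x t ≤ Real.exp (c * (t₀ + 1)) * x (t₀ + 1) * Real.exp (-(c * t)) := fun t ht => by
      have h := monotoneOn_exp_mul_of_deriv (a := c) (t₀ := t₀ + 1) (T := t)
        (fun s _ => (S.flow.dx s).fun_neg) (fun s hs => by
          have := hcle s hs.1.le
          linarith) (Set.left_mem_Icc.2 ht) (Set.right_mem_Icc.2 ht) ht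
      simp only [mul_neg, neg_le_neg_iff] at h
      rw [Real.exp_neg, ← div_eq_mul_inv, le_div_iff₀ (Real.exp_pos _)]
      linarith
    have hlim : Tendsto (fun t : ℝ => Real.exp (c * (t₀ + 1)) * x (t₀ + 1) * Real.exp (-(c * t)))
        atTop (𝓝 0) := by
      have h1 : Tendsto (fun t : ℝ => c * t) atTop atTop := tendsto_id.const_mul_atTop hc
      simpa using (Real.tendsto_exp_neg_atTop_nhds_zero.comp h1).const_mul
        (Real.exp (c * (t₀ + 1)) * x (t₀ + 1))
    refine squeeze_zero' (Eventually.of_forall fun t => (hpos t).le) ?_ hlim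
    filter_upwards [eventually_ge_atTop (t₀ + 1)] with t ht using hb t ht
  have hw : Tendsto w atTop (𝓝 0) := by
    refine tendsto_zero_of_linear_forced hβ (φ := fun t => κ * x t ^ 2)
      (fun t => (S.flow.dw t).congr_deriv (by ring)) ?_
    exact tendsto_nhds_of_eq ((hx.pow 2).const_mul κ) (by ring)
  have hp : Tendsto p atTop (𝓝 0) := by
    refine tendsto_zero_of_linear_forced (a := σ + 1) (by linarith) (fun t => S.flow.dp t) ?_
    exact tendsto_nhds_of_eq (hx.mul ((((hx.pow 2).div_const 2).const_sub g).sub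
      (hw.const_mul σ))) (by ring)
  refine ⟨1 + g / σ, ?_, toLorenz σ x p w, S.flow.hasDerivAt_toLorenz hσ hκ, ?_,
    tendsto_toLorenz hx hp hw, tendsto_toLorenz S.x_bot S.p_bot S.w_bot⟩
  · have : 0 < g / σ := by positivity
    linarith
  · by_contra! hconst
    have h1 : ∀ t, x t = x 0 := fun t => congrArg Prod.fst (hconst t 0)
    have h2 : Tendsto x atTop (𝓝 (x 0)) :=
      tendsto_const_nhds.congr fun t => (h1 t).symm
    exact absurd (tendsto_nhds_unique hx h2) (hpos 0).ne

/-- A separatrix either crosses, turns, or stays in the region `x > 0`, `J < 0`. -/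
theorem trichotomy (S : IsSeparatrix σ β κ lam x p w) (hσ : 0 < σ) (hβ : 0 < β) (hκ : 0 < κ)
    (hκ' : 2 * σ * κ = 2 * σ - β) :
    Crosses σ lam x p w ∨ Turns σ lam x p w ∨ ∀ t, 0 < x t ∧ J σ g x p w t < 0 := by
  have hxne : ∀ t, J σ g x p w t < 0 → (∀ᶠ s in 𝓝 t, 0 ≤ x s) → 0 < x t := fun t hJt hx => by
    refine lt_of_le_of_ne hx.self_of_nhds fun h0 => ?_
    have hmin : IsLocalMin x t := by
      filter_upwards [hx] with s hs
      rw [← h0]; exact hs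
    have hp := hmin.hasDerivAt_eq_zero (S.flow.dx t)
    unfold J at hJt
    rw [← h0, hp] at hJt
    simp at hJt
  by_cases hJ : ∀ t, J σ g x p w t < 0
  · by_cases hx : ∀ t, 0 ≤ x t
    · exact Or.inr (Or.inr fun t => ⟨hxne t (hJ t) (Eventually.of_forall hx), hJ t⟩)
    · push Not at hx
      obtain ⟨τ, hτ⟩ := hx
      exact Or.inl ⟨τ, hτ, fun t _ => hJ t⟩
  push Not at hJ
  obtain ⟨t₁, ht₁⟩ := hJ
  have h0 := S.J_neg_of_nonpos hσ hβ hκ (le_refl 0)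
  have ht₁0 : 0 ≤ t₁ := by
    by_contra! h
    have := S.J_neg_of_nonpos hσ hβ hκ h.le
    linarith
  obtain ⟨T, hT0, -, hJT, hJlt⟩ := exists_first_zero S.flow.continuous_J ht₁0 h0 ht₁
  have hJlt' : ∀ t < T, J σ g x p w t < 0 := fun t ht => by
    rcases le_total t 0 with h | h
    · exact S.J_neg_of_nonpos hσ hβ hκ h
    · exact hJlt t h ht
  by_cases hneg : ∃ t < T, x t < 0
  · obtain ⟨τ, hτT, hτ⟩ := hneg
    exact Or.inl ⟨τ, hτ, fun t ht => hJlt' t (by linarith)⟩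
  push Not at hneg
  have hxlt : ∀ t < T, 0 < x t := fun t ht => hxne t (hJlt' t ht) (by
    filter_upwards [gt_mem_nhds ht] with s hs using hneg s hs)
  have hxT : 0 < x T := by
    have hge : 0 ≤ x T := by
      refine ge_of_tendsto (S.flow.continuous_x.continuousAt.tendsto.mono_left
        nhdsWithin_le_nhds : Tendsto x (𝓝[<] T) (𝓝 (x T))) ?_
      filter_upwards [self_mem_nhdsWithin] with t ht using (hxlt t ht).le
    refine lt_of_le_of_ne hge fun hxT => ?_
    have hpT : p T = 0 := by
      unfold J at hJT
      rw [← hxT] at hJT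
      simpa using hJT
    obtain ⟨M, hM⟩ := isCompact_Icc.exists_bound_of_continuousOn
      (S.flow.continuous_G.continuousOn (s := Set.Icc 0 T))
    have key := pos_of_deriv_add_nonneg (a := 1 + M + 2 * (σ + 1))
      (f := fun t => x t ^ 2 + p t ^ 2) hT0.le
      (fun t _ => ((S.flow.dx t).fun_pow 2).fun_add ((S.flow.dp t).fun_pow 2))
      (fun t ht => by
        have h1 := abs_le.1 (hM t (Set.Ioo_subset_Icc_self ht))
        unfold G at h1
        have h2 : |x t * p t| * 2 ≤ x t ^ 2 + p t ^ 2 := by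
          rw [abs_mul, ← sq_abs (x t), ← sq_abs (p t)]
          nlinarith [sq_nonneg (|x t| - |p t|)]
        have h3 : |1 + (g - x t ^ 2 / 2 - σ * w t)| ≤ 1 + M := by
          rw [abs_le]; constructor <;> linarith
        have h4 : |2 * (x t * p t) * (1 + (g - x t ^ 2 / 2 - σ * w t))|
            ≤ (x t ^ 2 + p t ^ 2) * (1 + M) := by
          rw [abs_mul]
          refine mul_le_mul ?_ h3 (abs_nonneg _) (by positivity)
          rw [abs_mul, abs_two]; linarith
        have h5 := neg_abs_le (2 * (x t * p t) * (1 + (g - x t ^ 2 / 2 - σ * w t)))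
        have h6 : 0 ≤ (σ + 1) * x t ^ 2 := by positivity
        push_cast
        nlinarith)
      (by have := S.x_pos 0 le_rfl; positivity)
    simp [← hxT, hpT] at key
  have hK := S.K_pos_of_J_eq_zero hσ hβ hκ hκ' (T := T) (fun t ht => by
    rcases ht.eq_or_lt with h | h
    · rw [h]; exact hxT
    · exact hxlt t h) hJlt' hJT
  refine Or.inr (Or.inl ?_)
  have hd : 0 < -(σ + 1) * J σ g x p w T + x T ^ 2 * K σ β κ x p w T := by
    rw [hJT]; have : 0 < x T ^ 2 * K σ β κ x p w T := by positivity
    linarith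
  have h1 : ∀ᶠ t in 𝓝[>] T, 0 < J σ g x p w t := by
    have h2 : ∀ᶠ t in 𝓝[≠] T, 0 < slope (J σ g x p w) T t :=
      (S.flow.hasDerivAt_J T).tendsto_slope.eventually (lt_mem_nhds hd)
    have h3 := h2.filter_mono (nhdsWithin_mono T (fun t (ht : T < t) => ht.ne') :
      𝓝[>] T ≤ 𝓝[≠] T)
    filter_upwards [h3, self_mem_nhdsWithin] with t ht ht2
    rw [slope_def_field, hJT, sub_zero] at ht
    exact (div_pos_iff_of_pos_right (sub_pos.2 ht2)).1 ht
  have h2 : ∀ᶠ t in 𝓝 T, 0 < x t := S.flow.continuous_x.continuousAt.eventually (lt_mem_nhds hxT)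
  obtain ⟨ε, hε, hball⟩ := Metric.eventually_nhds_iff.1 h2
  obtain ⟨τ, hτJ, hτ⟩ := (h1.and (Ioo_mem_nhdsGT (show T < T + ε by linarith))).exists
  refine ⟨τ, hτJ, fun t ht => ?_⟩
  rcases lt_or_ge t T with h | h
  · exact hxlt t h
  · refine hball ?_
    rw [Real.dist_eq, abs_lt]
    constructor <;> linarith [hτ.2]

end IsSeparatrix

namespace IsSeparatrix

open ReducedFlow

variable {σ β κ lam : ℝ} {x p w : ℝ → ℝ}

local notation "g" => lam ^ 2 + (σ + 1) * lam

theorem x_mono (S : IsSeparatrix σ β κ lam x p w) {T : ℝ} (hp : ∀ t < T, 0 < p t) :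
    MonotoneOn x (Set.Iic T) := by
  refine monotoneOn_of_deriv_nonneg (convex_Iic T) S.flow.continuous_x.continuousOn
    (fun t _ => (S.flow.dx t).differentiableAt.differentiableWithinAt) fun t ht => ?_
  rw [interior_Iic] at ht
  rw [(S.flow.dx t).deriv]
  exact (hp t ht).le

theorem x_pos_of_p_pos (S : IsSeparatrix σ β κ lam x p w) {T : ℝ} (hp : ∀ t < T, 0 < p t) :
    ∀ t ≤ T, 0 < x t := fun t ht => by
  rcases le_total t 0 with h | h
  · exact S.x_pos t h
  · exact lt_of_lt_of_le (S.x_pos 0 le_rfl)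
      (S.x_mono hp (Set.mem_Iic.2 (h.trans ht)) (Set.mem_Iic.2 ht) h)

theorem antitoneOn_G (S : IsSeparatrix σ β κ lam x p w) (hσ : 0 < σ) (hβ : 0 < β) (hκ : 0 < κ)
    {T : ℝ} (hp : ∀ t < T, 0 < p t) : StrictAntiOn (G σ g x w) (Set.Iic T) := by
  refine strictAntiOn_of_deriv_neg (convex_Iic T) S.flow.continuous_G.continuousOn fun t ht => ?_
  rw [interior_Iic] at ht
  have ht' : t < T := ht
  rw [(S.flow.hasDerivAt_G t).deriv]
  have hx := S.x_pos_of_p_pos hp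
  exact S.K_neg hσ hβ hκ (fun s hs => ⟨hx s (hs.trans ht').le, hp s (hs.trans ht')⟩)
    (mul_pos (hx t ht'.le) (hp t ht')).le

/-- A separatrix that rises forever converges to an equilibrium. -/
theorem tendsto_of_rise (S : IsSeparatrix σ β κ lam x p w) (hσ : 0 < σ) (hβ : 0 < β)
    (hpos : ∀ t, 0 < x t) (hJ : ∀ t, J σ g x p w t < 0) (hp : ∀ t, 0 < p t) :
    ∃ X, 0 < X ∧ Tendsto x atTop (𝓝 X) ∧ Tendsto p atTop (𝓝 0) ∧
      Tendsto (Q β κ x w) atTop (𝓝 0) ∧ Tendsto (G σ g x w) atTop (𝓝 0) := by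
  have hmono : Monotone x := fun s t hst =>
    S.x_mono (T := t) (fun r _ => hp r) (Set.mem_Iic.2 hst) (Set.mem_Iic.2 le_rfl) hst
  obtain ⟨M, hM⟩ := S.bdd
  have hbdd : BddAbove (Set.range x) := by
    refine ⟨M, ?_⟩
    rintro _ ⟨t, rfl⟩
    exact (hmono (le_max_left t 0)).trans ((le_abs_self _).trans (hM _ (le_max_right t 0)))
  have hX := tendsto_atTop_ciSup hmono hbdd
  set X := ⨆ t, x t
  have hX0 : 0 < X := lt_of_lt_of_le (hpos 0) (le_ciSup hbdd 0)
  have hvanti : Antitone fun t => p t / x t := fun s t hst =>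
    (S.slope_strictAntiOn (T := t) (fun r _ => hpos r) (fun r _ => hJ r)).antitoneOn
      (Set.mem_Iic.2 hst) (Set.mem_Iic.2 le_rfl) hst
  have hv := tendsto_atTop_ciInf hvanti
    ⟨0, by rintro _ ⟨t, rfl⟩; exact (div_pos (hp t) (hpos t)).le⟩
  set v := ⨅ t, p t / x t
  have hp1 : Tendsto p atTop (𝓝 (v * X)) :=
    (hv.mul hX).congr fun t => div_mul_cancel₀ _ (hpos t).ne'
  have hvX : v * X = 0 := by
    have h1 : Tendsto (fun t => x t - (X + v * X)) atTop (𝓝 0) := by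
      refine tendsto_zero_of_linear_forced one_pos
        (φ := fun t => p t + x t - (X + v * X))
        (fun t => ((S.flow.dx t).sub_const _).congr_deriv (by ring)) ?_
      exact tendsto_nhds_of_eq ((hp1.add hX).sub_const _) (by ring)
    have h2 := tendsto_nhds_unique h1 (hX.sub_const _)
    linarith
  rw [hvX] at hp1
  have hw : Tendsto (fun t => w t - κ * X ^ 2 / β) atTop (𝓝 0) := by
    refine tendsto_zero_of_linear_forced hβ (φ := fun t => κ * x t ^ 2 - κ * X ^ 2)
      (fun t => ((S.flow.dw t).sub_const _).congr_deriv (by field_simp; ring)) ?_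
    exact tendsto_nhds_of_eq (((hX.pow 2).const_mul κ).sub_const _) (by ring)
  have hw' : Tendsto w atTop (𝓝 (κ * X ^ 2 / β)) :=
    tendsto_nhds_of_eq ((hw.add_const (κ * X ^ 2 / β)).congr fun t => by ring) (by ring)
  have hQ : Tendsto (Q β κ x w) atTop (𝓝 0) :=
    tendsto_nhds_of_eq (((hX.pow 2).const_mul κ).sub (hw'.const_mul β)) (by field_simp; ring)
  have hG : Tendsto (G σ g x w) atTop (𝓝 (g - X ^ 2 / 2 - σ * (κ * X ^ 2 / β))) :=
    (((hX.pow 2).div_const 2).const_sub g).sub (hw'.const_mul σ)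
  set H := g - X ^ 2 / 2 - σ * (κ * X ^ 2 / β) with hH
  have hσ1 : 0 < σ + 1 := by linarith
  have hH0 : H = 0 := by
    have h1 : Tendsto (fun t => p t - X * H / (σ + 1)) atTop (𝓝 0) := by
      refine tendsto_zero_of_linear_forced hσ1
        (φ := fun t => x t * G σ g x w t - X * H)
        (fun t => ((S.flow.dp t).sub_const _).congr_deriv (by unfold G; field_simp; ring)) ?_
      exact tendsto_nhds_of_eq ((hX.mul hG).sub_const _) (by ring)
    have h2 := tendsto_nhds_unique h1 (hp1.sub_const _)
    have h3 : X * H / (σ + 1) = 0 := by linarith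
    simpa [hX0.ne', hσ1.ne'] using h3
  exact ⟨X, hX0, hX, hp1, hQ, hH0 ▸ hG⟩

/-- The energy balance on the fall of a crossing separatrix from its peak to `x = 0`. -/
theorem peak_bound (S : IsSeparatrix σ β κ lam x p w) (hσ : 0 < σ) (hβ : 0 < β) (hκ : 0 < κ)
    {T₀ τ : ℝ} (hτ : T₀ < τ) (hp : ∀ t < T₀, 0 < p t) (hpT : p T₀ = 0)
    (hx : ∀ t < τ, 0 < x t) (hxτ : x τ = 0) (hJ : ∀ t ≤ τ, J σ g x p w t < 0) :
    g ≤ (1 / 4 + σ * κ / β) * x T₀ ^ 2 := by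
  have hx0 := hx T₀ hτ
  have hQ0 : 0 < Q β κ x w T₀ := S.Q_pos hβ hκ fun t ht => ⟨hx t (ht.trans hτ), hp t ht⟩
  have hpneg : ∀ t, T₀ < t → t < τ → p t < 0 := fun t h1 h2 => by
    have h3 := S.slope_strictAntiOn (T := t) (fun r hr => hx r (by linarith))
      (fun r hr => hJ r (by linarith)) (Set.mem_Iic.2 h1.le) (Set.mem_Iic.2 le_rfl) h1
    simp only [hpT, zero_div] at h3
    exact (div_neg_iff.1 h3).elim (fun h => absurd h.2 (by linarith [hx t h2])) fun h => h.1
  set Y : ℝ → ℝ := fun t => Real.exp (-β * (t - T₀)) * Q β κ x w T₀ with hY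
  have hYpos : ∀ t, 0 < Y t := fun t => mul_pos (Real.exp_pos _) hQ0
  have hYd : ∀ t, HasDerivAt Y (-β * Y t) t := fun t => by
    have h1 : HasDerivAt (fun s : ℝ => -β * (s - T₀)) (-β) t := by
      simpa using ((hasDerivAt_id t).sub_const T₀).const_mul (-β)
    exact (h1.exp.mul_const _).congr_deriv (by simp only [hY]; ring)
  have hQY : ∀ t, T₀ ≤ t → t ≤ τ → Q β κ x w t ≤ Y t := fun t h1 h2 => by
    have := nonneg_of_deriv_add_nonneg (a := β) (f := fun t => Y t - Q β κ x w t) h1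
      (fun s _ => (hYd s).fun_sub (S.flow.hasDerivAt_Q s))
      (fun s hs => by
        have := mul_pos hκ (mul_pos (hx s (by linarith [hs.2]))
          (neg_pos.2 (hpneg s hs.1 (by linarith [hs.2]))))
        linarith) (by simp [hY])
    linarith
  have key := monotoneOn_exp_mul_of_deriv (a := 0) (t₀ := T₀) (T := τ)
    (f := fun t => -(p t ^ 2 / 2 - g * x t ^ 2 / 2 + x t ^ 4 / 8 + σ / 2 * (x t ^ 2 * w t)
      + σ / (2 * β) * (x t ^ 2 * Y t)))
    (fun t _ => (((((((S.flow.dp t).fun_pow 2).div_const 2).fun_sub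
      ((((S.flow.dx t).fun_pow 2).const_mul g).div_const 2)).fun_add
      (((S.flow.dx t).fun_pow 4).div_const 8)).fun_add
      ((((S.flow.dx t).fun_pow 2).fun_mul (S.flow.dw t)).const_mul (σ / 2))).fun_add
      ((((S.flow.dx t).fun_pow 2).fun_mul (hYd t)).const_mul (σ / (2 * β)))).fun_neg)
    (fun t ht => by
      have h1 := hQY t ht.1.le ht.2.le
      have h2 : 0 ≤ σ / 2 * (x t ^ 2 * (Y t - Q β κ x w t)) := by
        have := sub_nonneg.2 h1
        positivity
      have h3 : 0 ≤ σ / β * (x t * (-p t) * Y t) := by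
        have := hx t ht.2
        have := neg_pos.2 (hpneg t ht.1 ht.2)
        have := hYpos t
        positivity
      have h4 : 0 ≤ (σ + 1) * p t ^ 2 := by positivity
      have h5 : σ / (2 * β) * (x t ^ 2 * (-β * Y t)) = -(σ / 2 * (x t ^ 2 * Y t)) := by
        field_simp
      have h6 : σ / (2 * β) = σ / β / 2 := by field_simp
      unfold Q at h2
      push_cast
      rw [mul_add (σ / (2 * β)), h5, h6]
      linarith)
    (Set.left_mem_Icc.2 hτ.le) (Set.right_mem_Icc.2 hτ.le) hτ.le
  simp only [zero_mul, Real.exp_zero, one_mul, hxτ, hpT] at key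
  have hY0 : Y T₀ = κ * x T₀ ^ 2 - β * w T₀ := by simp [hY, Q]
  rw [hY0] at key
  have h7 : 0 ≤ x T₀ ^ 2 * ((1 / 4 + σ * κ / β) * x T₀ ^ 2 - g) := by
    have h8 : σ / (2 * β) * (x T₀ ^ 2 * (κ * x T₀ ^ 2 - β * w T₀)) =
        σ * κ / β * x T₀ ^ 4 / 2 - σ / 2 * (x T₀ ^ 2 * w T₀) := by field_simp
    rw [h8] at key
    nlinarith [sq_nonneg (p τ)]
  have h9 := nonneg_of_mul_nonneg_right h7 (by positivity)
  linarith

/-- The state of a crossing separatrix at the time where `G` vanishes on the rise. -/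
theorem crosses_bound (S : IsSeparatrix σ β κ lam x p w) (hσ : 0 < σ) (hβ : 0 < β) (hκ : 0 < κ)
    (hA : Crosses σ lam x p w) {T : ℝ} (hp : ∀ t ≤ T, 0 < p t) (hG : 0 ≤ G σ g x w T) :
    ∃ T', T ≤ T' ∧ (∀ t ≤ T', 0 < p t) ∧ G σ g x w T' = 0 ∧
      (1 / 4 + σ * κ / β + 1 / 4) * x T' ^ 2 ≤
        (1 / 4 + σ * κ / β) * (x T' + p T' / (σ + 1)) ^ 2 + σ / β * Q β κ x w T' := by
  obtain ⟨τ, hxτ, hJ⟩ := hA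
  have hxT := S.x_pos_of_p_pos (fun t ht => hp t (le_of_lt ht))
  have hTτ : T < τ := by
    by_contra! h
    exact absurd (hxT τ h) (by linarith)
  obtain ⟨s, hTs, hsτ, hps⟩ : ∃ s, T ≤ s ∧ s ≤ τ ∧ p s ≤ 0 := by
    by_contra! h
    have := S.x_pos_of_p_pos (T := τ) (fun t ht => by
      rcases le_total t T with h1 | h1
      · exact hp t h1
      · exact h t h1 ht.le) τ le_rfl
    linarith
  obtain ⟨T₀, hT₀, hT₀s, hpT₀, hplt⟩ := exists_first_zero S.flow.continuous_p.neg hTs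
    (by simpa using hp T le_rfl) (by simpa using hps)
  have hpT₀' : p T₀ = 0 := by simpa using hpT₀
  have hp' : ∀ t < T₀, 0 < p t := fun t ht => by
    rcases le_total t T with h1 | h1
    · exact hp t h1
    · simpa using hplt t h1 ht
  have hx' := S.x_pos_of_p_pos hp'
  have hx₀ := hx' T₀ le_rfl
  obtain ⟨τ', hτ', hτ's, hxτ', hxlt⟩ := exists_first_zero S.flow.continuous_x.neg
    (hT₀s.trans hsτ) (by simpa using hx₀) (by simpa using hxτ.le)
  have hpeak := S.peak_bound hσ hβ hκ hτ' hp' hpT₀' (fun t ht => by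
    rcases le_total t T₀ with h1 | h1
    · exact hx' t h1
    · simpa using hxlt t h1 ht) (by simpa using hxτ') (fun t ht => hJ t (by linarith))
  have hG₀ : G σ g x w T₀ < 0 := by
    have h1 := hJ T₀ (by linarith)
    unfold J at h1
    rw [hpT₀'] at h1
    by_contra! h2
    have : 0 ≤ x T₀ * (x T₀ * G σ g x w T₀) := by positivity
    linarith
  obtain ⟨T', ⟨hT'1, hT'2⟩, hGT'⟩ := intermediate_value_Icc' hT₀.le
    (S.flow.continuous_G.continuousOn) (Set.mem_Icc.2 ⟨hG₀.le, hG⟩)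
  have hT'3 : T' < T₀ := lt_of_le_of_ne hT'2 (by rintro rfl; linarith)
  refine ⟨T', hT'1, fun t ht => hp' t (by linarith), hGT', ?_⟩
  have hxT' := hx' T' hT'2
  have hstiff := monotoneOn_exp_mul_of_deriv (a := 0) (t₀ := T') (T := T₀)
    (f := fun t => -(p t + (σ + 1) * x t))
    (fun t _ => ((S.flow.dp t).fun_add ((S.flow.dx t).const_mul (σ + 1))).fun_neg)
    (fun t ht => by
      have h1 : G σ g x w t ≤ 0 := by
        rw [← hGT']
        exact (S.antitoneOn_G hσ hβ hκ hp').antitoneOn (Set.mem_Iic.2 hT'2)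
          (Set.mem_Iic.2 ht.2.le) ht.1.le
      have h2 : x t * G σ g x w t ≤ 0 :=
        mul_nonpos_of_nonneg_of_nonpos (hx' t ht.2.le).le h1
      unfold G at h2
      linarith)
    (Set.left_mem_Icc.2 hT'2) (Set.right_mem_Icc.2 hT'2) hT'2
  simp only [zero_mul, Real.exp_zero, one_mul, hpT₀'] at hstiff
  have hσ1 : 0 < σ + 1 := by linarith
  have hx0le : x T₀ ≤ x T' + p T' / (σ + 1) := by
    rw [← sub_le_iff_le_add', le_div_iff₀ hσ1]; linarith
  have ha : 0 < 1 / 4 + σ * κ / β := by positivity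
  have hsq : x T₀ ^ 2 ≤ (x T' + p T' / (σ + 1)) ^ 2 := pow_le_pow_left₀ hx₀.le hx0le 2
  have h1 := mul_le_mul_of_nonneg_left hsq ha.le
  have h2 : σ / β * Q β κ x w T' = σ * κ / β * x T' ^ 2 - σ * w T' := by
    unfold Q; field_simp
  unfold G at hGT'
  rw [h2]
  linarith

/-- For small `lam` the separatrix does not cross. -/
theorem not_crosses_of_small (S : IsSeparatrix σ β κ lam x p w) (hσ : 0 < σ) (hβ : 0 < β)
    (hκ : 0 < κ) (hlam : 0 < lam)
    (h : (1 / 4 + σ * κ / β) * (1 + lam / (σ + 1)) ^ 2 + σ / β * (2 * κ * lam / β) <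
      1 / 4 + σ * κ / β + 1 / 4) : ¬ Crosses σ lam x p w := by
  intro hA
  have hg : 0 < g := by positivity
  obtain ⟨T, hGT, hT0⟩ := ((S.G_bot.eventually (lt_mem_nhds hg)).and
    (eventually_le_atBot 0)).exists
  obtain ⟨T', -, hp, -, hbound⟩ := S.crosses_bound hσ hβ hκ hA
    (fun t ht => S.p_pos t (by linarith)) hGT.le
  have hp' : ∀ t < T', 0 < p t := fun t ht => hp t ht.le
  have hx := S.x_pos_of_p_pos hp'
  have hJ : ∀ t < T', J σ g x p w t < 0 := fun t ht => S.J_neg_of_rise hσ hβ hκ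
    fun s hs => ⟨hx s (by linarith), hp s (by linarith)⟩
  have hv := S.slope_lt hx hJ
  have hQ : 0 ≤ 2 * κ * lam / β * x T' ^ 2 - Q β κ x w T' := by
    refine nonneg_of_deriv_add_nonneg_atBot hβ.le
      (f := fun t => 2 * κ * lam / β * x t ^ 2 - Q β κ x w t)
      (fun t _ => (((S.flow.dx t).fun_pow 2).const_mul _).fun_sub (S.flow.hasDerivAt_Q t))
      (tendsto_nhds_of_eq (((S.x_bot.pow 2).const_mul _).sub S.Q_bot) (by ring)) fun t ht => ?_
    have h1 := S.slope_lt (T := t) (fun s hs => hx s (by linarith))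
      (fun s hs => hJ s (by linarith))
    have hxt := hx t ht.le
    have h2 : 0 ≤ 2 * κ * (x t * (lam * x t - p t)) := by
      have := sub_pos.2 h1
      positivity
    have h3 : 0 ≤ 2 * κ * lam / β * (2 * (x t * p t)) := by
      have := hp t ht.le
      positivity
    have h4 : β * (2 * κ * lam / β * x t ^ 2) = 2 * κ * lam * x t ^ 2 := by field_simp
    push_cast
    nlinarith
  have hxT := hx T' le_rfl
  have hσ1 : 0 < σ + 1 := by linarith
  have h1 : x T' + p T' / (σ + 1) ≤ (1 + lam / (σ + 1)) * x T' := by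
    have : p T' / (σ + 1) ≤ lam / (σ + 1) * x T' := by
      rw [div_mul_eq_mul_div]; gcongr
    linarith
  have h2 : (x T' + p T' / (σ + 1)) ^ 2 ≤ ((1 + lam / (σ + 1)) * x T') ^ 2 := by
    have := hp T' le_rfl
    exact pow_le_pow_left₀ (by positivity) h1 2
  have h3 : σ / β * Q β κ x w T' ≤ σ / β * (2 * κ * lam / β * x T' ^ 2) := by
    gcongr; linarith
  have h4 : (1 / 4 + σ * κ / β) * (x T' + p T' / (σ + 1)) ^ 2 ≤
      (1 / 4 + σ * κ / β) * ((1 + lam / (σ + 1)) * x T') ^ 2 := by gcongr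
  have h5 := mul_lt_mul_of_pos_right h (pow_pos hxT 2)
  linarith

/-- A condition at a time on the rise which prevents crossing. -/
theorem not_crosses_of_rise (S : IsSeparatrix σ β κ lam x p w) (hσ : 0 < σ) (hβ : 0 < β)
    (hκ : 0 < κ) {T : ℝ} (hp : ∀ t ≤ T, 0 < p t) (hG : 0 < G σ g x w T)
    (h : (1 / 4 + σ * κ / β) * (1 + p T / x T / (σ + 1)) ^ 2 +
      σ / β * ((Q β κ x w T + 2 * κ * G σ g x w T) / x T ^ 2) <
      1 / 4 + σ * κ / β + 1 / 4) : ¬ Crosses σ lam x p w := by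
  intro hA
  obtain ⟨T', hT', hp', hGT', hbound⟩ := S.crosses_bound hσ hβ hκ hA hp hG.le
  have hx := S.x_pos_of_p_pos (fun t (ht : t < T') => hp' t ht.le)
  have hJ : ∀ t < T', J σ g x p w t < 0 := fun t ht => S.J_neg_of_rise hσ hβ hκ
    fun s hs => ⟨hx s (by linarith), hp' s (by linarith)⟩
  have hQpos : ∀ t ≤ T', 0 < Q β κ x w t := fun t ht => S.Q_pos hβ hκ
    fun s hs => ⟨hx s (by linarith), hp' s (by linarith)⟩
  have hv : p T' / x T' ≤ p T / x T := (S.slope_strictAntiOn hx hJ).antitoneOn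
    (Set.mem_Iic.2 hT') (Set.mem_Iic.2 le_rfl) hT'
  have hw : w T ≤ w T' := by
    have := monotoneOn_exp_mul_of_deriv (a := 0) (t₀ := T) (T := T')
      (fun t _ => S.flow.dw t) (fun t ht => by
        have := hQpos t ht.2.le
        unfold Q at this
        linarith) (Set.left_mem_Icc.2 hT') (Set.right_mem_Icc.2 hT') hT'
    simpa using this
  have hxx : x T ≤ x T' := S.x_mono (fun t (ht : t < T') => hp' t ht.le)
    (Set.mem_Iic.2 hT') (Set.mem_Iic.2 le_rfl) hT'
  have hxT := hx T hT'
  have hxT' := hx T' le_rfl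
  have hpT' := hp' T' le_rfl
  have hσ1 : 0 < σ + 1 := by linarith
  have hw' := mul_le_mul_of_nonneg_left hw hσ.le
  have hxsq : x T' ^ 2 ≤ x T ^ 2 + 2 * G σ g x w T := by
    unfold G at hGT' ⊢; linarith
  have hQ : Q β κ x w T' ≤ Q β κ x w T + 2 * κ * G σ g x w T := by
    have h1 := mul_le_mul_of_nonneg_left hxsq hκ.le
    have h2 := mul_le_mul_of_nonneg_left hw hβ.le
    unfold Q; linarith
  have h1 : σ / β * Q β κ x w T' ≤
      σ / β * ((Q β κ x w T + 2 * κ * G σ g x w T) / x T ^ 2) * x T' ^ 2 := by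
    rw [mul_assoc]
    refine mul_le_mul_of_nonneg_left ?_ (by positivity)
    rw [div_mul_eq_mul_div, le_div_iff₀ (by positivity)]
    have h2 : x T ^ 2 ≤ x T' ^ 2 := pow_le_pow_left₀ hxT.le hxx 2
    exact mul_le_mul hQ h2 (by positivity) ((hQpos T' le_rfl).le.trans hQ)
  have h2 : x T' + p T' / (σ + 1) ≤ (1 + p T / x T / (σ + 1)) * x T' := by
    have h3 : p T' / (σ + 1) ≤ p T / x T / (σ + 1) * x T' := by
      rw [div_mul_eq_mul_div]
      gcongr
      exact (div_le_iff₀ hxT').1 hv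
    linarith
  have h3 : (x T' + p T' / (σ + 1)) ^ 2 ≤ ((1 + p T / x T / (σ + 1)) * x T') ^ 2 :=
    pow_le_pow_left₀ (by positivity) h2 2
  have h4 : (1 / 4 + σ * κ / β) * (x T' + p T' / (σ + 1)) ^ 2 ≤
      (1 / 4 + σ * κ / β) * ((1 + p T / x T / (σ + 1)) * x T') ^ 2 := by gcongr
  have h5 := mul_lt_mul_of_pos_right h (pow_pos hxT' 2)
  linarith

end IsSeparatrix

namespace IsSeparatrix

open ReducedFlow

variable {σ β κ lam : ℝ} {x p w : ℝ → ℝ}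

local notation "g" => lam ^ 2 + (σ + 1) * lam
local notation "α" => (3 * σ - 2 * β - 1) / 8

theorem not_forall_J_le (S : IsSeparatrix σ β κ lam x p w) (hσ : 0 < σ) (hβ : 0 < β)
    (hκ : 0 < κ) (hlam : 0 < lam) (hx : ∀ t, 0 < x t) {m t₁ : ℝ} (hm : 0 < m) :
    ¬ ∀ t, t₁ ≤ t → J σ g x p w t ≤ -m * x t ^ 2 := by
  intro hJ
  have hg : 0 < g := by positivity
  have hdec : ∀ t, t₁ ≤ t → p t / x t ≤ p t₁ / x t₁ - m * (t - t₁) := fun t ht => by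
    have h := monotoneOn_exp_mul_of_deriv (a := 0) (t₀ := t₁) (T := t)
      (f := fun s => -(p s / x s) - m * s)
      (fun s _ => ((S.flow.hasDerivAt_slope (hx s).ne').fun_neg).fun_sub
        ((hasDerivAt_id s).const_mul m))
      (fun s hs => by
        have h1 := hJ s hs.1.le
        have h2 : J σ g x p w s / x s ^ 2 ≤ -m := by
          rw [div_le_iff₀ (pow_pos (hx s) 2)]; exact h1
        linarith) (Set.left_mem_Icc.2 ht) (Set.right_mem_Icc.2 ht) ht
    simp only [zero_mul, Real.exp_zero, one_mul] at h
    linarith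
  set R := 2 * (σ + 1) + 2 * g + 1 with hR
  have hR0 : 0 < R := by positivity
  obtain ⟨t₂, ht₂, hV⟩ : ∃ t₂, t₁ ≤ t₂ ∧ ∀ t, t₂ ≤ t → R * x t ≤ -p t := by
    refine ⟨t₁ + (R + |p t₁ / x t₁|) / m, ?_, fun t ht => ?_⟩
    · have : 0 ≤ (R + |p t₁ / x t₁|) / m := by positivity
      linarith
    · have h1 : (R + |p t₁ / x t₁|) / m ≤ t - t₁ := by linarith
      rw [div_le_iff₀ hm] at h1
      have h0 : 0 ≤ R + |p t₁ / x t₁| := by positivity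
      have h2 := hdec t (by nlinarith)
      have h3 : p t / x t ≤ -R := by linarith [le_abs_self (p t₁ / x t₁)]
      rw [div_le_iff₀ (hx t)] at h3
      linarith
  have hpneg : ∀ t, t₂ ≤ t → p t < 0 := fun t ht => by
    have h1 := hV t ht
    have h2 : 0 < R * x t := mul_pos hR0 (hx t)
    linarith
  have hJ2 : ∀ t, t₂ ≤ t → J σ g x p w t ≤ -(p t ^ 2 / 2) := fun t ht => by
    have h1 := hV t ht
    have hxt := hx t
    have hw := S.w_pos hβ hκ t
    have h2 : 0 ≤ σ * x t ^ 2 * w t := by positivity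
    have h3 : 0 ≤ x t ^ 4 := by positivity
    have h4 : x t ≤ -p t := by nlinarith
    have h5 : 0 ≤ (-p t) * (-p t - R * x t) :=
      mul_nonneg (neg_nonneg.2 (hpneg t ht).le) (by linarith)
    have h6 : 0 ≤ g * (x t * (-p t - x t)) :=
      mul_nonneg hg.le (mul_nonneg hxt.le (by linarith))
    have h7 : 0 ≤ x t * (-p t) := mul_nonneg hxt.le (neg_nonneg.2 (hpneg t ht).le)
    unfold J G
    rw [hR] at h5
    nlinarith
  have h := monotoneOn_exp_mul_of_deriv (a := 0) (t₀ := t₂) (T := t₂ - 2 * (x t₂ / p t₂) )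
    (f := fun s => x s / p s - s / 2)
    (fun s hs => ((S.flow.dx s).fun_div (S.flow.dp s) (hpneg s hs.1).ne).fun_sub
      ((hasDerivAt_id s).div_const 2))
    (fun s hs => by
      have h1 := hJ2 s hs.1.le
      have h2 := hpneg s hs.1.le
      have h3 : 1 / 2 ≤ (p s * p s - x s * (-(σ + 1) * p s + x s *
          (g - x s ^ 2 / 2 - σ * w s))) / p s ^ 2 := by
        rw [le_div_iff₀ (sq_pos_of_neg h2)]
        unfold J G at h1
        linarith
      linarith)
  have h0 : x t₂ / p t₂ < 0 := div_neg_of_pos_of_neg (hx _) (hpneg _ le_rfl)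
  have hle : t₂ ≤ t₂ - 2 * (x t₂ / p t₂) := by linarith
  have h1 := h (Set.left_mem_Icc.2 hle) (Set.right_mem_Icc.2 hle) hle
  simp only [zero_mul, Real.exp_zero, one_mul] at h1
  have h2 := div_neg_of_pos_of_neg (hx (t₂ - 2 * (x t₂ / p t₂))) (hpneg _ hle)
  linarith

theorem exists_slope_eq (S : IsSeparatrix σ β κ lam x p w) {T μ : ℝ} (hx : ∀ t ≤ T, 0 < x t)
    (hμ : μ < lam) (hT : p T ≤ μ * x T) : ∃ s ≤ T, p s = μ * x s := by
  obtain ⟨r, hr, hrT⟩ := ((S.slope_bot.eventually (lt_mem_nhds hμ)).and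
    (eventually_le_atBot T)).exists
  have hr' : μ * x r < p r := (lt_div_iff₀ (hx r hrT)).1 hr
  have hc : ContinuousOn (fun t => p t - μ * x t) (Set.Icc r T) :=
    (S.flow.continuous_p.sub (S.flow.continuous_x.const_mul μ)).continuousOn
  obtain ⟨s, hs, hs0⟩ := intermediate_value_Icc' hrT hc
    (Set.mem_Icc.2 ⟨sub_nonpos.2 hT, (sub_pos.2 hr').le⟩)
  exact ⟨s, hs.2, sub_eq_zero.1 hs0⟩

theorem le_slope (S : IsSeparatrix σ β κ lam x p w) {T μ : ℝ} (hx : ∀ t ≤ T, 0 < x t)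
    (hJ : ∀ t ≤ T, J σ g x p w t < 0) (hT : μ * x T ≤ p T) : ∀ t ≤ T, μ * x t ≤ p t := by
  intro t ht
  have h := (S.slope_strictAntiOn hx (fun s hs => hJ s hs.le)).antitoneOn (Set.mem_Iic.2 ht)
    (Set.mem_Iic.2 le_rfl) ht
  have h1 := (le_div_iff₀ (hx T le_rfl)).2 hT
  exact (le_div_iff₀ (hx t ht)).1 (h1.trans h)

theorem slope_le (S : IsSeparatrix σ β κ lam x p w) {s T μ : ℝ} (hx : ∀ t ≤ T, 0 < x t)
    (hJ : ∀ t ≤ T, J σ g x p w t < 0) (hT : p s ≤ μ * x s) : ∀ t, s ≤ t → t ≤ T →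
    p t ≤ μ * x t := by
  intro t hst ht
  have h := (S.slope_strictAntiOn hx (fun s hs => hJ s hs.le)).antitoneOn
    (Set.mem_Iic.2 (hst.trans ht)) (Set.mem_Iic.2 ht) hst
  have h1 := (div_le_iff₀ (hx s (hst.trans ht))).2 hT
  exact (div_le_iff₀ (hx t ht)).1 (h.trans h1)

theorem w_le_of_slope_ge (S : IsSeparatrix σ β κ lam x p w) (hβ : 0 < β)
    (hκ : 0 < κ) {T : ℝ} (hx : ∀ t ≤ T, 0 < x t)
    (hv : ∀ t ≤ T, lam / 2 * x t ≤ p t) : lam * w T ≤ κ * x T ^ 2 := by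
  have := nonneg_of_deriv_add_nonneg_atBot hβ.le (T := T)
    (f := fun t => κ * x t ^ 2 - lam * w t)
    (fun t _ => (((S.flow.dx t).fun_pow 2).const_mul κ).fun_sub ((S.flow.dw t).const_mul lam))
    (tendsto_nhds_of_eq (((S.x_bot.pow 2).const_mul κ).sub (S.w_bot.const_mul lam)) (by ring))
    (fun t ht => by
      have hxt := hx t ht.le
      have h1 : 0 ≤ 2 * κ * (x t * (p t - lam / 2 * x t)) := by
        have := sub_nonneg.2 (hv t ht.le)
        positivity
      have h2 : 0 ≤ β * (κ * x t ^ 2) := by positivity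
      push_cast
      nlinarith)
  linarith

theorem J_neg_of_F_nonneg {T : ℝ} (hx : ∀ t ≤ T, 0 < x t)
    (hF : ∀ t ≤ T, 0 ≤ F σ g x p w t) : ∀ t ≤ T, J σ g x p w t < 0 := fun t ht => by
  rw [J_eq]
  have := hF t ht
  have := pow_pos (hx t ht) 4
  linarith

theorem w_le_of_F_nonneg (S : IsSeparatrix σ β κ lam x p w) (hβ : 0 < β)
    (hκ : 0 < κ) {T : ℝ} (hx : ∀ t ≤ T, 0 < x t)
    (hF : ∀ t ≤ T, 0 ≤ F σ g x p w t) : w T ≤ 4 * κ * (lam - p T / x T) := by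
  have := nonneg_of_deriv_add_nonneg_atBot (a := 0) le_rfl (T := T)
    (f := fun t => 4 * κ * (lam - p t / x t) - w t)
    (fun t ht => (((S.flow.hasDerivAt_slope (hx t ht).ne').const_sub lam).const_mul
      (4 * κ)).fun_sub (S.flow.dw t))
    (tendsto_nhds_of_eq (((S.slope_bot.const_sub lam).const_mul (4 * κ)).sub S.w_bot) (by ring))
    (fun t ht => by
      have hxt := hx t ht.le
      have h1 : J σ g x p w t / x t ^ 2 ≤ -(x t ^ 2 / 4) := by
        rw [div_le_iff₀ (by positivity), J_eq]
        have := hF t ht.le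
        linarith
      have h2 := mul_nonneg hβ.le (S.w_pos hβ hκ t).le
      have h3 := mul_le_mul_of_nonneg_left h1 hκ.le
      linarith)
  linarith

theorem x_sq_le_of_F_nonneg (S : IsSeparatrix σ β κ lam x p w) (hlam : 0 < lam)
    {T : ℝ} (hx : ∀ t ≤ T, 0 < x t)
    (hF : ∀ t ≤ T, 0 ≤ F σ g x p w t) : x T ^ 2 ≤ 4 * lam ^ 2 := by
  have hJ := J_neg_of_F_nonneg hx hF
  have key : ∀ s ≤ T, 0 ≤ p s → x s ^ 2 ≤ 4 * lam ^ 2 := fun s hs hps => by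
    have := nonneg_of_deriv_add_nonneg_atBot (a := 0) le_rfl (T := s)
      (f := fun t => 4 * lam ^ 2 - x t ^ 2 - 4 * (p t / x t) ^ 2)
      (fun t ht => (((S.flow.dx t).fun_pow 2).const_sub (4 * lam ^ 2)).fun_sub
        (((S.flow.hasDerivAt_slope (hx t (ht.trans hs)).ne').fun_pow 2).const_mul 4))
      (tendsto_nhds_of_eq (((S.x_bot.pow 2).const_sub (4 * lam ^ 2)).sub
        ((S.slope_bot.pow 2).const_mul 4)) (by ring))
      (fun t ht => by
        have hxt := hx t (ht.le.trans hs)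
        have h1 : J σ g x p w t / x t ^ 2 ≤ -(x t ^ 2 / 4) := by
          rw [div_le_iff₀ (by positivity), J_eq]
          have := hF t (ht.le.trans hs)
          linarith
        have h2 := S.le_slope (T := s) (μ := 0) (fun r hr => hx r (hr.trans hs))
          (fun r hr => hJ r (hr.trans hs)) (by simpa using hps) t ht.le
        have h3 : 0 ≤ p t / x t := div_nonneg (by simpa using h2) hxt.le
        have h4 := mul_le_mul_of_nonneg_left h1 h3
        have h5 : p t / x t * x t ^ 2 = x t * p t := by field_simp
        push_cast
        nlinarith)
    have := sq_nonneg (p s / x s)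
    linarith
  rcases le_total 0 (p T) with h | h
  · exact key T le_rfl h
  · obtain ⟨s, hs, hs0⟩ := S.exists_slope_eq (μ := 0) hx hlam (by simpa using h)
    have hps : p s = 0 := by simpa using hs0
    refine le_trans ?_ (key s hs hps.ge)
    have h1 := S.slope_le (μ := 0) hx hJ hs0.le
    have h2 := monotoneOn_exp_mul_of_deriv (a := 0) (t₀ := s) (T := T)
      (fun t _ => (S.flow.dx t).fun_neg) (fun t ht => by
        have := h1 t ht.1.le ht.2.le
        linarith) (Set.left_mem_Icc.2 hs) (Set.right_mem_Icc.2 hs) hs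
    simp only [zero_mul, Real.exp_zero, one_mul] at h2
    exact pow_le_pow_left₀ (hx T le_rfl).le (by linarith) 2

theorem le_x_sq_of_F_nonneg (S : IsSeparatrix σ β κ lam x p w) (hσ : 0 < σ) (hβ : 0 < β)
    (hκ : 0 < κ) (hlam : 0 < lam) (hlam₂ : 24 * σ * κ ≤ lam) {T : ℝ} (hx : ∀ t ≤ T, 0 < x t)
    (hF : ∀ t ≤ T, 0 ≤ F σ g x p w t) (hv : -(lam / 2) * x T ≤ p T) (hv' : p T ≤ lam / 2 * x T) :
    2 * lam ^ 2 ≤ x T ^ 2 := by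
  have hxT := hx T le_rfl
  have hw := S.w_le_of_F_nonneg hβ hκ hx hF
  have hFT := hF T le_rfl
  obtain ⟨v, hv0⟩ : ∃ v, p T = v * x T := ⟨p T / x T, by field_simp⟩
  rw [hv0] at hv hv'
  have h1 : -(lam / 2) ≤ v := le_of_mul_le_mul_right hv hxT
  have h2 : v ≤ lam / 2 := le_of_mul_le_mul_right hv' hxT
  have h3 : p T / x T = v := by rw [hv0]; field_simp
  rw [h3] at hw
  have h4 : F σ g x p w T = x T ^ 2 * (v ^ 2 / 2 + (σ + 1) / 2 * v - g / 2 + x T ^ 2 / 8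
      + σ / 2 * w T) := by unfold F; rw [hv0]; ring
  rw [h4] at hFT
  have h5 := nonneg_of_mul_nonneg_right hFT (by positivity)
  have h6 : v ^ 2 ≤ (lam / 2) ^ 2 := sq_le_sq' h1 h2
  have h7 : (σ + 1) * v ≤ (σ + 1) * (lam / 2) := by gcongr
  have h8 : σ * w T ≤ σ * (6 * κ * lam) := by
    gcongr
    have : κ * (-v) ≤ κ * (lam / 2) := by gcongr; linarith
    linarith
  have h9 : 24 * σ * κ * lam ≤ lam * lam := by gcongr
  have h10 : 0 ≤ (σ + 1) * lam := by positivity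
  linarith

theorem source_ge_of_F_nonneg (S : IsSeparatrix σ β κ lam x p w) (hσ : 0 < σ) (hβ : 0 < β)
    (hκ : 0 < κ) (hα : 0 < α) (hlam : 0 < lam) (hlam₂ : 24 * σ * κ ≤ lam)
    (hlam₃ : 50 * σ * β * κ ≤ α * lam) {T : ℝ} (hx : ∀ t ≤ T, 0 < x t)
    (hF : ∀ t ≤ T, 0 ≤ F σ g x p w t) (hv : -(lam / 2) * x T ≤ p T) :
    α / 2 * x T ^ 4 ≤ α * x T ^ 4 - σ * β / 2 * (x T ^ 2 * w T) := by
  have hxT := hx T le_rfl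
  have hsb : 0 < σ * β := mul_pos hσ hβ
  suffices h : σ * β * w T ≤ α * x T ^ 2 by
    have := mul_le_mul_of_nonneg_left h (sq_nonneg (x T))
    linarith
  rcases le_total (lam / 2 * x T) (p T) with hv' | hv'
  · have h1 := S.w_le_of_slope_ge hβ hκ hx
      (S.le_slope hx (J_neg_of_F_nonneg hx hF) hv')
    have h2 := mul_le_mul_of_nonneg_left h1 hsb.le
    have h3 := mul_le_mul_of_nonneg_right hlam₃ (sq_nonneg (x T))
    have h4 : 0 ≤ σ * β * κ * x T ^ 2 := by positivity
    refine le_of_mul_le_mul_left ?_ hlam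
    linarith
  · have h1 := S.le_x_sq_of_F_nonneg hσ hβ hκ hlam hlam₂ hx hF hv hv'
    have h2 := S.w_le_of_F_nonneg hβ hκ hx hF
    have h3 : -(lam / 2) ≤ p T / x T := by rw [le_div_iff₀ hxT]; exact hv
    have h4 : κ * (-(p T / x T)) ≤ κ * (lam / 2) := by gcongr; linarith
    have h5 : w T ≤ 6 * κ * lam := by linarith
    have h6 := mul_le_mul_of_nonneg_left h5 hsb.le
    have h7 := mul_le_mul_of_nonneg_left h1 hα.le
    have h8 := mul_le_mul_of_nonneg_right hlam₃ hlam.le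
    have h9 : 0 ≤ σ * β * κ * lam := by positivity
    linarith

theorem F_ge_of_F_nonneg (S : IsSeparatrix σ β κ lam x p w) (hσ : 0 < σ) (hβ : 0 < β)
    (hκ : 0 < κ) (hκ' : 2 * σ * κ = 2 * σ - β) (hα : 0 < α) (hlam : 0 < lam)
    (hlam₂ : 24 * σ * κ ≤ lam)
    (hlam₃ : 50 * σ * β * κ ≤ α * lam) {T : ℝ} (hx : ∀ t ≤ T, 0 < x t)
    (hF : ∀ t ≤ T, 0 ≤ F σ g x p w t) (hv : -(lam / 2) * x T ≤ p T) :
    α / 2 * x T ^ 4 ≤ (4 * lam + σ + 1) * F σ g x p w T := by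
  have hJ := J_neg_of_F_nonneg hx hF
  have hv' := S.le_slope hx hJ hv
  have := nonneg_of_deriv_add_nonneg_atBot (a := σ + 1) (by linarith) (T := T)
    (f := fun t => (4 * lam + σ + 1) * F σ g x p w t - α / 2 * x t ^ 4)
    (fun t _ => ((S.flow.hasDerivAt_F hκ' t).const_mul _).fun_sub
      (((S.flow.dx t).fun_pow 4).const_mul _))
    (tendsto_nhds_of_eq ((S.F_bot.const_mul _).sub ((S.x_bot.pow 4).const_mul _)) (by ring))
    (fun t ht => by
      have hxt := hx t ht.le
      have h1 := S.source_ge_of_F_nonneg hσ hβ hκ hα hlam hlam₂ hlam₃ (T := t)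
        (fun s hs => hx s (hs.trans ht.le)) (fun s hs => hF s (hs.trans ht.le)) (hv' t ht.le)
      have h2 := mul_le_mul_of_nonneg_left h1 (show 0 ≤ 4 * lam + σ + 1 by positivity)
      have h3 := S.slope_lt (T := t) (fun s hs => hx s (hs.trans ht.le))
        (fun s hs => hJ s (hs.le.trans ht.le))
      have h4 : 0 ≤ α * (x t ^ 3 * (lam * x t - p t)) :=
        mul_nonneg hα.le (mul_nonneg (by positivity) (by linarith))
      push_cast
      linarith)
  linarith

theorem F_ge_of_slope_le (S : IsSeparatrix σ β κ lam x p w) (hσ : 0 < σ) (hβ : 0 < β)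
    (hκ : 0 < κ) (hκ' : 2 * σ * κ = 2 * σ - β) (hα : 0 < α) (hlam : 0 < lam)
    (hlam₁ : 2 * (σ + 1) ≤ lam) (hlam₂ : 24 * σ * κ ≤ lam)
    (hlam₃ : 50 * σ * β * κ ≤ α * lam) {T : ℝ} (hx : ∀ t ≤ T, 0 < x t)
    (hF : ∀ t ≤ T, 0 ≤ F σ g x p w t) (hv : p T ≤ -(lam / 2) * x T) :
    10 * σ * β * κ * x T ^ 2 ≤ F σ g x p w T := by
  have hJ := J_neg_of_F_nonneg hx hF
  obtain ⟨s, hs, hps⟩ := S.exists_slope_eq hx (by linarith) hv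
  have hxs := hx s hs
  have hx' : ∀ t ≤ s, 0 < x t := fun t ht => hx t (ht.trans hs)
  have hF' : ∀ t ≤ s, 0 ≤ F σ g x p w t := fun t ht => hF t (ht.trans hs)
  have hle := S.slope_le hx hJ hps.le
  have hxsq := S.x_sq_le_of_F_nonneg hlam hx' hF'
  have hxsq' := S.le_x_sq_of_F_nonneg hσ hβ hκ hlam hlam₂ hx' hF' hps.ge
    (by rw [hps]; nlinarith)
  have hws : w s ≤ 6 * κ * lam := by
    have h1 := S.w_le_of_F_nonneg hβ hκ hx' hF'
    rw [hps, mul_div_cancel_right₀ _ hxs.ne'] at h1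
    linarith
  have hw : ∀ t, s ≤ t → t ≤ T → w t ≤ 10 * κ * lam := fun t h1 h2 => by
    have h := monotoneOn_exp_mul_of_deriv (a := 0) (t₀ := s) (T := t)
      (f := fun r => -(lam * w r + κ * x r ^ 2))
      (fun r _ => (((S.flow.dw r).const_mul lam).fun_add
        (((S.flow.dx r).fun_pow 2).const_mul κ)).fun_neg)
      (fun r hr => by
        have h3 := hle r hr.1.le (hr.2.le.trans h2)
        have hxr := hx r (hr.2.le.trans h2)
        have h4 := mul_nonneg (mul_nonneg hlam.le hβ.le) (S.w_pos hβ hκ r).le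
        have h5 : 0 ≤ κ * (x r * (-(lam / 2) * x r - p r)) :=
          mul_nonneg hκ.le (mul_nonneg hxr.le (by linarith))
        push_cast
        linarith) (Set.left_mem_Icc.2 h1) (Set.right_mem_Icc.2 h1) h1
    simp only [zero_mul, Real.exp_zero, one_mul] at h
    have h6 := mul_le_mul_of_nonneg_left hxsq hκ.le
    have h7 := mul_le_mul_of_nonneg_left hws hlam.le
    have h8 : 0 ≤ κ * x t ^ 2 := by positivity
    refine le_of_mul_le_mul_left ?_ hlam
    linarith
  have h0 := S.F_ge_of_F_nonneg hσ hβ hκ hκ' hα hlam hlam₂ hlam₃ hx' hF' hps.ge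
  have hinit : 0 ≤ F σ g x p w s - 10 * σ * β * κ * x s ^ 2 := by
    have h1 : α * lam ^ 2 * x s ^ 2 ≤ α / 2 * x s ^ 4 := by
      have := mul_le_mul_of_nonneg_left hxsq' (show 0 ≤ α / 2 * x s ^ 2 by positivity)
      linarith
    have h2 := mul_le_mul_of_nonneg_right hlam₃ (show 0 ≤ lam * x s ^ 2 by positivity)
    have h3 : (4 * lam + σ + 1) * F σ g x p w s ≤ 5 * lam * F σ g x p w s := by
      have := hF s hs
      gcongr
      linarith
    have h4 : 0 ≤ 5 * lam * (F σ g x p w s - 10 * σ * β * κ * x s ^ 2) := by linarith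
    exact nonneg_of_mul_nonneg_right h4 (by positivity)
  have := nonneg_of_deriv_add_nonneg (a := σ + 1) hs
    (f := fun t => F σ g x p w t - 10 * σ * β * κ * x t ^ 2)
    (fun t _ => (S.flow.hasDerivAt_F hκ' t).fun_sub (((S.flow.dx t).fun_pow 2).const_mul _))
    (fun t ht => by
      have hxt := hx t ht.2.le
      have h1 := hw t ht.1.le ht.2.le
      have h2 := hle t ht.1.le ht.2.le
      have h3 : σ * β / 2 * (x t ^ 2 * w t) ≤ σ * β / 2 * (x t ^ 2 * (10 * κ * lam)) := by gcongr
      have h4 : 0 ≤ 20 * σ * β * κ * (x t * (-(lam / 2) * x t - p t)) := by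
        have : 0 ≤ -(lam / 2) * x t - p t := by linarith
        positivity
      have h5 : 0 ≤ 5 * σ * β * κ * x t ^ 2 * (lam - 2 * (σ + 1)) :=
        mul_nonneg (by positivity) (by linarith)
      have h6 : 0 ≤ α * x t ^ 4 := by positivity
      push_cast
      linarith) hinit
  linarith

/-- For large `lam` the energy stays positive while `x > 0`. -/
theorem F_pos (S : IsSeparatrix σ β κ lam x p w) (hσ : 0 < σ) (hβ : 0 < β)
    (hκ : 0 < κ) (hκ' : 2 * σ * κ = 2 * σ - β) (hα : 0 < α) (hlam : 0 < lam)
    (hlam₁ : 2 * (σ + 1) ≤ lam) (hlam₂ : 24 * σ * κ ≤ lam)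
    (hlam₃ : 50 * σ * β * κ ≤ α * lam) {T : ℝ} (hx : ∀ t ≤ T, 0 < x t) :
    0 < F σ g x p w T := by
  by_contra! hFT
  have hFc : Continuous (F σ g x p w) :=
    continuous_iff_continuousAt.2 fun t => (S.flow.hasDerivAt_F hκ' t).continuousAt
  obtain ⟨r, hr⟩ := eventually_atBot.1 ((S.slope_bot.eventually
    (lt_mem_nhds (show lam / 2 < lam by linarith))).and (eventually_le_atBot T))
  have hrT := (hr r le_rfl).2
  have hFr : ∀ t ≤ r, 0 < F σ g x p w t := fun t ht => by
    have hv : ∀ s ≤ t, lam / 2 * x s ≤ p s := fun s hs =>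
      ((lt_div_iff₀ (hx s (hr s (hs.trans ht)).2)).1 (hr s (hs.trans ht)).1).le
    refine pos_of_deriv_add_pos_atBot (a := σ + 1) (by linarith)
      (fun s _ => S.flow.hasDerivAt_F hκ' s) S.F_bot fun s hs => ?_
    have hxs := hx s (hr s (hs.le.trans ht)).2
    have h1 := S.w_le_of_slope_ge hβ hκ (T := s) (fun q hq => hx q (by linarith))
      (fun q hq => hv q (by linarith))
    have h2 := mul_le_mul_of_nonneg_left h1 (show 0 ≤ σ * β * x s ^ 2 by positivity)
    have h3 := mul_le_mul_of_nonneg_right hlam₃ (show 0 ≤ x s ^ 4 by positivity)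
    have h4 : 0 < σ * β * κ * x s ^ 4 := by positivity
    have h5 : 0 < lam * (α * x s ^ 4 - σ * β / 2 * (x s ^ 2 * w s)) := by linarith
    have h6 := pos_of_mul_pos_right h5 hlam.le
    linarith
  obtain ⟨c, hrc, hcT, hFc0, hlt⟩ := exists_first_zero hFc.neg hrT
    (by simpa using hFr r le_rfl) (by simpa using hFT)
  have hFc0' : F σ g x p w c = 0 := by simpa using hFc0
  have hF : ∀ t ≤ c, 0 ≤ F σ g x p w t := fun t ht => by
    rcases le_total t r with h | h
    · exact (hFr t h).le
    · rcases ht.eq_or_lt with h1 | h1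
      · rw [h1, hFc0']
      · have := hlt t h h1
        simp only [Pi.neg_apply] at this
        linarith
  have hx' : ∀ t ≤ c, 0 < x t := fun t ht => hx t (ht.trans hcT)
  have hxc := hx' c le_rfl
  rcases le_total (-(lam / 2) * x c) (p c) with h | h
  · have h1 := S.F_ge_of_F_nonneg hσ hβ hκ hκ' hα hlam hlam₂ hlam₃ hx' hF h
    rw [hFc0'] at h1
    have : 0 < α / 2 * x c ^ 4 := by positivity
    linarith
  · have h1 := S.F_ge_of_slope_le hσ hβ hκ hκ' hα hlam hlam₁ hlam₂ hlam₃ hx' hF h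
    rw [hFc0'] at h1
    have : 0 < 10 * σ * β * κ * x c ^ 2 := by positivity
    linarith

/-- For large `lam` the separatrix crosses. -/
theorem crosses_of_large (S : IsSeparatrix σ β κ lam x p w) (hσ : 0 < σ) (hβ : 0 < β)
    (hκ : 0 < κ) (hκ' : 2 * σ * κ = 2 * σ - β) (hα : 0 < α) (hlam : 0 < lam)
    (hlam₁ : 2 * (σ + 1) ≤ lam) (hlam₂ : 24 * σ * κ ≤ lam)
    (hlam₃ : 50 * σ * β * κ ≤ α * lam) : Crosses σ lam x p w := by
  have hF : ∀ T, (∀ t ≤ T, 0 < x t) → 0 < F σ g x p w T := fun T hx =>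
    S.F_pos hσ hβ hκ hκ' hα hlam hlam₁ hlam₂ hlam₃ hx
  rcases S.trichotomy hσ hβ hκ hκ' with h | ⟨τ, hJ, hx⟩ | h
  · exact h
  · rw [J_eq] at hJ
    have := hF τ hx
    have := pow_pos (hx τ le_rfl) 4
    linarith
  exfalso
  have hx : ∀ t, 0 < x t := fun t => (h t).1
  have hF' : ∀ t, 0 < F σ g x p w t := fun t => hF t fun s _ => hx s
  by_cases hv : ∃ t, p t ≤ -(lam / 2) * x t
  · obtain ⟨s, hs⟩ := hv
    refine S.not_forall_J_le hσ hβ hκ hlam hx (m := 20 * σ * β * κ) (t₁ := s) (by positivity)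
      fun t ht => ?_
    have h1 := S.slope_le (T := t) (fun r _ => hx r) (fun r _ => (h r).2) hs t ht le_rfl
    have h2 := S.F_ge_of_slope_le hσ hβ hκ hκ' hα hlam hlam₁ hlam₂ hlam₃ (T := t)
      (fun r _ => hx r) (fun r _ => (hF' r).le) h1
    have h3 := pow_pos (hx t) 4
    rw [J_eq]
    linarith
  · push Not at hv
    refine S.not_forall_J_le hσ hβ hκ hlam hx (m := min (x 0 ^ 2) (2 * lam ^ 2) / 4) (t₁ := 0)
      (div_pos (lt_min (pow_pos (hx 0) 2) (by positivity)) (by norm_num)) fun t ht => ?_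
    have h1 : min (x 0 ^ 2) (2 * lam ^ 2) ≤ x t ^ 2 := by
      rcases le_total 0 (p t) with hp | hp
      · refine (min_le_left _ _).trans (pow_le_pow_left₀ (hx 0).le ?_ 2)
        refine S.x_mono (T := t) (fun s hs => ?_) (Set.mem_Iic.2 ht) (Set.mem_Iic.2 le_rfl) ht
        exact S.p_pos_of_nonneg (fun r _ => hx r) (fun r _ => (h r).2) hp s hs
      · refine (min_le_right _ _).trans (S.le_x_sq_of_F_nonneg hσ hβ hκ hlam hlam₂
          (fun r _ => hx r) (fun r _ => (hF' r).le) (hv t).le ?_)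
        have := mul_pos hlam (hx t)
        linarith
    have h2 := mul_le_mul_of_nonneg_right h1 (sq_nonneg (x t))
    rw [J_eq]
    have := hF' t
    linarith

end IsSeparatrix

namespace IsSeparatrix

open ReducedFlow

variable {σ β κ : ℝ}

theorem eventually_forall_pos {φ : ℝ → ℝ → ℝ} {l : ℝ} {s : Set ℝ} (hs : IsCompact s)
    (hφ : ∀ t ∈ s, ContinuousAt (fun q : ℝ × ℝ => φ q.1 |q.2|) (l, t))
    (hpos : ∀ t ∈ s, 0 < φ l |t|) : ∀ᶠ m in 𝓝 l, ∀ t ∈ s, 0 < φ m |t| :=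
  hs.eventually_forall_of_forall_eventually fun t ht =>
    (hφ t ht).eventually (lt_mem_nhds (hpos t ht))

/-- If the separatrices form a continuous family then one of them is homoclinic. -/
theorem exists_homoclinic_of_family (hσ : 0 < σ) (hβ : 0 < β) (hκ : 0 < κ)
    (hκ' : 2 * σ * κ = 2 * σ - β) (hα : 0 < (3 * σ - 2 * β - 1) / 8) {X P W : ℝ → ℝ → ℝ}
    (hS : ∀ l, 0 < l → IsSeparatrix σ β κ l (X l) (P l) (W l))
    (hX : ∀ l, 0 < l → ∀ t, ContinuousAt (fun q : ℝ × ℝ => X q.1 |q.2|) (l, t))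
    (hP : ∀ l, 0 < l → ∀ t, ContinuousAt (fun q : ℝ × ℝ => P q.1 |q.2|) (l, t))
    (hW : ∀ l, 0 < l → ∀ t, ContinuousAt (fun q : ℝ × ℝ => W q.1 |q.2|) (l, t)) :
    ∃ ρ : ℝ, 1 < ρ ∧ ∃ u : ℝ → ℝ × ℝ × ℝ,
      (∀ t : ℝ, HasDerivAt u (lorenzRHS σ ρ β (u t)) t) ∧
      (∃ t₁ t₂ : ℝ, u t₁ ≠ u t₂) ∧
      Tendsto u atTop (nhds 0) ∧ Tendsto u atBot (nhds 0) := by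
  by_contra hno
  have hG : ∀ l, 0 < l → ∀ t, ContinuousAt (fun q : ℝ × ℝ =>
      G σ (q.1 ^ 2 + (σ + 1) * q.1) (X q.1) (W q.1) |q.2|) (l, t) := fun l hl t => by
    have h1 := hX l hl t
    have h2 := hW l hl t
    unfold G
    exact (ContinuousAt.sub (by fun_prop) ((h1.pow 2).div_const 2)).sub (continuousAt_const.mul h2)
  have hJ : ∀ l, 0 < l → ∀ t, ContinuousAt (fun q : ℝ × ℝ =>
      J σ (q.1 ^ 2 + (σ + 1) * q.1) (X q.1) (P q.1) (W q.1) |q.2|) (l, t) := fun l hl t => by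
    have h1 := hX l hl t
    have h2 := hP l hl t
    have h3 := hG l hl t
    unfold J
    exact (h1.mul ((continuousAt_const.mul h2).add (h1.mul h3))).sub (h2.pow 2)
  set U : Set ℝ := {l | 0 < l ∧ Crosses σ l (X l) (P l) (W l)} with hU
  set V : Set ℝ := {l | 0 < l ∧ ¬ Crosses σ l (X l) (P l) (W l)} with hV
  have hJneg : ∀ l, 0 < l → ∀ {τ : ℝ}, (∀ t ∈ Set.Icc 0 τ,
      0 < -J σ (l ^ 2 + (σ + 1) * l) (X l) (P l) (W l) |t|) →
      ∀ t ≤ τ, J σ (l ^ 2 + (σ + 1) * l) (X l) (P l) (W l) t < 0 := fun l hl τ h t ht => by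
    rcases le_total t 0 with h0 | h0
    · exact (hS l hl).J_neg_of_nonpos hσ hβ hκ h0
    · have := h t ⟨h0, ht⟩
      rw [abs_of_nonneg h0] at this
      linarith
  have hUo : IsOpen U := by
    rw [isOpen_iff_mem_nhds]
    rintro l ⟨hl, τ, hxτ, hJτ⟩
    have hτ : 0 ≤ τ := by
      by_contra! h
      have := (hS l hl).x_pos τ h.le
      linarith
    have h1 := eventually_forall_pos (l := l) (φ := fun l t => -X l t) (isCompact_singleton (x := τ))
      (fun t _ => (hX l hl t).neg) (by simpa [abs_of_nonneg hτ] using hxτ)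
    have h2 := eventually_forall_pos (l := l)
      (φ := fun l t => -J σ (l ^ 2 + (σ + 1) * l) (X l) (P l) (W l) t)
      (isCompact_Icc (a := 0) (b := τ))
      (fun t _ => (hJ l hl t).neg) (fun t ht => by
        rw [abs_of_nonneg ht.1]; exact neg_pos.2 (hJτ t ht.2))
    filter_upwards [h1, h2, lt_mem_nhds hl] with m hm1 hm2 hm
    refine ⟨hm, τ, ?_, hJneg m hm hm2⟩
    have := hm1 τ rfl
    rw [abs_of_nonneg hτ] at this
    linarith
  have hVo : IsOpen V := by
    rw [isOpen_iff_mem_nhds]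
    rintro l ⟨hl, hlV⟩
    have S := hS l hl
    rcases S.trichotomy hσ hβ hκ hκ' with h | ⟨τ, hJτ, hx⟩ | h
    · exact absurd h hlV
    · have hτ : 0 ≤ τ := by
        by_contra! h
        have := S.J_neg_of_nonpos hσ hβ hκ h.le
        linarith
      have h1 := eventually_forall_pos (l := l)
        (φ := fun l t => J σ (l ^ 2 + (σ + 1) * l) (X l) (P l) (W l) t)
        (isCompact_singleton (x := τ))
        (fun t _ => hJ l hl t) (by simpa [abs_of_nonneg hτ] using hJτ)
      have h2 := eventually_forall_pos (l := l) (φ := X) (isCompact_Icc (a := 0) (b := τ))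
        (fun t _ => hX l hl t) (fun t ht => by rw [abs_of_nonneg ht.1]; exact hx t ht.2)
      filter_upwards [h1, h2, lt_mem_nhds hl] with m hm1 hm2 hm
      refine ⟨hm, fun hc => not_turns_of_crosses hc ⟨τ, ?_, fun t ht => ?_⟩⟩
      · have := hm1 τ rfl
        rwa [abs_of_nonneg hτ] at this
      · rcases le_total t 0 with h0 | h0
        · exact (hS m hm).x_pos t h0
        · have := hm2 t ⟨h0, ht⟩
          rwa [abs_of_nonneg h0] at this
    · have hp : ∀ t, 0 < P l t := fun t => by
        by_contra! hpt
        exact hno (S.exists_homoclinic hσ hβ hκ' hl (fun s => (h s).1) (fun s => (h s).2) hpt)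
      obtain ⟨L, hL, hxL, hpL, hQL, hGL⟩ := S.tendsto_of_rise hσ hβ (fun s => (h s).1)
        (fun s => (h s).2) hp
      have hlim := ((((((hpL.div hxL hL.ne').div_const (σ + 1)).const_add 1).pow 2).const_mul
        (1 / 4 + σ * κ / β)).add (((hQL.add (hGL.const_mul (2 * κ))).div (hxL.pow 2)
        (by positivity)).const_mul (σ / β)))
      obtain ⟨T, hT, hT0⟩ := ((hlim.eventually (gt_mem_nhds (show _ < 1 / 4 + σ * κ / β + 1 / 4
        by simp))).and (eventually_ge_atTop 0)).exists
      have hGT : 0 < G σ (l ^ 2 + (σ + 1) * l) (X l) (W l) T := by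
        have hanti := fun t : ℝ => S.antitoneOn_G hσ hβ hκ (T := t) (fun s _ => hp s)
        have h1 : 0 ≤ G σ (l ^ 2 + (σ + 1) * l) (X l) (W l) (T + 1) := by
          refine le_of_tendsto hGL ?_
          filter_upwards [eventually_ge_atTop (T + 1)] with s hs
          exact (hanti s).antitoneOn (Set.mem_Iic.2 hs) (Set.mem_Iic.2 le_rfl) hs
        exact lt_of_le_of_lt h1 (hanti (T + 1) (Set.mem_Iic.2 (by linarith))
          (Set.mem_Iic.2 le_rfl) (by linarith))
      have h1 := eventually_forall_pos (l := l) (φ := P) (isCompact_Icc (a := 0) (b := T))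
        (fun t _ => hP l hl t) (fun t _ => hp _)
      have h2 := eventually_forall_pos (l := l)
        (φ := fun l t => G σ (l ^ 2 + (σ + 1) * l) (X l) (W l) t) (isCompact_singleton (x := T))
        (fun t _ => hG l hl t) (by simpa [abs_of_nonneg hT0] using hGT)
      have h3 := eventually_forall_pos (l := l)
        (φ := fun l t => 1 / 4 + σ * κ / β + 1 / 4 - ((1 / 4 + σ * κ / β) *
          (1 + P l t / X l t / (σ + 1)) ^ 2 + σ / β * ((Q β κ (X l) (W l) t
          + 2 * κ * G σ (l ^ 2 + (σ + 1) * l) (X l) (W l) t) / X l t ^ 2)))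
        (isCompact_singleton (x := T))
        (fun t ht => by
          have h1 := hX l hl t
          have h2 := hP l hl t
          have h3 := hG l hl t
          have h4 := hW l hl t
          have h5 := (h |t|).1.ne'
          have h6 := h1.pow 2
          unfold Q
          refine ContinuousAt.sub (by fun_prop) (ContinuousAt.add (ContinuousAt.mul (by fun_prop)
            (((h2.div h1 h5).div_const _).const_add 1 |>.pow 2)) (ContinuousAt.mul (by fun_prop)
            (ContinuousAt.div
            (((continuousAt_const.mul h6).sub (continuousAt_const.mul h4)).add
              (continuousAt_const.mul h3)) h6 (by simpa using h5)))))
        (by simpa [abs_of_nonneg hT0] using hT)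
      filter_upwards [h1, h2, h3, lt_mem_nhds hl] with m hm1 hm2 hm3 hm
      have e2 := hm2 T rfl
      have e3 := hm3 T rfl
      rw [abs_of_nonneg hT0] at e2 e3
      refine ⟨hm, (hS m hm).not_crosses_of_rise hσ hβ hκ (T := T) (fun t ht => ?_) e2
        (sub_pos.1 e3)⟩
      rcases le_total t 0 with h0 | h0
      · exact (hS m hm).p_pos t h0
      · have := hm1 t ⟨h0, ht⟩
        rwa [abs_of_nonneg h0] at this
  have hUn : (Set.Ioi 0 ∩ U).Nonempty := by
    set α := (3 * σ - 2 * β - 1) / 8 with hα'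
    set l := 2 * (σ + 1) + 24 * σ * κ + 50 * σ * β * κ / α with hl
    have h0 : 0 < 50 * σ * β * κ / α := by positivity
    have h1 : 0 < 24 * σ * κ := by positivity
    have hl0 : 0 < l := by positivity
    refine ⟨l, hl0, hl0, (hS l hl0).crosses_of_large hσ hβ hκ hκ' hα hl0 (by linarith)
      (by linarith) ?_⟩
    rw [← hα', ← div_le_iff₀' hα]
    linarith
  have hVn : (Set.Ioi 0 ∩ V).Nonempty := by
    have hc : Tendsto (fun l : ℝ => (1 / 4 + σ * κ / β) * (1 + l / (σ + 1)) ^ 2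
        + σ / β * (2 * κ * l / β)) (𝓝[>] 0) (𝓝 ((1 / 4 + σ * κ / β) * (1 + 0 / (σ + 1)) ^ 2
        + σ / β * (2 * κ * 0 / β))) :=
      (Continuous.tendsto (by fun_prop) 0).mono_left nhdsWithin_le_nhds
    obtain ⟨l, hl, hl0⟩ := ((hc.eventually (gt_mem_nhds (show _ < 1 / 4 + σ * κ / β + 1 / 4
      by simp))).and self_mem_nhdsWithin).exists
    exact ⟨l, hl0, hl0, (hS l hl0).not_crosses_of_small hσ hβ hκ hl0 hl⟩
  obtain ⟨l, -, h1, h2⟩ := isPreconnected_Ioi U V hUo hVo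
    (fun l hl => by
      by_cases h : Crosses σ l (X l) (P l) (W l)
      · exact Or.inl ⟨hl, h⟩
      · exact Or.inr ⟨hl, h⟩) hUn hVn
  exact h2.2 h1.2

end IsSeparatrix

namespace UnstableSeries

open Finset.HasAntidiagonal (antidiagonal)

/-- Contribution of `x ^ 2 / 2` and `σ w` to the recursion. -/
noncomputable def weight (σ β κ l : ℝ) (n : ℕ) : ℝ := 1 / 2 + σ * κ / (2 * (n + 1) * l + β)

/-- The indicial polynomial of the recursion. -/
noncomputable def indicial (σ l : ℝ) (n : ℕ) : ℝ :=
  4 * (n + 1) * (n + 2) * l ^ 2 + 2 * (σ + 1) * (n + 1) * l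

/-- The leading coefficient. -/
noncomputable def lead (σ κ l : ℝ) : ℝ := l * (l / (l + σ * κ))

/-- Coefficients of `x = ∑ aₙ exp ((2 n + 1) l t)` on the unstable manifold. -/
noncomputable def coef (σ β κ l : ℝ) : ℕ → ℝ
  | 0 => lead σ κ l
  | n + 1 => -(∑ i ∈ (antidiagonal n).attach, coef σ β κ l i.1.1 * (weight σ β κ l i.1.2 *
      ∑ j ∈ (antidiagonal i.1.2).attach, coef σ β κ l j.1.1 * coef σ β κ l j.1.2)) / indicial σ l n
termination_by n => n
decreasing_by
  · have := Finset.HasAntidiagonal.antidiagonal.fst_le i.2; omega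
  · have := Finset.HasAntidiagonal.antidiagonal.fst_le j.2; have := Finset.HasAntidiagonal.antidiagonal.snd_le i.2; omega
  · have := Finset.HasAntidiagonal.antidiagonal.snd_le j.2; have := Finset.HasAntidiagonal.antidiagonal.snd_le i.2; omega

/-- Coefficients of the square of the series with coefficients `a`. -/
def sq (a : ℕ → ℝ) (n : ℕ) : ℝ := ∑ j ∈ antidiagonal n, a j.1 * a j.2

/-- Coefficients of `w = ∑ cₙ exp (2 (n + 1) l t)`. -/
noncomputable def coefW (σ β κ l : ℝ) (n : ℕ) : ℝ :=
  κ * sq (coef σ β κ l) n / (2 * (n + 1) * l + β)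

variable {σ β κ l : ℝ}

theorem coef_zero : coef σ β κ l 0 = lead σ κ l := by
  rw [coef]

theorem coef_succ (n : ℕ) : coef σ β κ l (n + 1) =
    -(∑ i ∈ antidiagonal n, coef σ β κ l i.1 *
      (weight σ β κ l i.2 * sq (coef σ β κ l) i.2)) / indicial σ l n := by
  rw [coef]
  congr 2
  rw [← Finset.sum_attach (antidiagonal n)]
  refine Finset.sum_congr rfl fun i _ => ?_
  rw [sq, ← Finset.sum_attach (antidiagonal i.1.2)]

theorem indicial_pos (hσ : 0 < σ) (hl : 0 < l) (n : ℕ) : 0 < indicial σ l n := by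
  unfold indicial; positivity

theorem lead_pos (hσ : 0 < σ) (hκ : 0 < κ) (hl : 0 < l) : 0 < lead σ κ l := by
  unfold lead; positivity

theorem lead_le (hσ : 0 < σ) (hκ : 0 < κ) (hl : 0 < l) : lead σ κ l ≤ l := by
  have : l / (l + σ * κ) ≤ 1 := (div_le_one (by positivity)).2 (by have := mul_pos hσ hκ; linarith)
  unfold lead; nlinarith

theorem lead_sq_le (hσ : 0 < σ) (hκ : 0 < κ) (hl : 0 < l) :
    (1 / 2 + σ * κ / (2 * l)) * lead σ κ l ^ 2 ≤ l ^ 2 := by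
  have h0 := mul_pos hσ hκ
  have e : (1 / 2 + σ * κ / (2 * l)) * lead σ κ l ^ 2 = l ^ 2 * (l / (2 * (l + σ * κ))) := by
    unfold lead; field_simp
  rw [e]
  have : l / (2 * (l + σ * κ)) ≤ 1 := (div_le_one (by positivity)).2 (by linarith)
  nlinarith [sq_nonneg l]

theorem abs_sq_le {a : ℕ → ℝ} {r : ℝ} {n : ℕ} (hr : 0 ≤ r) (h : ∀ m ≤ n, |a m| ≤ r * (1 / 8) ^ m) :
    |sq a n| ≤ (n + 1) * (r ^ 2 * (1 / 8) ^ n) := by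
  refine (Finset.abs_sum_le_sum_abs _ _).trans ((Finset.sum_le_card_nsmul _ _
    (r ^ 2 * (1 / 8) ^ n) fun j hj => ?_).trans_eq ?_)
  · have e := Finset.HasAntidiagonal.mem_antidiagonal.1 hj
    rw [abs_mul]
    refine (mul_le_mul (h _ (by omega)) (h _ (by omega)) (abs_nonneg _) (by positivity)).trans_eq ?_
    rw [← e, pow_add]; ring
  · rw [Finset.Nat.card_antidiagonal, nsmul_eq_mul]; push_cast; ring

theorem sum_antidiagonal_succ (n : ℕ) :
    ∑ i ∈ antidiagonal n, ((i.2 : ℝ) + 1) = (n + 1) * (n + 2) / 2 := by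
  induction n with
  | zero => simp
  | succ n ih =>
    rw [Finset.Nat.sum_antidiagonal_succ, ih]
    push_cast
    ring

theorem abs_coef_le (hσ : 0 < σ) (hβ : 0 < β) (hκ : 0 < κ) (hl : 0 < l) (n : ℕ) :
    |coef σ β κ l n| ≤ lead σ κ l * (1 / 8) ^ n := by
  have hr := lead_pos hσ hκ hl
  induction n using Nat.strong_induction_on with
  | _ n ih =>
    rcases n with _ | n
    · rw [coef_zero, abs_of_pos hr]; simp
    have hD := indicial_pos hσ hl n
    rw [coef_succ, abs_div, abs_neg, abs_of_pos hD, div_le_iff₀ hD]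
    set M := 1 / 2 + σ * κ / (2 * l) with hM
    set r := lead σ κ l with hr'
    have hM0 : 0 < M := by positivity
    have hw : ∀ j : ℕ, 0 < weight σ β κ l j ∧ weight σ β κ l j ≤ M := fun j => by
      unfold weight
      refine ⟨by positivity, ?_⟩
      rw [hM]
      gcongr
      have : (0 : ℝ) ≤ j * l := by positivity
      nlinarith
    have hterm : ∀ i ∈ antidiagonal n, |coef σ β κ l i.1 *
        (weight σ β κ l i.2 * sq (coef σ β κ l) i.2)| ≤ M * r ^ 3 * (1 / 8) ^ n * (i.2 + 1) := by
      intro i hi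
      have e := Finset.HasAntidiagonal.mem_antidiagonal.1 hi
      rw [abs_mul, abs_mul, abs_of_pos (hw _).1]
      have h1 := ih i.1 (by omega)
      have h2 := abs_sq_le (n := i.2) hr.le fun m hm => ih m (by omega)
      calc _ ≤ (r * (1 / 8) ^ i.1) * (M * ((i.2 + 1) * (r ^ 2 * (1 / 8) ^ i.2))) := by
            gcongr
            · exact mul_nonneg (hw _).1.le (abs_nonneg _)
            · exact (hw _).2
        _ = _ := by rw [← e, pow_add]; ring
    refine (Finset.abs_sum_le_sum_abs _ _).trans ((Finset.sum_le_sum hterm).trans ?_)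
    rw [← Finset.mul_sum, sum_antidiagonal_succ]
    have h3 := lead_sq_le hσ hκ hl
    have h4 : 4 * (n + 1) * (n + 2) * l ^ 2 ≤ indicial σ l n := by
      unfold indicial
      have : 0 ≤ 2 * (σ + 1) * (n + 1) * l := by positivity
      linarith
    calc M * r ^ 3 * (1 / 8) ^ n * ((n + 1) * (n + 2) / 2)
        = (M * r ^ 2) * (r * (1 / 8) ^ n * ((n + 1) * (n + 2) / 2)) := by ring
      _ ≤ l ^ 2 * (r * (1 / 8) ^ n * ((n + 1) * (n + 2) / 2)) := by gcongr
      _ = r * (1 / 8) ^ (n + 1) * (4 * (n + 1) * (n + 2) * l ^ 2) := by rw [pow_succ]; ring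
      _ ≤ _ := by gcongr

end UnstableSeries

namespace UnstableSeries

open Finset.HasAntidiagonal (antidiagonal)

theorem hasSum_of_eq {f g : ℕ → ℝ} {a : ℝ} (h : HasSum f a) (e : ∀ n, g n = f n) : HasSum g a :=
  (funext e : g = f) ▸ h

/-- The sum of a power series. -/
noncomputable def ps (a : ℕ → ℝ) (s : ℝ) : ℝ := ∑' n, a n * s ^ n

/-- Geometric decay of coefficients, which gives convergence of the power series on `[0, 3 / 2]`. -/
def Small (a : ℕ → ℝ) : Prop := ∃ C, ∀ n, |a n| ≤ C * (1 / 2) ^ n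

theorem norm_term_le {a : ℕ → ℝ} {C s : ℝ} {n : ℕ} (h : |a n| ≤ C * (1 / 2) ^ n) (h0 : 0 ≤ s)
    (h1 : s ≤ 3 / 2) : ‖a n * s ^ n‖ ≤ C * (3 / 4) ^ n := by
  have hC : 0 ≤ C * (1 / 2) ^ n := (abs_nonneg _).trans h
  rw [Real.norm_eq_abs, abs_mul, abs_of_nonneg (pow_nonneg h0 n)]
  calc |a n| * s ^ n ≤ (C * (1 / 2) ^ n) * (3 / 2) ^ n := by gcongr
    _ = C * (3 / 4) ^ n := by rw [mul_assoc, ← mul_pow]; norm_num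

theorem summable_geom (C : ℝ) : Summable fun n : ℕ => C * (3 / 4 : ℝ) ^ n :=
  (summable_geometric_of_lt_one (by norm_num) (by norm_num)).mul_left C

namespace Small

variable {a b : ℕ → ℝ} {s : ℝ}

theorem summable_norm (ha : Small a) (h0 : 0 ≤ s) (h1 : s ≤ 3 / 2) :
    Summable fun n => ‖a n * s ^ n‖ := by
  obtain ⟨C, hC⟩ := ha
  refine Summable.of_nonneg_of_le (fun _ => norm_nonneg _) (fun n => norm_term_le (hC n) h0 h1)
    (summable_geom C)

theorem hasSum (ha : Small a) (h0 : 0 ≤ s) (h1 : s ≤ 3 / 2) :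
    HasSum (fun n => a n * s ^ n) (ps a s) :=
  (ha.summable_norm h0 h1).of_norm.hasSum

theorem continuousOn (ha : Small a) : ContinuousOn (ps a) (Set.Icc 0 (3 / 2)) := by
  obtain ⟨C, hC⟩ := ha
  exact continuousOn_tsum (fun n => by fun_prop) (summable_geom C)
    fun n s hs => norm_term_le (hC n) hs.1 hs.2

theorem mul (ha : Small a) (hb : Small b) (h0 : 0 ≤ s) (h1 : s ≤ 3 / 2) :
    HasSum (fun n => (∑ i ∈ antidiagonal n, a i.1 * b i.2) * s ^ n) (ps a s * ps b s) := by
  have hs := ha.summable_norm h0 h1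
  have ht := hb.summable_norm h0 h1
  have e := tsum_mul_tsum_eq_tsum_sum_antidiagonal_of_summable_norm hs ht
  have hsum := (summable_norm_sum_mul_antidiagonal_of_summable_norm hs ht).of_norm.hasSum
  rw [← e] at hsum
  have e' : (fun n => (∑ i ∈ antidiagonal n, a i.1 * b i.2) * s ^ n) = fun n =>
      ∑ i ∈ antidiagonal n, a i.1 * s ^ i.1 * (b i.2 * s ^ i.2) := funext fun n => ?_
  · rw [e']
    exact hsum
  rw [Finset.sum_mul]
  refine Finset.sum_congr rfl fun i hi => ?_
  rw [← Finset.HasAntidiagonal.mem_antidiagonal.1 hi, pow_add]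
  ring

theorem hasDerivAt (ha : Small a) (ha' : Small fun n => n * a n) {m τ : ℝ}
    (hτ : ∀ t < τ, Real.exp (m * t) ≤ 3 / 2) {t : ℝ} (ht : t < τ) :
    HasDerivAt (fun t => ps a (Real.exp (m * t)))
      (m * ps (fun n => n * a n) (Real.exp (m * t))) t := by
  obtain ⟨C, hC⟩ := ha'
  have key := hasDerivAt_tsum_of_isPreconnected (𝕜 := ℝ) (t := Set.Iio τ)
    (g := fun n t => a n * Real.exp (m * t) ^ n)
    (g' := fun n t => m * ((n * a n) * Real.exp (m * t) ^ n))
    (u := fun n => |m| * (C * (3 / 4) ^ n)) (y₀ := t) (y := t)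
    ((summable_geom C).mul_left _) isOpen_Iio isPreconnected_Iio (fun n y _ => ?_)
    (fun n y hy => ?_) ht (ha.summable_norm (Real.exp_pos _).le (hτ t ht)).of_norm ht
  · refine key.congr_deriv ?_
    rw [tsum_mul_left]; rfl
  · have h := ((((hasDerivAt_id y).const_mul m).exp).fun_pow n).const_mul (a n)
    refine h.congr_deriv ?_
    rcases n with _ | n
    · simp
    · simp only [id, Nat.add_sub_cancel, mul_one, pow_succ]
      ring
  · rw [norm_mul, Real.norm_eq_abs]
    exact mul_le_mul_of_nonneg_left (norm_term_le (a := fun n => n * a n) (hC n)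
      (Real.exp_pos _).le (hτ y hy)) (abs_nonneg _)

end Small

theorem small_of_le {a : ℕ → ℝ} {C : ℝ} (h : ∀ n, |a n| ≤ C * (1 / 8) ^ n) (k : ℕ) (hk : k ≤ 2) :
    Small fun n => (n : ℝ) ^ k * a n := by
  have hC : 0 ≤ C := by have := (abs_nonneg _).trans (h 0); simpa using this
  refine ⟨C, fun n => ?_⟩
  have hn : (n : ℝ) ≤ 2 ^ n := by exact_mod_cast Nat.lt_two_pow_self.le
  rw [abs_mul, abs_of_nonneg (by positivity)]
  have h2 : (n : ℝ) ^ k ≤ (2 ^ n) ^ 2 := by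
    refine (pow_le_pow_left₀ (by positivity) hn k).trans ?_
    exact pow_le_pow_right₀ (one_le_pow₀ (by norm_num)) hk
  calc (n : ℝ) ^ k * |a n| ≤ (2 ^ n) ^ 2 * (C * (1 / 8) ^ n) := by
        gcongr; exact h n
    _ = C * (1 / 2) ^ n := by
        rw [← pow_mul, mul_comm n 2, pow_mul, mul_left_comm, ← mul_pow]; norm_num

end UnstableSeries

/-- The part of the unstable manifold of the origin near the origin, parametrized by `t ≤ 0`. -/
structure IsLocalSeparatrix (σ β κ lam : ℝ) (x p w : ℝ → ℝ) : Prop where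
  dx : ∀ t ≤ 0, HasDerivAt x (p t) t
  dp : ∀ t ≤ 0, HasDerivAt p
    (-(σ + 1) * p t + x t * (lam ^ 2 + (σ + 1) * lam - x t ^ 2 / 2 - σ * w t)) t
  dw : ∀ t ≤ 0, HasDerivAt w (κ * x t ^ 2 - β * w t) t
  x_bot : Tendsto x atBot (𝓝 0)
  p_bot : Tendsto p atBot (𝓝 0)
  w_bot : Tendsto w atBot (𝓝 0)
  x_pos : ∀ t ≤ 0, 0 < x t
  p_pos : ∀ t ≤ 0, 0 < p t
  slope_bot : Tendsto (fun t => p t / x t) atBot (𝓝 lam)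

namespace UnstableSeries

open Finset.HasAntidiagonal (antidiagonal)

variable {σ β κ l : ℝ}

theorem abs_coefW_le (hσ : 0 < σ) (hβ : 0 < β) (hκ : 0 < κ) (hl : 0 < l) (n : ℕ) :
    |coefW σ β κ l n| ≤ κ * l / 2 * (1 / 8) ^ n := by
  have hr := lead_pos hσ hκ hl
  have hr' := lead_le hσ hκ hl
  have h := abs_sq_le (n := n) hr.le fun m _ => abs_coef_le hσ hβ hκ hl m
  have hD : 0 < 2 * (n + 1) * l + β := by positivity
  rw [coefW, abs_div, abs_mul, abs_of_pos hκ, abs_of_pos hD, div_le_iff₀ hD]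
  calc κ * |sq (coef σ β κ l) n| ≤ κ * ((n + 1) * (lead σ κ l ^ 2 * (1 / 8) ^ n)) := by gcongr
    _ ≤ κ * ((n + 1) * (l ^ 2 * (1 / 8) ^ n)) := by gcongr
    _ = κ * l / 2 * (1 / 8) ^ n * (2 * (n + 1) * l) := by ring
    _ ≤ κ * l / 2 * (1 / 8) ^ n * (2 * (n + 1) * l + β) := by gcongr; linarith

theorem small_coef (hσ : 0 < σ) (hβ : 0 < β) (hκ : 0 < κ) (hl : 0 < l) :
    Small (coef σ β κ l) := by
  simpa using small_of_le (abs_coef_le hσ hβ hκ hl) 0 (by norm_num)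

theorem small_coef_one (hσ : 0 < σ) (hβ : 0 < β) (hκ : 0 < κ) (hl : 0 < l) :
    Small fun n => n * coef σ β κ l n := by
  simpa using small_of_le (abs_coef_le hσ hβ hκ hl) 1 (by norm_num)

theorem small_coef_two (hσ : 0 < σ) (hβ : 0 < β) (hκ : 0 < κ) (hl : 0 < l) :
    Small fun n => n * (n * coef σ β κ l n) := by
  simpa [pow_two, mul_assoc] using small_of_le (abs_coef_le hσ hβ hκ hl) 2 le_rfl

theorem small_coefW (hσ : 0 < σ) (hβ : 0 < β) (hκ : 0 < κ) (hl : 0 < l) :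
    Small (coefW σ β κ l) := by
  simpa using small_of_le (abs_coefW_le hσ hβ hκ hl) 0 (by norm_num)

theorem small_coefW_one (hσ : 0 < σ) (hβ : 0 < β) (hκ : 0 < κ) (hl : 0 < l) :
    Small fun n => n * coefW σ β κ l n := by
  simpa using small_of_le (abs_coefW_le hσ hβ hκ hl) 1 (by norm_num)

theorem small_sq (hσ : 0 < σ) (hβ : 0 < β) (hκ : 0 < κ) (hl : 0 < l) :
    Small (sq (coef σ β κ l)) := by
  have hr := lead_pos hσ hκ hl
  refine ⟨lead σ κ l ^ 2, fun n => ?_⟩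
  have hn : (n : ℝ) + 1 ≤ 2 ^ n := by exact_mod_cast Nat.lt_two_pow_self
  calc _ ≤ _ := abs_sq_le (n := n) hr.le fun m _ => abs_coef_le hσ hβ hκ hl m
    _ ≤ (2 ^ n * 2 ^ n) * (lead σ κ l ^ 2 * (1 / 8) ^ n) := by
        gcongr
        exact hn.trans (le_mul_of_one_le_left (by positivity) (one_le_pow₀ (by norm_num)))
    _ = lead σ κ l ^ 2 * (1 / 2) ^ n := by
        rw [← mul_pow, mul_left_comm, ← mul_pow]; norm_num

variable {s : ℝ}

theorem ps_sq (hσ : 0 < σ) (hβ : 0 < β) (hκ : 0 < κ) (hl : 0 < l) (h0 : 0 ≤ s) (h1 : s ≤ 3 / 2) :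
    ps (sq (coef σ β κ l)) s = ps (coef σ β κ l) s ^ 2 := by
  have hA := small_coef hσ hβ hκ hl
  rw [pow_two]
  exact ((small_sq hσ hβ hκ hl).hasSum h0 h1).unique (hA.mul hA h0 h1)

theorem coefW_relation (hσ : 0 < σ) (hβ : 0 < β) (hκ : 0 < κ) (hl : 0 < l) (h0 : 0 ≤ s)
    (h1 : s ≤ 3 / 2) :
    2 * l * (ps (coefW σ β κ l) s + ps (fun n => n * coefW σ β κ l n) s) + β * ps (coefW σ β κ l) s
      = κ * ps (coef σ β κ l) s ^ 2 := by
  have hC := (small_coefW hσ hβ hκ hl).hasSum h0 h1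
  have hC1 := (small_coefW_one hσ hβ hκ hl).hasSum h0 h1
  rw [← ps_sq hσ hβ hκ hl h0 h1]
  refine (((hC.add hC1).mul_left (2 * l)).add (hC.mul_left β)).unique ?_
  have e := ((small_sq hσ hβ hκ hl).hasSum h0 h1).mul_left κ
  refine hasSum_of_eq e fun n => ?_
  have hD : (2 * (n + 1) * l + β) ≠ 0 := by positivity
  have : (2 * (n + 1) * l + β) * coefW σ β κ l n = κ * sq (coef σ β κ l) n := by
    unfold coefW; field_simp
  linear_combination (s ^ n) * this

theorem coef_relation (hσ : 0 < σ) (hβ : 0 < β) (hκ : 0 < κ) (hl : 0 < l) (h0 : 0 ≤ s)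
    (h1 : s ≤ 3 / 2) :
    4 * l ^ 2 * (ps (fun n => n * coef σ β κ l n) s + ps (fun n => n * (n * coef σ β κ l n)) s)
      + 2 * (σ + 1) * l * ps (fun n => n * coef σ β κ l n) s
      = -(s * (ps (coef σ β κ l) s * (ps (coef σ β κ l) s ^ 2 / 2
        + σ * ps (coefW σ β κ l) s))) := by
  have hA := small_coef hσ hβ hκ hl
  have hA1 := (small_coef_one hσ hβ hκ hl).hasSum h0 h1
  have hA2 := (small_coef_two hσ hβ hκ hl).hasSum h0 h1
  have e1 := (hA.mul (small_sq hσ hβ hκ hl) h0 h1).mul_left (1 / 2)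
  have e2 := (hA.mul (small_coefW hσ hβ hκ hl) h0 h1).mul_left σ
  have e3 := ((e1.add e2).mul_left s).neg
  have e4 := ((hA1.add hA2).mul_left (4 * l ^ 2)).add (hA1.mul_left (2 * (σ + 1) * l))
  rw [← hasSum_nat_add_iff' 1] at e4
  have e5 := e4.unique (hasSum_of_eq e3 fun n => ?_)
  · rw [ps_sq hσ hβ hκ hl h0 h1] at e5
    simp at e5
    linear_combination e5
  · have hD := (indicial_pos hσ hl n).ne'
    have h3 : indicial σ l n * coef σ β κ l (n + 1) = -(1 / 2 * ∑ i ∈ antidiagonal n,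
        coef σ β κ l i.1 * sq (coef σ β κ l) i.2 + σ * ∑ i ∈ antidiagonal n,
        coef σ β κ l i.1 * coefW σ β κ l i.2) := by
      rw [coef_succ, mul_div_cancel₀ _ hD, Finset.mul_sum, Finset.mul_sum,
        ← Finset.sum_add_distrib]
      congr 1
      refine Finset.sum_congr rfl fun i _ => ?_
      unfold weight coefW
      ring
    unfold indicial at h3
    push_cast
    rw [pow_succ]
    linear_combination (s ^ n * s) * h3

theorem ps_lower (hσ : 0 < σ) (hβ : 0 < β) (hκ : 0 < κ) (hl : 0 < l) (h0 : 0 ≤ s)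
    (h1 : s ≤ 1) :
    0 < ps (coef σ β κ l) s ∧
      0 < ps (coef σ β κ l) s + 2 * ps (fun n => n * coef σ β κ l n) s := by
  have hr := lead_pos hσ hκ hl
  have hA := (small_coef hσ hβ hκ hl).hasSum h0 (by linarith)
  have hA1 := (small_coef_one hσ hβ hκ hl).hasSum h0 (by linarith)
  have hmin : HasSum (fun n : ℕ => (if n = 0 then 2 * lead σ κ l else 0)
      - lead σ κ l * (3 / 8) ^ n) (2 * lead σ κ l - lead σ κ l * (1 - 3 / 8)⁻¹) :=
    (hasSum_ite_eq 0 _).sub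
      ((hasSum_geometric_of_lt_one (by norm_num) (by norm_num)).mul_left _)
  have hpos : 0 < 2 * lead σ κ l - lead σ κ l * (1 - 3 / 8)⁻¹ := by norm_num; linarith
  have main : ∀ u : ℝ, 0 ≤ u → u ≤ 2 → ∀ n : ℕ, (if n = 0 then 2 * lead σ κ l else 0)
      - lead σ κ l * (3 / 8) ^ n ≤ (1 + u * n) * (coef σ β κ l n * s ^ n) := fun u hu hu' n => by
    rcases n with _ | n
    · simp [coef_zero]; linarith
    · have hn : ∀ n : ℕ, 1 + 2 * ((n + 1 : ℕ) : ℝ) ≤ 3 ^ (n + 1) := fun n => by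
        induction n with
        | zero => norm_num
        | succ n ih => rw [pow_succ]; push_cast at ih ⊢; nlinarith
      have h2 : |coef σ β κ l (n + 1) * s ^ (n + 1)| ≤ lead σ κ l * (1 / 8) ^ (n + 1) := by
        rw [abs_mul, abs_of_nonneg (pow_nonneg h0 _)]
        exact (mul_le_of_le_one_right (abs_nonneg _) (pow_le_one₀ h0 h1)).trans
          (abs_coef_le hσ hβ hκ hl _)
      have h3 : |(1 + u * ((n + 1 : ℕ) : ℝ)) * (coef σ β κ l (n + 1) * s ^ (n + 1))|
          ≤ 3 ^ (n + 1) * (lead σ κ l * (1 / 8) ^ (n + 1)) := by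
        rw [abs_mul, abs_of_nonneg (by positivity)]
        refine mul_le_mul (le_trans ?_ (hn n)) h2 (abs_nonneg _) (by positivity)
        gcongr
      have h4 : (3 : ℝ) ^ (n + 1) * (lead σ κ l * (1 / 8) ^ (n + 1))
          = lead σ κ l * (3 / 8) ^ (n + 1) := by
        rw [mul_left_comm, ← mul_pow]; norm_num
      rw [h4] at h3
      have := (abs_le.1 h3).1
      simpa using this
  refine ⟨hpos.trans_le (hasSum_le (fun n => ?_) hmin hA),
    hpos.trans_le (hasSum_le (fun n => ?_) hmin (hA.add (hA1.mul_left 2)))⟩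
  · simpa using main 0 le_rfl (by norm_num) n
  · refine (main 2 (by norm_num) le_rfl n).trans_eq ?_
    ring

end UnstableSeries

namespace UnstableSeries

variable {σ β κ l : ℝ}

variable (σ β κ l) in
/-- The `x` coordinate on the local unstable manifold. -/
noncomputable def locX (t : ℝ) : ℝ := Real.exp (l * t) * ps (coef σ β κ l) (Real.exp (2 * l * t))

variable (σ β κ l) in
/-- The `p` coordinate on the local unstable manifold. -/
noncomputable def locP (t : ℝ) : ℝ := l * (Real.exp (l * t) * (ps (coef σ β κ l)
  (Real.exp (2 * l * t)) + 2 * ps (fun n => n * coef σ β κ l n) (Real.exp (2 * l * t))))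

variable (σ β κ l) in
/-- The `w` coordinate on the local unstable manifold. -/
noncomputable def locW (t : ℝ) : ℝ :=
  Real.exp (2 * l * t) * ps (coefW σ β κ l) (Real.exp (2 * l * t))

theorem hasDerivAt_exp_mul (m t : ℝ) :
    HasDerivAt (fun t => Real.exp (m * t)) (m * Real.exp (m * t)) t := by
  have h := ((hasDerivAt_id t).const_mul m).exp
  refine h.congr_deriv ?_
  simp only [id]; ring

theorem tendsto_ps_exp {a : ℕ → ℝ} (ha : Small a) (hl : 0 < l) :
    Tendsto (fun t => ps a (Real.exp (2 * l * t))) atBot (𝓝 (a 0)) := by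
  have h0 : ps a 0 = a 0 := by
    unfold ps
    rw [tsum_eq_single 0 fun n hn => by simp [hn]]
    simp
  have h1 := ha.continuousOn 0 (by norm_num)
  rw [ContinuousWithinAt, h0] at h1
  refine h1.comp (tendsto_nhdsWithin_iff.2 ⟨?_, ?_⟩)
  · exact Real.tendsto_exp_atBot.comp (tendsto_id.const_mul_atBot (by positivity))
  · filter_upwards [Iic_mem_atBot (0 : ℝ)] with t ht
    refine ⟨(Real.exp_pos _).le, ?_⟩
    have : Real.exp (2 * l * t) ≤ 1 := Real.exp_le_one_iff.2
      (mul_nonpos_of_nonneg_of_nonpos (by positivity) ht)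
    linarith

theorem isLocalSeparatrix (hσ : 0 < σ) (hβ : 0 < β) (hκ : 0 < κ) (hl : 0 < l) :
    IsLocalSeparatrix σ β κ l (locX σ β κ l) (locP σ β κ l) (locW σ β κ l) := by
  set τ := Real.log (3 / 2) / (2 * l) with hτ'
  have hτ : ∀ t < τ, Real.exp (2 * l * t) ≤ 3 / 2 := fun t ht => by
    rw [hτ', lt_div_iff₀ (by positivity)] at ht
    rw [← Real.exp_log (show (0 : ℝ) < 3 / 2 by norm_num)]
    exact Real.exp_le_exp.2 (by linarith)
  have hτ0 : ∀ t ≤ 0, t < τ := fun t ht =>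
    ht.trans_lt (div_pos (Real.log_pos (by norm_num)) (by positivity))
  have hA := small_coef hσ hβ hκ hl
  have hA1 := small_coef_one hσ hβ hκ hl
  have hA2 := small_coef_two hσ hβ hκ hl
  have hC := small_coefW hσ hβ hκ hl
  have hC1 := small_coefW_one hσ hβ hκ hl
  have hS : ∀ t, Real.exp (2 * l * t) = Real.exp (l * t) ^ 2 := fun t => by
    rw [← Real.exp_nat_mul]; congr 1; push_cast; ring
  have hle : ∀ t ≤ 0, Real.exp (2 * l * t) ≤ 1 := fun t ht => Real.exp_le_one_iff.2
    (mul_nonpos_of_nonneg_of_nonpos (by positivity) ht)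
  have hexp : ∀ {m : ℝ}, 0 < m → Tendsto (fun t => Real.exp (m * t)) atBot (𝓝 0) := fun hm =>
    Real.tendsto_exp_atBot.comp (tendsto_id.const_mul_atBot hm)
  have hlow := fun t ht => ps_lower hσ hβ hκ hl (Real.exp_pos (2 * l * t)).le (hle t ht)
  refine ⟨fun t ht => ?_, fun t ht => ?_, fun t ht => ?_, ?_, ?_, ?_, fun t ht => ?_,
    fun t ht => ?_, ?_⟩
  · refine ((hasDerivAt_exp_mul l t).fun_mul (hA.hasDerivAt hA1 hτ (hτ0 t ht))).congr_deriv ?_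
    unfold locP
    ring
  · refine (((hasDerivAt_exp_mul l t).fun_mul ((hA.hasDerivAt hA1 hτ (hτ0 t ht)).fun_add
      ((hA1.hasDerivAt hA2 hτ (hτ0 t ht)).const_mul 2))).const_mul l).congr_deriv ?_
    have e := coef_relation hσ hβ hκ hl (Real.exp_pos (2 * l * t)).le (hτ t (hτ0 t ht))
    unfold locP locX locW
    generalize ps (coef σ β κ l) (Real.exp (2 * l * t)) = A at *
    generalize ps (fun n => n * coef σ β κ l n) (Real.exp (2 * l * t)) = A1 at *
    generalize ps (fun n => n * (n * coef σ β κ l n)) (Real.exp (2 * l * t)) = A2 at *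
    generalize ps (coefW σ β κ l) (Real.exp (2 * l * t)) = C at *
    rw [hS] at *
    linear_combination (Real.exp (l * t)) * e
  · refine ((hasDerivAt_exp_mul (2 * l) t).fun_mul
      (hC.hasDerivAt hC1 hτ (hτ0 t ht))).congr_deriv ?_
    have e := coefW_relation hσ hβ hκ hl (Real.exp_pos (2 * l * t)).le (hτ t (hτ0 t ht))
    unfold locX locW
    rw [mul_pow, ← hS]
    linear_combination (Real.exp (2 * l * t)) * e
  · exact tendsto_nhds_of_eq ((hexp hl).mul (tendsto_ps_exp hA hl)) (zero_mul _)
  · exact tendsto_nhds_of_eq (((hexp hl).mul ((tendsto_ps_exp hA hl).add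
      ((tendsto_ps_exp hA1 hl).const_mul 2))).const_mul l) (by simp)
  · exact tendsto_nhds_of_eq ((hexp (mul_pos two_pos hl)).mul (tendsto_ps_exp hC hl)) (zero_mul _)
  · exact mul_pos (Real.exp_pos _) (hlow t ht).1
  · exact mul_pos hl (mul_pos (Real.exp_pos _) (hlow t ht).2)
  · have h0 : coef σ β κ l 0 ≠ 0 := by rw [coef_zero]; exact (lead_pos hσ hκ hl).ne'
    have h := ((((tendsto_ps_exp hA hl).add ((tendsto_ps_exp hA1 hl).const_mul 2)).const_mul l).div
      (tendsto_ps_exp hA hl) h0)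
    refine (tendsto_nhds_of_eq h ?_).congr fun t => ?_
    · simp; field_simp
    · have := (Real.exp_pos (l * t)).ne'
      simp only [locP, locX, Pi.div_apply]
      rw [mul_left_comm, mul_div_mul_left _ _ this]

theorem continuousOn_coef (hσ : 0 < σ) (hβ : 0 < β) (hκ : 0 < κ) (n : ℕ) :
    ContinuousOn (fun l => coef σ β κ l n) (Set.Ioi 0) := by
  induction n using Nat.strong_induction_on with
  | _ n ih =>
    rcases n with _ | n
    · simp only [coef_zero, lead]
      refine continuousOn_id.mul (continuousOn_id.div (by fun_prop) fun l (hl : 0 < l) => ?_)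
      have := mul_pos hσ hκ
      positivity
    · simp only [coef_succ]
      refine ContinuousOn.div (ContinuousOn.neg (continuousOn_finsetSum _ fun i hi => ?_))
        (by unfold indicial; fun_prop) fun l hl => (indicial_pos hσ hl n).ne'
      have e := Finset.HasAntidiagonal.mem_antidiagonal.1 hi
      refine (ih _ (by omega)).mul (ContinuousOn.mul ?_ (continuousOn_finsetSum _ fun j hj => ?_))
      · unfold weight
        refine continuousOn_const.add (continuousOn_const.div (by fun_prop)
          fun l (hl : 0 < l) => ?_)
        positivity
      · have e' := Finset.HasAntidiagonal.mem_antidiagonal.1 hj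
        exact (ih _ (by omega)).mul (ih _ (by omega))

theorem continuousOn_coefW (hσ : 0 < σ) (hβ : 0 < β) (hκ : 0 < κ) (n : ℕ) :
    ContinuousOn (fun l => coefW σ β κ l n) (Set.Ioi 0) := by
  unfold coefW
  refine (continuousOn_const.mul (continuousOn_finsetSum _ fun j _ =>
    (continuousOn_coef hσ hβ hκ _).mul (continuousOn_coef hσ hβ hκ _))).div (by fun_prop)
    fun l (hl : 0 < l) => ?_
  positivity

/-- A power series at `s = 1` depends continuously on a parameter. -/
theorem continuousAt_ps_one {a : ℝ → ℕ → ℝ} (ha : ∀ n, ContinuousOn (fun l => a l n) (Set.Ioi 0))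
    {C : ℝ → ℝ} (h : ∀ L, ∀ l ∈ Set.Ioo 0 L, ∀ n, |a l n| ≤ C L * (1 / 4) ^ n) (hl : 0 < l) :
    ContinuousAt (fun l => ps (a l) 1) l := by
  have hu : Summable fun n : ℕ => C (l + 1) * (1 / 4 : ℝ) ^ n :=
    (summable_geometric_of_lt_one (by norm_num) (by norm_num)).mul_left _
  have hc : ContinuousOn (fun l => ps (a l) 1) (Set.Ioo 0 (l + 1)) := by
    unfold ps
    refine continuousOn_tsum (fun n => ?_) hu fun n m hm => ?_
    · simp only [one_pow, mul_one]
      exact (ha n).mono fun m hm => hm.1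
    · simpa using h (l + 1) m hm n
  exact hc.continuousAt (Ioo_mem_nhds hl (by linarith))

theorem continuousAt_loc_zero (hσ : 0 < σ) (hβ : 0 < β) (hκ : 0 < κ) (hl : 0 < l) :
    ContinuousAt (fun l => locX σ β κ l 0) l ∧ ContinuousAt (fun l => locP σ β κ l 0) l ∧
      ContinuousAt (fun l => locW σ β κ l 0) l := by
  have hcoef : ∀ L, ∀ l ∈ Set.Ioo 0 L, ∀ n, |coef σ β κ l n| ≤ L * (1 / 8) ^ n :=
    fun L l hl n => (abs_coef_le hσ hβ hκ hl.1 n).trans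
      (mul_le_mul_of_nonneg_right ((lead_le hσ hκ hl.1).trans hl.2.le) (by positivity))
  have h8 : ∀ n : ℕ, (1 / 8 : ℝ) ^ n ≤ (1 / 4) ^ n := fun n =>
    pow_le_pow_left₀ (by norm_num) (by norm_num) n
  have hA := continuousAt_ps_one (C := fun L => L) (continuousOn_coef hσ hβ hκ)
    (fun L l hl n => (hcoef L l hl n).trans
      (mul_le_mul_of_nonneg_left (h8 n) (hl.1.trans hl.2).le)) hl
  have hA1 := continuousAt_ps_one (a := fun l n => n * coef σ β κ l n) (C := fun L => L)
    (fun n => continuousOn_const.mul (continuousOn_coef hσ hβ hκ n))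
    (fun L l hl n => by
      have hn : (n : ℝ) ≤ 2 ^ n := by exact_mod_cast Nat.lt_two_pow_self.le
      rw [abs_mul, Nat.abs_cast]
      calc _ ≤ 2 ^ n * (L * (1 / 8) ^ n) := by
            gcongr
            exact hcoef L l hl n
        _ = L * (1 / 4) ^ n := by rw [mul_left_comm, ← mul_pow]; norm_num) hl
  have hC := continuousAt_ps_one (C := fun L => κ * L / 2) (continuousOn_coefW hσ hβ hκ)
    (fun L l hl n => (abs_coefW_le hσ hβ hκ hl.1 n).trans (by
      have h1 := h8 n
      have h2 := hl.2
      have h3 : 0 < L := hl.1.trans hl.2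
      gcongr)) hl
  simp only [locX, locP, locW, mul_zero, Real.exp_zero, one_mul]
  exact ⟨hA, continuousAt_id.mul (hA.add (continuousAt_const.mul hA1)), hC⟩

end UnstableSeries

theorem hasDerivAt_fst_snd {E F : Type*} [NormedAddCommGroup E] [NormedSpace ℝ E]
    [NormedAddCommGroup F] [NormedSpace ℝ F] {u : ℝ → E × F} {v : E × F} {t : ℝ}
    (h : HasDerivAt u v t) :
    HasDerivAt (fun s => (u s).1) v.1 t ∧ HasDerivAt (fun s => (u s).2) v.2 t :=
  ⟨(ContinuousLinearMap.fst ℝ E F).hasFDerivAt.comp_hasDerivAt t h,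
    (ContinuousLinearMap.snd ℝ E F).hasFDerivAt.comp_hasDerivAt t h⟩

section GlobalExistence

variable {E : Type*} [NormedAddCommGroup E] [NormedSpace ℝ E]

theorem exists_forall_hasDerivAt_of_lipschitzWith [CompleteSpace E] {f : E → E} {K : NNReal}
    (hK : LipschitzWith K f) {M : ℝ} (hM : ∀ q, ‖f q‖ ≤ M) (q₀ : E) :
    ∃ u : ℝ → E, u 0 = q₀ ∧ ∀ t, HasDerivAt u (f (u t)) t := by
  have hM0 : 0 ≤ M := (norm_nonneg _).trans (hM q₀)
  have hloc : ∀ a : ℝ, 0 < a → ∃ u : ℝ → E, u 0 = q₀ ∧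
      ∀ t ∈ Set.Ioo (-a) a, HasDerivAt u (f (u t)) t := fun a ha => by
    have hPL : IsPicardLindelof (fun _ => f)
        (⟨0, by constructor <;> linarith⟩ : Set.Icc (-a) a) q₀
        ⟨M * a, by positivity⟩ 0 ⟨M, hM0⟩ K :=
      IsPicardLindelof.of_time_independent (fun q _ => hM q) hK.lipschitzOnWith (by
        change M * max (a - 0) (0 - -a) ≤ M * a - 0
        simp)
    obtain ⟨u, hu0, hu⟩ := hPL.exists_eq_forall_mem_Icc_hasDerivWithinAt₀
    exact ⟨u, hu0, fun t ht =>
      (hu t (Set.Ioo_subset_Icc_self ht)).hasDerivAt (Icc_mem_nhds ht.1 ht.2)⟩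
  choose! v hv0 hv using hloc
  have huniq : ∀ a b : ℝ, 0 < a → a ≤ b → Set.EqOn (v a) (v b) (Set.Ioo (-a) a) := fun a b ha hab =>
    ODE_solution_unique_of_mem_Ioo (v := fun _ => f) (s := fun _ => Set.univ) (t₀ := 0)
      (fun _ _ => hK.lipschitzOnWith) ⟨by linarith, ha⟩ (fun t ht => ⟨hv a ha t ht, trivial⟩)
      (fun t ht => ⟨hv b (ha.trans_le hab) t ⟨by linarith [ht.1], by linarith [ht.2]⟩, trivial⟩)
      ((hv0 a ha).trans (hv0 b (ha.trans_le hab)).symm)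
  have heq : ∀ a b s : ℝ, |s| < a → |s| < b → v a s = v b s := fun a b s ha hb => by
    have h0 := abs_nonneg s
    rcases le_total a b with h | h
    · exact huniq a b (by linarith) h (abs_lt.1 ha)
    · exact (huniq b a (by linarith) h (abs_lt.1 hb)).symm
  refine ⟨fun t => v (|t| + 1) t, hv0 _ (by simp), fun t => ?_⟩
  have ht : |t| < |t| + 1 := by linarith
  refine (hv (|t| + 1) (by positivity) t (abs_lt.1 ht)).congr_of_eventuallyEq ?_
  filter_upwards [(continuous_abs.tendsto t).eventually (gt_mem_nhds ht)] with s hs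
  exact heq _ _ s (by linarith) hs

/-- Global existence in positive time inside a bounded sublevel set of a Lyapunov function. -/
theorem exists_forall_nonneg_hasDerivAt [FiniteDimensional ℝ E] {f : E → E} (hf : ContDiff ℝ 1 f)
    {V : E → ℝ} {DV : E → E → ℝ}
    (hDV : ∀ {u : ℝ → E} {t : ℝ} {v : E}, HasDerivAt u v t →
      HasDerivAt (fun s => V (u s)) (DV (u t) v) t) {R B : ℝ}
    (hB : ∀ q, V q ≤ R → ‖q‖ ≤ B) (hV : ∀ q, V q = R → DV q (f q) < 0) {q₀ : E} (hq₀ : V q₀ ≤ R) :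
    ∃ u : ℝ → E, u 0 = q₀ ∧ ∀ t, 0 ≤ t → ‖u t‖ ≤ B ∧ HasDerivAt u (f (u t)) t := by
  have : CompleteSpace E := FiniteDimensional.complete ℝ E
  have hB0 : 0 ≤ B := (norm_nonneg _).trans (hB q₀ hq₀)
  let χ : ContDiffBump (0 : E) := ⟨B + 1, B + 2, by linarith, by linarith⟩
  have hχ : ∀ q, V q ≤ R → χ q • f q = f q := fun q hq => by
    rw [χ.one_of_mem_closedBall, one_smul]
    rw [mem_closedBall_zero_iff]
    have := hB q hq
    change ‖q‖ ≤ B + 1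
    linarith
  have hsupp : HasCompactSupport fun q => χ q • f q := χ.hasCompactSupport.smul_right
  have hsmooth : ContDiff ℝ 1 fun q => χ q • f q := χ.contDiff.smul hf
  obtain ⟨K, hK⟩ := hsmooth.lipschitzWith_of_hasCompactSupport hsupp one_ne_zero
  obtain ⟨M, hM⟩ := hsupp.exists_bound_of_continuous hsmooth.continuous
  obtain ⟨u, hu0, hu⟩ := exists_forall_hasDerivAt_of_lipschitzWith hK hM q₀
  have hle : ∀ t, 0 ≤ t → V (u t) ≤ R := fun t ht =>
    image_le_of_deriv_right_lt_deriv_boundary' (f := fun s => V (u s)) (a := 0) (b := t)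
      (B := fun _ => R) (B' := fun _ => 0)
      (fun s _ => (hDV (hu s)).continuousAt.continuousWithinAt)
      (fun s _ => (hDV (hu s)).hasDerivWithinAt) (by rw [hu0]; exact hq₀) continuousOn_const
      (fun s _ => hasDerivWithinAt_const _ _ _)
      (fun s _ hs => by
        rw [hχ _ hs.le]
        exact hV _ hs) ⟨ht, le_rfl⟩
  refine ⟨u, hu0, fun t ht => ⟨hB _ (hle t ht), ?_⟩⟩
  have := hu t
  rwa [hχ _ (hle t ht)] at this

end GlobalExistence

namespace ReducedFlow

/-- The vector field of the reduced system. -/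
noncomputable def field (σ β κ g : ℝ) (q : ℝ × ℝ × ℝ) : ℝ × ℝ × ℝ :=
  (q.2.1, -(σ + 1) * q.2.1 + q.1 * (g - q.1 ^ 2 / 2 - σ * q.2.2), κ * q.1 ^ 2 - β * q.2.2)

theorem contDiff_field (σ β κ g : ℝ) : ContDiff ℝ 1 (field σ β κ g) := by
  unfold field; fun_prop

/-- The square of the distance of `(x, y, z)` to `(0, 0, c)`. -/
noncomputable def lyap (σ c : ℝ) (q : ℝ × ℝ × ℝ) : ℝ :=
  q.1 ^ 2 + (q.1 + q.2.1 / σ) ^ 2 + (q.2.2 + q.1 ^ 2 / (2 * σ) - c) ^ 2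

/-- A level of `lyap` that trajectories from `q` do not cross. -/
noncomputable def level (σ β g : ℝ) (q : ℝ × ℝ × ℝ) : ℝ :=
  lyap σ (σ + 1 + g / σ) q + β * (σ + 1 + g / σ) ^ 2 / (2 * min (min σ 1) (β / 2)) + 1

/-- A bound for trajectories starting at `q`. -/
noncomputable def bound (σ β g : ℝ) (q : ℝ × ℝ × ℝ) : ℝ :=
  (level σ β g q + 1) * (1 + 2 * σ) + (σ + 1 + g / σ) + (level σ β g q + 1) ^ 2 / (2 * σ)

variable {σ β κ g : ℝ}

theorem norm_le_bound (hσ : 0 < σ) (hg : 0 < g) {q q₀ : ℝ × ℝ × ℝ}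
    (h : lyap σ (σ + 1 + g / σ) q ≤ level σ β g q₀) : ‖q‖ ≤ bound σ β g q₀ := by
  obtain ⟨x, p, w⟩ := q
  unfold bound
  have hR : 0 ≤ level σ β g q₀ := by
    refine le_trans ?_ h
    unfold lyap; positivity
  generalize level σ β g q₀ = R at *
  have hc : 0 < σ + 1 + g / σ := by positivity
  generalize σ + 1 + g / σ = c at *
  unfold lyap at h
  simp only at h
  have hle : ∀ a : ℝ, a ^ 2 ≤ R → |a| ≤ R + 1 := fun a ha =>
    abs_le_of_sq_le_sq (by nlinarith) (by linarith)
  have h1 := sq_nonneg x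
  have h2 := sq_nonneg (x + p / σ)
  have h3 := sq_nonneg (w + x ^ 2 / (2 * σ) - c)
  have hx := hle x (by linarith)
  have hy := hle (x + p / σ) (by linarith)
  have hz := hle (w + x ^ 2 / (2 * σ) - c) (by linarith)
  have hx2 : x ^ 2 / (2 * σ) ≤ (R + 1) ^ 2 / (2 * σ) := by
    have := sq_le_sq' (abs_le.1 hx).1 (abs_le.1 hx).2
    gcongr
  have hx0 : 0 ≤ x ^ 2 / (2 * σ) := by positivity
  have hσR : 0 ≤ (R + 1) * (2 * σ) := by positivity
  have hp : |p| ≤ (R + 1) * (2 * σ) := by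
    have e : p = σ * ((x + p / σ) - x) := by field_simp; ring
    rw [e, abs_mul, abs_of_pos hσ]
    have := abs_sub (x + p / σ) x
    nlinarith
  rw [abs_le] at hz
  have hw : |w| ≤ R + 1 + c + (R + 1) ^ 2 / (2 * σ) := abs_le.2 ⟨by linarith [hz.1], by linarith [hz.2]⟩
  simp only [Prod.norm_def, Real.norm_eq_abs]
  refine max_le ?_ (max_le ?_ ?_) <;> nlinarith

theorem exists_forward (hσ : 0 < σ) (hβ : 0 < β) (hκ : 2 * σ * κ = 2 * σ - β) (hg : 0 < g)
    (q₀ : ℝ × ℝ × ℝ) : ∃ u : ℝ → ℝ × ℝ × ℝ, u 0 = q₀ ∧ ∀ t, 0 ≤ t →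
      ‖u t‖ ≤ bound σ β g q₀ ∧ HasDerivAt u (field σ β κ g (u t)) t := by
  have hκ' : κ = 1 - β / (2 * σ) := by field_simp; linarith
  set c := σ + 1 + g / σ with hc
  have hm : 0 < min (min σ 1) (β / 2) := lt_min (lt_min hσ one_pos) (by linarith)
  have hm1 : min (min σ 1) (β / 2) ≤ σ := (min_le_left _ _).trans (min_le_left _ _)
  have hm2 : min (min σ 1) (β / 2) ≤ 1 := (min_le_left _ _).trans (min_le_right _ _)
  have hm3 : min (min σ 1) (β / 2) ≤ β / 2 := min_le_right _ _
  refine exists_forall_nonneg_hasDerivAt (contDiff_field σ β κ g) (V := lyap σ c)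
    (DV := fun q v => 2 * q.1 * v.1 + 2 * (q.1 + q.2.1 / σ) * (v.1 + v.2.1 / σ)
      + 2 * (q.2.2 + q.1 ^ 2 / (2 * σ) - c) * (v.2.2 + 2 * q.1 * v.1 / (2 * σ)))
    (R := level σ β g q₀) (fun {u t v} hu => ?_) (fun q hq => norm_le_bound hσ hg hq)
    (fun q hq => ?_) ?_
  · obtain ⟨h1, h0⟩ := hasDerivAt_fst_snd hu
    obtain ⟨h2, h3⟩ := hasDerivAt_fst_snd h0
    have h := ((h1.fun_pow 2).fun_add ((h1.fun_add (h2.div_const σ)).fun_pow 2)).fun_add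
      (((h3.fun_add ((h1.fun_pow 2).div_const (2 * σ))).sub_const c).fun_pow 2)
    refine h.congr_deriv ?_
    push_cast
    ring
  · obtain ⟨x, p, w⟩ := q
    have hlow : β * c ^ 2 < 2 * min (min σ 1) (β / 2) * lyap σ c (x, p, w) := by
      rw [hq]
      have h0 : 0 ≤ lyap σ c q₀ := by unfold lyap; positivity
      have e : 2 * min (min σ 1) (β / 2) * level σ β g q₀ = β * c ^ 2
          + 2 * min (min σ 1) (β / 2) * (lyap σ c q₀ + 1) := by
        unfold level; rw [← hc]; field_simp; ring
      rw [e]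
      have : 0 < 2 * min (min σ 1) (β / 2) * (lyap σ c q₀ + 1) := by positivity
      linarith
    generalize min (min σ 1) (β / 2) = m at *
    unfold lyap at hlow
    simp only [field] at hlow ⊢
    obtain ⟨y, hy⟩ : ∃ y, y = x + p / σ := ⟨_, rfl⟩
    obtain ⟨z, hz⟩ : ∃ z, z = w + x ^ 2 / (2 * σ) := ⟨_, rfl⟩
    have e : 2 * x * p + 2 * (x + p / σ) * (p + (-(σ + 1) * p + x * (g - x ^ 2 / 2 - σ * w)) / σ)
        + 2 * (w + x ^ 2 / (2 * σ) - c) * (κ * x ^ 2 - β * w + 2 * x * p / (2 * σ))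
        = 2 * (-σ * x ^ 2 - y ^ 2 - β * z ^ 2 + β * c * z) := by
      rw [hy, hz, hκ', hc]; field_simp; ring
    rw [e]
    rw [← hy, ← hz] at hlow
    nlinarith [mul_nonneg (sub_nonneg.2 hm1) (sq_nonneg x),
      mul_nonneg (sub_nonneg.2 hm2) (sq_nonneg y),
      mul_nonneg (sub_nonneg.2 hm3) (sq_nonneg (z - c)), mul_nonneg hβ.le (sq_nonneg z)]
  · unfold level
    rw [← hc]
    have : 0 ≤ β * c ^ 2 / (2 * min (min σ 1) (β / 2)) := by positivity
    linarith

end ReducedFlow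

namespace ReducedFlow

variable {σ β κ : ℝ}

theorem continuous_bound : Continuous fun y : ℝ × ℝ × ℝ × ℝ => bound σ β y.1 y.2 := by
  unfold bound level lyap
  simp only [div_eq_mul_inv]
  fun_prop

theorem dist_field_field_le (σ β κ g g' : ℝ) (q : ℝ × ℝ × ℝ) :
    dist (field σ β κ g q) (field σ β κ g' q) ≤ |g - g'| * ‖q‖ := by
  have e : field σ β κ g q - field σ β κ g' q = (0, (g - g') * q.1, 0) := by
    unfold field
    refine Prod.ext ?_ (Prod.ext ?_ ?_) <;> simp
    ring
  rw [dist_eq_norm, e]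
  have h1 : |(g - g') * q.1| ≤ |g - g'| * ‖q‖ := by
    rw [abs_mul]
    exact mul_le_mul_of_nonneg_left (norm_fst_le q) (abs_nonneg _)
  have h2 : 0 ≤ |g - g'| * ‖q‖ := by positivity
  refine max_le ?_ (max_le h1 ?_) <;> simpa using h2

/-- Bounded forward trajectories depend continuously on the parameters and on time. -/
theorem continuousAt_forward {g B : ℝ → ℝ} {U : ℝ → ℝ → ℝ × ℝ × ℝ}
    (hU : ∀ l, 0 < l → ∀ t, 0 ≤ t → ‖U l t‖ ≤ B l ∧ HasDerivAt (U l) (field σ β κ (g l) (U l t)) t)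
    {l : ℝ} (hl : 0 < l) (hg : ContinuousAt g l) (hB : ContinuousAt B l)
    (h0 : ContinuousAt (fun m => U m 0) l) (t : ℝ) :
    ContinuousAt (fun q : ℝ × ℝ => U q.1 |q.2|) (l, t) := by
  obtain ⟨K, hK⟩ := (contDiff_field σ β κ (g l)).contDiffOn.exists_lipschitzOnWith one_ne_zero
    (convex_closedBall 0 (B l + 1)) (isCompact_closedBall 0 (B l + 1))
  have hK1 : LipschitzOnWith (K + 1) (field σ β κ (g l)) (Metric.closedBall 0 (B l + 1)) :=
    hK.weaken (by simp)
  have hB0 : 0 ≤ B l + 1 := by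
    have := (norm_nonneg _).trans (hU l hl 0 le_rfl).1
    linarith
  set T := |t| + 1 with hT
  have hgron : ∀ᶠ m in 𝓝 l, ∀ s ∈ Set.Icc 0 T, dist (U m s) (U l s) ≤
      gronwallBound (dist (U m 0) (U l 0)) (K + 1 : NNReal) (|g m - g l| * (B l + 1)) T := by
    filter_upwards [lt_mem_nhds hl, hB.eventually (gt_mem_nhds (lt_add_one (B l)))] with m hm hmB
    intro s hs
    have key := dist_le_of_approx_trajectories_ODE_of_mem (v := fun _ => field σ β κ (g l))
      (s := fun _ => Metric.closedBall 0 (B l + 1)) (a := 0) (b := T) (K := K + 1)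
      (f := U m) (f' := fun s => field σ β κ (g m) (U m s)) (g := U l)
      (g' := fun s => field σ β κ (g l) (U l s)) (εf := |g m - g l| * (B l + 1)) (εg := 0)
      (δ := dist (U m 0) (U l 0)) (fun _ _ => hK1)
      (fun r hr => (hU m hm r hr.1).2.continuousAt.continuousWithinAt)
      (fun r hr => (hU m hm r hr.1).2.hasDerivWithinAt)
      (fun r hr => (dist_field_field_le _ _ _ _ _ _).trans
        (mul_le_mul_of_nonneg_left ((hU m hm r hr.1).1.trans hmB.le) (abs_nonneg _)))
      (fun r hr => mem_closedBall_zero_iff.2 ((hU m hm r hr.1).1.trans hmB.le))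
      (fun r hr => (hU l hl r hr.1).2.continuousAt.continuousWithinAt)
      (fun r hr => (hU l hl r hr.1).2.hasDerivWithinAt)
      (fun r hr => by simp)
      (fun r hr => mem_closedBall_zero_iff.2 ((hU l hl r hr.1).1.trans (by linarith)))
      le_rfl s hs
    rw [add_zero, sub_zero] at key
    exact key.trans (gronwallBound_mono dist_nonneg (by positivity) (by positivity) hs.2)
  have hzero : Tendsto (fun m => gronwallBound (dist (U m 0) (U l 0)) (K + 1 : NNReal)
      (|g m - g l| * (B l + 1)) T) (𝓝 l) (𝓝 0) := by
    have hne : ((K + 1 : NNReal) : ℝ) ≠ 0 := by positivity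
    simp only [gronwallBound_of_K_ne_0 hne]
    have h1 : Tendsto (fun m => dist (U m 0) (U l 0)) (𝓝 l) (𝓝 0) :=
      tendsto_iff_dist_tendsto_zero.1 h0
    have h2 : Tendsto (fun m => |g m - g l|) (𝓝 l) (𝓝 0) := tendsto_iff_dist_tendsto_zero.1 hg
    exact tendsto_nhds_of_eq ((h1.mul_const _).add
      (((h2.mul_const (B l + 1)).div_const _).mul_const _)) (by simp)
  have hcont : ContinuousAt (fun s => U l |s|) t :=
    ContinuousAt.comp (g := U l) (hU l hl _ (abs_nonneg t)).2.continuousAt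
      continuous_abs.continuousAt
  rw [ContinuousAt, nhds_prod_eq, tendsto_iff_dist_tendsto_zero]
  refine squeeze_zero' (Eventually.of_forall fun _ => dist_nonneg) ?_ (tendsto_nhds_of_eq
    ((hzero.comp tendsto_fst).add ((tendsto_iff_dist_tendsto_zero.1 hcont).comp tendsto_snd))
    (add_zero 0))
  have hT' : ∀ᶠ s in 𝓝 t, |s| < T := (continuous_abs.tendsto t).eventually
    (gt_mem_nhds (lt_add_one |t|))
  filter_upwards [hgron.prod_mk hT'] with q hq
  exact (dist_triangle _ (U l |q.2|) _).trans
    (add_le_add (hq.1 _ ⟨abs_nonneg _, hq.2.le⟩) le_rfl)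

/-- The function equal to `f₁` on `(-∞, 0]` and to `f₂` on `(0, ∞)`. -/
noncomputable def glue (f₁ f₂ : ℝ → ℝ) (t : ℝ) : ℝ := if t ≤ 0 then f₁ t else f₂ t

theorem glue_of_nonpos {f₁ f₂ : ℝ → ℝ} {t : ℝ} (ht : t ≤ 0) : glue f₁ f₂ t = f₁ t := if_pos ht

theorem glue_of_nonneg {f₁ f₂ : ℝ → ℝ} (h0 : f₁ 0 = f₂ 0) {t : ℝ} (ht : 0 ≤ t) :
    glue f₁ f₂ t = f₂ t := by
  rcases eq_or_lt_of_le ht with rfl | ht'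
  · rw [glue_of_nonpos le_rfl, h0]
  · exact if_neg ht'.not_ge

theorem glue_eventuallyEq_atBot {f₁ f₂ : ℝ → ℝ} : f₁ =ᶠ[atBot] glue f₁ f₂ := by
  filter_upwards [Iic_mem_atBot (0 : ℝ)] with t ht
  exact (glue_of_nonpos ht).symm

theorem hasDerivAt_glue {f₁ f₂ f' : ℝ → ℝ} (h0 : f₁ 0 = f₂ 0)
    (h₁ : ∀ t ≤ 0, HasDerivAt f₁ (f' t) t) (h₂ : ∀ t, 0 ≤ t → HasDerivAt f₂ (f' t) t) (t : ℝ) :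
    HasDerivAt (glue f₁ f₂) (f' t) t := by
  rcases lt_trichotomy t 0 with ht | rfl | ht
  · refine (h₁ t ht.le).congr_of_eventuallyEq ?_
    filter_upwards [gt_mem_nhds ht] with s hs
    exact glue_of_nonpos (le_of_lt hs)
  · rw [← hasDerivWithinAt_univ, ← Set.Iic_union_Ici (a := (0 : ℝ))]
    exact ((h₁ 0 le_rfl).hasDerivWithinAt.congr (fun s hs => glue_of_nonpos hs)
      (glue_of_nonpos le_rfl)).union ((h₂ 0 le_rfl).hasDerivWithinAt.congr
      (fun s hs => glue_of_nonneg h0 hs) (glue_of_nonneg h0 le_rfl))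
  · refine (h₂ t ht.le).congr_of_eventuallyEq ?_
    filter_upwards [lt_mem_nhds ht] with s hs
    exact glue_of_nonneg h0 (le_of_lt hs)

theorem continuousAt_glue {f₁ : ℝ → ℝ → ℝ} {U : ℝ → ℝ → ℝ × ℝ × ℝ} {π : ℝ × ℝ × ℝ → ℝ}
    (hπ : Continuous π) (h0 : ∀ l, 0 < l → f₁ l 0 = π (U l 0)) {l t : ℝ} (hl : 0 < l)
    (hU : ContinuousAt (fun q : ℝ × ℝ => U q.1 |q.2|) (l, t)) :
    ContinuousAt (fun q : ℝ × ℝ => glue (f₁ q.1) (fun t => π (U q.1 t)) |q.2|) (l, t) := by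
  refine (hπ.continuousAt.comp hU).congr ?_
  filter_upwards [(continuous_fst.tendsto (l, t)).eventually (lt_mem_nhds hl)] with q hq
  exact (glue_of_nonneg (f₂ := fun t => π (U q.1 t)) (h0 _ hq) (abs_nonneg _)).symm

end ReducedFlow

open ReducedFlow in
/-- A local separatrix extends by a bounded forward trajectory. -/
theorem IsLocalSeparatrix.isSeparatrix_glue {σ β κ l B : ℝ} {x p w : ℝ → ℝ}
    (h : IsLocalSeparatrix σ β κ l x p w) {u : ℝ → ℝ × ℝ × ℝ} (h0 : u 0 = (x 0, p 0, w 0))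
    (hu : ∀ t, 0 ≤ t → ‖u t‖ ≤ B ∧
      HasDerivAt u (field σ β κ (l ^ 2 + (σ + 1) * l) (u t)) t) :
    IsSeparatrix σ β κ l (glue x fun t => (u t).1) (glue p fun t => (u t).2.1)
      (glue w fun t => (u t).2.2) := by
  have e1 : x 0 = (u 0).1 := by rw [h0]
  have e2 : p 0 = (u 0).2.1 := by rw [h0]
  have e3 : w 0 = (u 0).2.2 := by rw [h0]
  have hx : ∀ t, 0 ≤ t → glue x (fun t => (u t).1) t = (u t).1 := fun _ => glue_of_nonneg e1
  have hp : ∀ t, 0 ≤ t → glue p (fun t => (u t).2.1) t = (u t).2.1 := fun _ => glue_of_nonneg e2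
  have hw : ∀ t, 0 ≤ t → glue w (fun t => (u t).2.2) t = (u t).2.2 := fun _ => glue_of_nonneg e3
  refine ⟨⟨?_, ?_, ?_⟩, h.x_bot.congr' glue_eventuallyEq_atBot,
    h.p_bot.congr' glue_eventuallyEq_atBot, h.w_bot.congr' glue_eventuallyEq_atBot,
    fun t ht => ?_, fun t ht => ?_, ?_, ?_⟩
  · refine hasDerivAt_glue e1 (fun t ht => ?_) fun t ht => ?_
    · rw [glue_of_nonpos ht]
      exact h.dx t ht
    · rw [hp t ht]
      exact (hasDerivAt_fst_snd (hu t ht).2).1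
  · refine hasDerivAt_glue e2 (fun t ht => ?_) fun t ht => ?_
    · rw [glue_of_nonpos ht, glue_of_nonpos ht, glue_of_nonpos ht]
      exact h.dp t ht
    · rw [hx t ht, hp t ht, hw t ht]
      exact (hasDerivAt_fst_snd (hasDerivAt_fst_snd (hu t ht).2).2).1
  · refine hasDerivAt_glue e3 (fun t ht => ?_) fun t ht => ?_
    · rw [glue_of_nonpos ht, glue_of_nonpos ht]
      exact h.dw t ht
    · rw [hx t ht, hw t ht]
      exact (hasDerivAt_fst_snd (hasDerivAt_fst_snd (hu t ht).2).2).2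
  · rw [glue_of_nonpos ht]
    exact h.x_pos t ht
  · rw [glue_of_nonpos ht]
    exact h.p_pos t ht
  · exact h.slope_bot.congr' (glue_eventuallyEq_atBot.div glue_eventuallyEq_atBot)
  · refine ⟨B, fun t ht => ?_⟩
    rw [hx t ht]
    exact (norm_fst_le (u t)).trans (hu t ht).1

open ReducedFlow UnstableSeries in
/-- The separatrices form a continuous family. -/
theorem exists_separatrix_family {σ β κ : ℝ} (hσ : 0 < σ) (hβ : 0 < β) (hκ : 0 < κ)
    (hκ' : 2 * σ * κ = 2 * σ - β) : ∃ X P W : ℝ → ℝ → ℝ,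
      (∀ l, 0 < l → IsSeparatrix σ β κ l (X l) (P l) (W l)) ∧
      (∀ l, 0 < l → ∀ t, ContinuousAt (fun q : ℝ × ℝ => X q.1 |q.2|) (l, t)) ∧
      (∀ l, 0 < l → ∀ t, ContinuousAt (fun q : ℝ × ℝ => P q.1 |q.2|) (l, t)) ∧
      (∀ l, 0 < l → ∀ t, ContinuousAt (fun q : ℝ × ℝ => W q.1 |q.2|) (l, t)) := by
  have hloc := fun l (hl : 0 < l) => isLocalSeparatrix hσ hβ hκ hl
  have hloc0 := fun l (hl : 0 < l) => continuousAt_loc_zero hσ hβ hκ hl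
  generalize locX σ β κ = x at hloc hloc0
  generalize locP σ β κ = p at hloc hloc0
  generalize locW σ β κ = w at hloc hloc0
  have hex : ∀ l, 0 < l → ∃ u : ℝ → ℝ × ℝ × ℝ, u 0 = (x l 0, p l 0, w l 0) ∧ ∀ t, 0 ≤ t →
      ‖u t‖ ≤ bound σ β (l ^ 2 + (σ + 1) * l) (x l 0, p l 0, w l 0) ∧
        HasDerivAt u (field σ β κ (l ^ 2 + (σ + 1) * l) (u t)) t := fun l hl =>
    exists_forward hσ hβ hκ' (by positivity) _
  choose! U hU0 hU using hex
  have hcont : ∀ l, 0 < l → ∀ t, ContinuousAt (fun q : ℝ × ℝ => U q.1 |q.2|) (l, t) := by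
    intro l hl t
    have hg : ContinuousAt (fun l : ℝ => l ^ 2 + (σ + 1) * l) l := by fun_prop
    obtain ⟨h1, h2, h3⟩ := hloc0 l hl
    have hq : ContinuousAt (fun l => (x l 0, p l 0, w l 0)) l := h1.prodMk (h2.prodMk h3)
    have hB : ContinuousAt (fun l => bound σ β (l ^ 2 + (σ + 1) * l) (x l 0, p l 0, w l 0)) l :=
      (continuous_bound (σ := σ) (β := β)).continuousAt.comp (f := fun l =>
        (l ^ 2 + (σ + 1) * l, x l 0, p l 0, w l 0)) (hg.prodMk hq)
    refine continuousAt_forward hU hl hg hB (hq.congr ?_) t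
    filter_upwards [lt_mem_nhds hl] with m hm
    exact (hU0 m hm).symm
  refine ⟨fun l => glue (x l) fun t => (U l t).1, fun l => glue (p l) fun t => (U l t).2.1,
    fun l => glue (w l) fun t => (U l t).2.2,
    fun l hl => (hloc l hl).isSeparatrix_glue (hU0 l hl) (hU l hl), fun l hl t => ?_,
    fun l hl t => ?_, fun l hl t => ?_⟩
  · exact continuousAt_glue (π := fun q => q.1) (by fun_prop)
      (fun l hl => by rw [hU0 l hl]) hl (hcont l hl t)
  · exact continuousAt_glue (π := fun q => q.2.1) (by fun_prop)
      (fun l hl => by rw [hU0 l hl]) hl (hcont l hl t)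
  · exact continuousAt_glue (π := fun q => q.2.2) (by fun_prop)
      (fun l hl => by rw [hU0 l hl]) hl (hcont l hl t)

theorem add_mul_sub_le_of_le_deriv {f f' : ℝ → ℝ} {a c : ℝ}
    (hf : ∀ t, a ≤ t → HasDerivAt f (f' t) t)
    (hc : ∀ t, a ≤ t → c ≤ f' t) {t : ℝ} (ht : a ≤ t) : f a + c * (t - a) ≤ f t := by
  have h := (convex_Ici a).mul_sub_le_image_sub_of_le_deriv
    (fun t ht => (hf t ht).continuousAt.continuousWithinAt)
    (fun t ht => (hf t (interior_subset ht)).differentiableAt.differentiableWithinAt)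
    (C := c) (fun t ht => by
      rw [(hf t (interior_subset ht)).deriv]
      exact hc t (interior_subset ht)) a Set.self_mem_Ici t ht ht
  linarith

theorem exists_pos_of_le_deriv {f f' : ℝ → ℝ} {a c : ℝ} (h0 : 0 < c)
    (hf : ∀ t, a ≤ t → HasDerivAt f (f' t) t) (hc : ∀ t, a ≤ t → c ≤ f' t) :
    ∃ t, a ≤ t ∧ 0 < f t := by
  have ht : a ≤ a + (|f a| + 1) / c := by
    have : 0 ≤ (|f a| + 1) / c := by positivity
    linarith
  refine ⟨_, ht, lt_of_lt_of_le ?_ (add_mul_sub_le_of_le_deriv hf hc ht)⟩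
  rw [add_sub_cancel_left, mul_div_cancel₀ _ h0.ne']
  linarith [neg_abs_le (f a)]

namespace ReducedFlow

variable {σ β κ g : ℝ} {x p w : ℝ → ℝ}

theorem of_lorenz {ρ : ℝ} {u : ℝ → ℝ × ℝ × ℝ} (hσ : 0 < σ) (hκ : 2 * σ * κ = 2 * σ - β)
    (hu : ∀ t, HasDerivAt u (lorenzRHS σ ρ β (u t)) t) :
    ReducedFlow σ β κ (σ * (ρ - 1)) (fun t => (u t).1) (fun t => σ * ((u t).2.1 - (u t).1))
      (fun t => (u t).2.2 - (u t).1 ^ 2 / (2 * σ)) := by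
  have hκ' : κ = 1 - β / (2 * σ) := by field_simp; linarith
  have h1 := fun t => (hasDerivAt_fst_snd (hu t)).1
  have h2 := fun t => hasDerivAt_fst_snd (hasDerivAt_fst_snd (hu t)).2
  refine ⟨h1, fun t => ?_, fun t => ?_⟩
  · refine (((h2 t).1.fun_sub (h1 t)).const_mul σ).congr_deriv ?_
    simp only [lorenzRHS]
    field_simp
    ring
  · refine ((h2 t).2.fun_sub (((h1 t).fun_pow 2).div_const (2 * σ))).congr_deriv ?_
    simp only [lorenzRHS, hκ']
    push_cast
    field_simp
    ring

theorem neg (S : ReducedFlow σ β κ g x p w) :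
    ReducedFlow σ β κ g (fun t => -x t) (fun t => -p t) w :=
  ⟨fun t => (S.dx t).fun_neg, fun t => (S.dp t).fun_neg.congr_deriv (by ring),
    fun t => (S.dw t).congr_deriv (by ring)⟩

theorem w_eq_zero (S : ReducedFlow σ β κ g x p w) (hβ : 0 < β) (hw : Tendsto w atBot (𝓝 0))
    (hx : ∀ t, x t = 0) (t : ℝ) : w t = 0 := by
  refine le_antisymm ?_ ?_
  · have := nonneg_of_deriv_add_nonneg_atBot (T := t) hβ.le (f := fun t => -w t)
      (fun s _ => (S.dw s).fun_neg) (by simpa using hw.neg) fun s _ => by rw [hx s]; linarith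
    linarith
  · exact nonneg_of_deriv_add_nonneg_atBot hβ.le (fun s _ => S.dw s) hw fun s _ => by
      rw [hx s]; linarith

theorem x_eq_zero_of_neg (S : ReducedFlow σ β κ g x p w) (hσ : 0 < σ) (hκ : κ < 0)
    (hx : Tendsto x atBot (𝓝 0)) (hp : Tendsto p atBot (𝓝 0)) (hw : Tendsto w atBot (𝓝 0))
    (hx' : Tendsto x atTop (𝓝 0)) (hp' : Tendsto p atTop (𝓝 0)) (hw' : Tendsto w atTop (𝓝 0))
    (t : ℝ) : x t = 0 := by
  have hκ0 := hκ.ne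
  set c := σ * β / (4 * κ) with hc
  set V : ℝ → ℝ := fun t => p t ^ 2 / 2 - g * x t ^ 2 / 2 + x t ^ 4 / 8
    + σ / 2 * (x t ^ 2 * w t) - c * w t ^ 2
  have hV : ∀ t, HasDerivAt V (-(σ + 1) * p t ^ 2 + σ / (2 * κ) * (κ * x t ^ 2 - β * w t) ^ 2) t :=
    fun t => by
    have h := ((((((S.dp t).fun_pow 2).div_const 2).fun_sub
      ((((S.dx t).fun_pow 2).const_mul g).div_const 2)).fun_add
      (((S.dx t).fun_pow 4).div_const 8)).fun_add
      ((((S.dx t).fun_pow 2).fun_mul (S.dw t)).const_mul (σ / 2))).fun_sub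
      (((S.dw t).fun_pow 2).const_mul c)
    refine h.congr_deriv ?_
    rw [hc]
    push_cast
    field_simp
    ring
  have hlim : ∀ {l : Filter ℝ}, Tendsto x l (𝓝 0) → Tendsto p l (𝓝 0) → Tendsto w l (𝓝 0) →
      Tendsto V l (𝓝 0) := fun hx hp hw =>
    tendsto_nhds_of_eq ((((((hp.pow 2).div_const 2).sub (((hx.pow 2).const_mul g).div_const 2)).add
      ((hx.pow 4).div_const 8)).add (((hx.pow 2).mul hw).const_mul (σ / 2))).sub
      ((hw.pow 2).const_mul c)) (by ring)
  have hle : ∀ t, σ / (2 * κ) * (κ * x t ^ 2 - β * w t) ^ 2 ≤ 0 := fun t =>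
    mul_nonpos_of_nonpos_of_nonneg (div_nonpos_of_nonneg_of_nonpos hσ.le (by linarith))
      (sq_nonneg _)
  have hanti : Antitone V := antitone_of_hasDerivAt_nonpos hV fun t => by
    have := hle t
    have := mul_nonneg (by linarith : (0 : ℝ) ≤ σ + 1) (sq_nonneg (p t))
    show _ ≤ (0 : ℝ)
    linarith
  have h0 : V = fun _ => 0 := funext fun t => le_antisymm
    (hanti.ge_of_tendsto (hlim hx hp hw) t) (hanti.le_of_tendsto (hlim hx' hp' hw') t)
  have hp0 : ∀ t, p t = 0 := fun t => by
    have h1 := hV t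
    rw [h0] at h1
    have h2 := h1.unique (hasDerivAt_const t (0 : ℝ))
    have h3 := hle t
    have h4 : (σ + 1) * p t ^ 2 ≤ 0 := by linarith
    have h5 : p t ^ 2 ≤ 0 := nonpos_of_mul_nonpos_right h4 (by linarith)
    exact pow_eq_zero_iff two_ne_zero |>.1 (le_antisymm h5 (sq_nonneg _))
  have hconst : x = fun _ => x t := funext fun s =>
    is_const_of_deriv_eq_zero (fun t => (S.dx t).differentiableAt)
      (fun t => by rw [(S.dx t).deriv, hp0]) s t
  rw [hconst] at hx
  exact tendsto_nhds_unique tendsto_const_nhds hx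

theorem not_forall_pos_of_F_le (S : ReducedFlow σ β κ g x p w) (hσ : 0 < σ) (hg : 0 < g)
    (hx : Tendsto x atTop (𝓝 0)) (hw : Tendsto w atTop (𝓝 0)) (hw0 : ∀ t, 0 ≤ w t) {T δ : ℝ}
    (hδ : 0 < δ) (hF : ∀ t, T ≤ t → Real.exp ((σ + 1) * t) * F σ g x p w t ≤ -δ)
    (hpos : ∀ t, T ≤ t → 0 < x t) : False := by
  set e := (σ + 1) / 2 with he
  have hG : Tendsto (G σ g x w) atTop (𝓝 g) :=
    tendsto_nhds_of_eq ((((hx.pow 2).div_const 2).const_sub g).sub (hw.const_mul σ)) (by ring)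
  obtain ⟨T₁, hT₁⟩ := eventually_atTop.1 ((hG.eventually (lt_mem_nhds (half_lt_self hg))).and
    (eventually_ge_atTop T))
  have hG1 : ∀ t, T₁ ≤ t → g / 2 ≤ G σ g x w t := fun t ht => (hT₁ t ht).1.le
  have hT : ∀ t, T₁ ≤ t → T ≤ t := fun t ht => (hT₁ t ht).2
  set s : ℝ → ℝ := fun t => Real.exp (e * t) * x t
  set r : ℝ → ℝ := fun t => Real.exp (e * t) * (p t + e * x t)
  have hexp : ∀ t, HasDerivAt (fun t => Real.exp (e * t)) (Real.exp (e * t) * e) t := fun t => by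
    simpa using ((hasDerivAt_id t).const_mul e).exp
  have hr : ∀ t, HasDerivAt r ((e ^ 2 + G σ g x w t) * s t) t := fun t => by
    refine ((hexp t).fun_mul ((S.dp t).fun_add ((S.dx t).const_mul e))).congr_deriv ?_
    simp only [s, G, he]
    ring
  have hd : 0 < 2 * δ / (e ^ 2 + g) := by positivity
  have hs : ∀ t, T₁ ≤ t → √(2 * δ / (e ^ 2 + g)) ≤ s t := fun t ht => by
    refine Real.sqrt_le_iff.2 ⟨(mul_pos (Real.exp_pos _) (hpos t (hT t ht))).le, ?_⟩
    rw [div_le_iff₀ (by positivity)]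
    have h1 := hF t (hT t ht)
    have h2 : Real.exp ((σ + 1) * t) = Real.exp (e * t) ^ 2 := by
      rw [← Real.exp_nat_mul, he]; congr 1; push_cast; ring
    have h3 : Real.exp (e * t) ^ 2 * F σ g x p w t = (r t ^ 2 - (e ^ 2 + g) * s t ^ 2) / 2 +
        Real.exp (e * t) ^ 2 * (x t ^ 4 / 8 + σ / 2 * (x t ^ 2 * w t)) := by
      simp only [r, s, F, he]; ring
    have h4 : 0 ≤ Real.exp (e * t) ^ 2 * (x t ^ 4 / 8 + σ / 2 * (x t ^ 2 * w t)) := by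
      have := hw0 t
      positivity
    rw [h2, h3] at h1
    linarith [sq_nonneg (r t)]
  have hr' : ∀ t, T₁ ≤ t → (e ^ 2 + g / 2) * √(2 * δ / (e ^ 2 + g)) ≤
      (e ^ 2 + G σ g x w t) * s t := fun t ht =>
    mul_le_mul (by linarith [hG1 t ht]) (hs t ht) (Real.sqrt_nonneg _)
      (by linarith [hG1 t ht, sq_nonneg e])
  obtain ⟨t₁, ht₁, hrt₁⟩ := exists_pos_of_le_deriv (by positivity) (fun t _ => hr t) hr'
  have hslope : ∀ t, t₁ ≤ t → 0 < p t + e * x t := fun t ht => by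
    have h := add_mul_sub_le_of_le_deriv (fun t _ => hr t) (c := 0) (a := t₁) (fun s hs =>
      (by positivity : (0 : ℝ) ≤ (e ^ 2 + g / 2) * √(2 * δ / (e ^ 2 + g))).trans
        (hr' s (ht₁.trans hs))) ht
    have h' : 0 < r t := by linarith
    exact pos_of_mul_pos_right h' (Real.exp_pos _).le
  obtain ⟨t₂, ht₂, hpt₂⟩ : ∃ t, t₁ ≤ t ∧ 0 < p t := by
    by_contra! hp
    obtain ⟨t, ht, hv⟩ := exists_pos_of_le_deriv (half_pos hg) (a := t₁)
      (f := fun t => p t / x t)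
      (fun t ht => S.hasDerivAt_slope (hpos t (hT t (ht₁.trans ht))).ne') fun t ht => by
        have hxt := hpos t (hT t (ht₁.trans ht))
        rw [le_div_iff₀ (by positivity)]
        have h1 := mul_nonneg (neg_nonneg.2 (hp t ht))
          (by nlinarith [hslope t ht] : 0 ≤ 2 * e * x t + p t)
        have h2 := mul_le_mul_of_nonneg_right (hG1 t (ht₁.trans ht)) (sq_nonneg (x t))
        unfold J
        rw [he] at h1
        nlinarith
    exact absurd ((div_pos_iff_of_pos_right (hpos t (hT t (ht₁.trans ht)))).1 hv)
      (hp t ht).not_gt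
  have hT₂ : ∀ t, t₂ ≤ t → T₁ ≤ t := fun t ht => ht₁.trans (ht₂.trans ht)
  have hp : ∀ t, t₂ ≤ t → 0 ≤ p t := fun t ht =>
    (pos_of_deriv_add_nonneg ht (a := σ + 1) (fun r _ => S.dp r) (fun r hr => by
      have h1 := hG1 r (hT₂ r hr.1.le)
      have := mul_nonneg (hpos r (hT r (hT₂ r hr.1.le))).le (by linarith : 0 ≤ G σ g x w r)
      unfold G at this
      linarith) hpt₂).le
  have hxt := hpos t₂ (hT t₂ (hT₂ t₂ le_rfl))
  refine absurd (ge_of_tendsto hx ?_) hxt.not_ge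
  filter_upwards [eventually_ge_atTop t₂] with t ht
  have := add_mul_sub_le_of_le_deriv (fun t _ => S.dx t) (c := 0) hp ht
  linarith

theorem x_eq_zero_of_nonneg (S : ReducedFlow σ β κ g x p w) (hσ : 0 < σ) (hβ : 0 < β) (hg : 0 < g)
    (hκ : 0 ≤ κ) (hκ' : 2 * σ * κ = 2 * σ - β) (hα : 3 * σ - 2 * β - 1 ≤ 0)
    (hx : Tendsto x atBot (𝓝 0)) (hp : Tendsto p atBot (𝓝 0)) (hw : Tendsto w atBot (𝓝 0))
    (hx' : Tendsto x atTop (𝓝 0)) (hw' : Tendsto w atTop (𝓝 0)) (t : ℝ) : x t = 0 := by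
  by_contra hxt
  have hw0 := S.w_nonneg hβ hκ hw
  set N : ℝ → ℝ := fun t => -F σ g x p w t with hN
  set R : ℝ → ℝ := fun t => -((3 * σ - 2 * β - 1) / 8) * x t ^ 4 + σ * β / 2 * (x t ^ 2 * w t)
  have hdN : ∀ t, HasDerivAt N (-(σ + 1) * N t + R t) t := fun t => by
    refine (S.hasDerivAt_F hκ' t).fun_neg.congr_deriv ?_
    simp only [hN, R]
    ring
  have hR : ∀ t, 0 ≤ R t := fun t => by
    have h1 := hw0 t
    have h2 : 0 ≤ -((3 * σ - 2 * β - 1) / 8) := by linarith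
    positivity
  have hNbot : Tendsto N atBot (𝓝 0) := by
    have h := (((((hp.pow 2).div_const 2).add ((hx.mul hp).const_mul ((σ + 1) / 2))).sub
      (((hx.pow 2).const_mul g).div_const 2)).add ((hx.pow 4).div_const 8)).add
      (((hx.pow 2).mul hw).const_mul (σ / 2))
    exact tendsto_nhds_of_eq h.neg (by ring)
  have hN0 : ∀ t, 0 ≤ N t := fun t =>
    nonneg_of_deriv_add_nonneg_atBot (by linarith : 0 ≤ σ + 1) (fun s _ => hdN s) hNbot
      fun s _ => by linarith [hR s]
  obtain ⟨T, hT⟩ : ∃ T, 0 < N T := by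
    by_contra! h
    have hNz : N = fun _ => 0 := funext fun t => le_antisymm (h t) (hN0 t)
    have hRz : ∀ t, R t = 0 := fun t => by
      have h1 := hdN t
      rw [hNz] at h1
      have := h1.unique (hasDerivAt_const t (0 : ℝ))
      linarith
    rcases hκ.eq_or_lt with h0 | h0
    · rw [← h0] at hκ'
      have h1 := hRz t
      have h2 : 0 < -((3 * σ - 2 * β - 1) / 8) * x t ^ 4 := by
        have : 0 < -((3 * σ - 2 * β - 1) / 8) := by linarith
        positivity
      have h3 : 0 ≤ σ * β / 2 * (x t ^ 2 * w t) := by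
        have := hw0 t
        positivity
      simp only [R] at h1
      linarith
    · obtain ⟨s, hs, hts⟩ := ((((S.continuous_x.tendsto t).eventually_ne hxt).filter_mono
        nhdsWithin_le_nhds).and (self_mem_nhdsWithin (s := Set.Ioi t))).exists
      have h1 := hRz s
      have h2 := S.w_pos_of_lt hβ h0 hw hts hxt
      have h3 : 0 < σ * β / 2 * (x s ^ 2 * w s) := by positivity
      have h4 : 0 ≤ -((3 * σ - 2 * β - 1) / 8) * x s ^ 4 := by
        have : 0 ≤ -((3 * σ - 2 * β - 1) / 8) := by linarith
        positivity
      simp only [R] at h1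
      linarith
  set δ := Real.exp ((σ + 1) * T) * N T with hδ
  have hF : ∀ t, T ≤ t → Real.exp ((σ + 1) * t) * F σ g x p w t ≤ -δ := fun t ht => by
    have h := monotoneOn_exp_mul_of_deriv (a := σ + 1) (t₀ := T) (T := t) (fun s _ => hdN s)
      (fun s _ => by linarith [hR s]) ⟨le_rfl, ht⟩ ⟨ht, le_rfl⟩ ht
    simp only [hN] at h hδ
    linarith
  have hδ0 : 0 < δ := mul_pos (Real.exp_pos _) hT
  have hne : ∀ t, T ≤ t → x t ≠ 0 := fun t ht h0 => by
    have h1 := hF t ht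
    have h2 : 0 ≤ F σ g x p w t := by
      simp only [F, h0]
      nlinarith [sq_nonneg (p t)]
    have := mul_nonneg (Real.exp_pos ((σ + 1) * t)).le h2
    linarith
  have hsign : (∀ t, T ≤ t → 0 < x t) ∨ ∀ t, T ≤ t → 0 < -x t := by
    by_contra! h
    obtain ⟨⟨a, ha, hxa⟩, b, hb, hxb⟩ := h
    obtain ⟨c, hc, hxc⟩ := isPreconnected_Ici.intermediate_value (Set.mem_Ici.2 ha)
      (Set.mem_Ici.2 hb) S.continuous_x.continuousOn ⟨hxa, by linarith⟩
    exact hne c hc hxc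
  rcases hsign with h | h
  · exact S.not_forall_pos_of_F_le hσ hg hx' hw' hw0 hδ0 hF h
  · refine S.neg.not_forall_pos_of_F_le hσ hg (by simpa using hx'.neg) hw' hw0 hδ0
      (fun t ht => ?_) h
    refine le_of_eq_of_le ?_ (hF t ht)
    unfold F
    ring

end ReducedFlow

theorem not_homoclinic {σ β ρ : ℝ} (hσ : 0 < σ) (hβ : 0 < β) (hρ : 1 < ρ)
    (hα : 3 * σ ≤ 2 * β + 1) {u : ℝ → ℝ × ℝ × ℝ}
    (hu : ∀ t, HasDerivAt u (lorenzRHS σ ρ β (u t)) t) (htop : Tendsto u atTop (𝓝 0))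
    (hbot : Tendsto u atBot (𝓝 0)) (t : ℝ) : u t = 0 := by
  obtain ⟨κ, hκ'⟩ : ∃ κ, 2 * σ * κ = 2 * σ - β := ⟨(2 * σ - β) / (2 * σ), by field_simp⟩
  have S := ReducedFlow.of_lorenz hσ hκ' hu
  have hlim : ∀ {l : Filter ℝ}, Tendsto u l (𝓝 0) → Tendsto (fun t => (u t).1) l (𝓝 0) ∧
      Tendsto (fun t => σ * ((u t).2.1 - (u t).1)) l (𝓝 0) ∧
      Tendsto (fun t => (u t).2.2 - (u t).1 ^ 2 / (2 * σ)) l (𝓝 0) := fun h => by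
    have h1 := (continuous_fst.tendsto (0 : ℝ × ℝ × ℝ)).comp h
    have h2 := ((continuous_fst.comp continuous_snd).tendsto (0 : ℝ × ℝ × ℝ)).comp h
    have h3 := ((continuous_snd.comp continuous_snd).tendsto (0 : ℝ × ℝ × ℝ)).comp h
    exact ⟨h1, tendsto_nhds_of_eq ((h2.sub h1).const_mul σ) (by simp),
      tendsto_nhds_of_eq (h3.sub ((h1.pow 2).div_const (2 * σ))) (by simp)⟩
  obtain ⟨a1, a2, a3⟩ := hlim hbot
  obtain ⟨b1, b2, b3⟩ := hlim htop
  have hx : ∀ t, (u t).1 = 0 := fun t => by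
    rcases lt_or_ge κ 0 with hκ | hκ
    · exact S.x_eq_zero_of_neg hσ hκ a1 a2 a3 b1 b2 b3 t
    · exact S.x_eq_zero_of_nonneg hσ hβ (mul_pos hσ (by linarith)) hκ hκ' (by linarith)
        a1 a2 a3 b1 b3 t
  have hy : (u t).2.1 = 0 := by
    have h := (S.dx t).unique ((hasDerivAt_const t (0 : ℝ)).congr_of_eventuallyEq
      (Eventually.of_forall hx))
    rw [hx t, sub_zero] at h
    exact (mul_eq_zero.1 h).resolve_left hσ.ne'
  have hz := S.w_eq_zero hβ a3 hx t
  simp only [hx t] at hz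
  exact Prod.ext (hx t) (Prod.ext hy (by simpa using hz))

/-- for `σ, β > 0`, there exists `ρ > 1` such that the Lorenz system with
parameters `(σ, ρ, β)` has a homoclinic trajectory to the origin iff `2β + 1 < 3σ`. -/
theorem lorenz_homoclinic_iff (σ β : ℝ) (hσ : 0 < σ) (hβ : 0 < β) :
    (∃ ρ : ℝ, 1 < ρ ∧ ∃ u : ℝ → ℝ × ℝ × ℝ,
      (∀ t : ℝ, HasDerivAt u (lorenzRHS σ ρ β (u t)) t) ∧
      (∃ t₁ t₂ : ℝ, u t₁ ≠ u t₂) ∧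
      Tendsto u atTop (nhds 0) ∧ Tendsto u atBot (nhds 0)) ↔
    2 * β + 1 < 3 * σ := by
  refine ⟨fun ⟨ρ, hρ, u, hu, ⟨t₁, t₂, hne⟩, htop, hbot⟩ => ?_, fun h => ?_⟩
  · by_contra! hα
    have h0 := not_homoclinic hσ hβ hρ hα hu htop hbot
    exact hne ((h0 t₁).trans (h0 t₂).symm)
  · have hκ : 0 < (2 * σ - β) / (2 * σ) := div_pos (by linarith) (by linarith)
    have hκ' : 2 * σ * ((2 * σ - β) / (2 * σ)) = 2 * σ - β := by field_simp
    obtain ⟨X, P, W, hS, hX, hP, hW⟩ := exists_separatrix_family hσ hβ hκ hκ'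
    exact IsSeparatrix.exists_homoclinic_of_family hσ hβ hκ hκ' (by linarith) hS hX hP hW
end

section
/- Let f : ℝⁿ → ℝⁿ be continuously differentiable and let x₀ be an equilibrium point, f(x₀) = 0, such that div f(x₀) = trace(Df(x₀)) > 0. Then the stationary solution x(t) ≡ x₀ is Lyapunov unstable: there exists ε > 0 such that for every δ > 0 there exist T ≥ 0 and a solution u of u' = f(u) defined on [0, T] with ‖u(0) − x₀‖ < δ and ‖u(T) − x₀‖ ≥ ε. -/
open Filter Topology

/-- The Jacobian matrix of a vector field `f : ℝⁿ → ℝⁿ` at a point `x`: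
`(Df(x))ᵢⱼ = ∂fᵢ/∂xⱼ (x)`. -/
noncomputable def jacobian {n : ℕ}
    (f : EuclideanSpace ℝ (Fin n) → EuclideanSpace ℝ (Fin n))
    (x : EuclideanSpace ℝ (Fin n)) : Matrix (Fin n) (Fin n) ℝ :=
  Matrix.of fun i j => fderiv ℝ f x (EuclideanSpace.single j 1) i

open Set Metric MeasureTheory
open scoped NNReal ENNReal

section Flow

variable {E : Type*} [NormedAddCommGroup E] [NormedSpace ℝ E]

/-- A bounded, globally Lipschitz autonomous vector field has solutions on every `[0, T]`. -/
theorem LipschitzWith.exists_forall_mem_Icc_hasDerivAt [CompleteSpace E] {g : E → E} {K L : ℝ≥0}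
    (hg : LipschitzWith K g) (hL : ∀ x, ‖g x‖ ≤ L) (x : E) {T : ℝ} (hT : 0 ≤ T) :
    ∃ u : ℝ → E, u 0 = x ∧ ∀ t ∈ Icc 0 T, HasDerivAt u (g (u t)) t := by
  have h0 : (0 : ℝ) ∈ Icc (-1) (T + 1) := ⟨by norm_num, by linarith⟩
  have hPL : IsPicardLindelof (fun _ ↦ g) (⟨0, h0⟩ : Icc (-1 : ℝ) (T + 1)) x
      (L * (T.toNNReal + 1)) 0 L K := by
    refine IsPicardLindelof.of_time_independent (fun x _ ↦ hL x) hg.lipschitzOnWith ?_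
    simp [Real.coe_toNNReal T hT, hT]
  obtain ⟨u, hu0, hu⟩ := hPL.exists_eq_forall_mem_Icc_hasDerivWithinAt₀
  exact ⟨u, hu0, fun t ht ↦ (hu t ⟨by linarith [ht.1], by linarith [ht.2]⟩).hasDerivAt
    (Icc_mem_nhds (by linarith [ht.1]) (by linarith [ht.2]))⟩

/-- If `f` is close to the linear map `A` in the Lipschitz sense, then the time-`h` evolution of
the difference of two solutions of `u' = f(u)` is close to `exp (h • A)`. -/
theorem ApproximatesLinearOn.norm_sub_sub_exp_le [CompleteSpace E] {f : E → E} {A : E →L[ℝ] E}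
    {s : Set E} {η : ℝ≥0} (hf : ApproximatesLinearOn f A s η) (hη : η ≤ 1) {u v : ℝ → E} {h : ℝ}
    (hh : 0 ≤ h) (hu : ∀ t ∈ Icc 0 h, HasDerivAt u (f (u t)) t)
    (hv : ∀ t ∈ Icc 0 h, HasDerivAt v (f (v t)) t)
    (hus : ∀ t ∈ Icc 0 h, u t ∈ s) (hvs : ∀ t ∈ Icc 0 h, v t ∈ s) :
    ‖u h - v h - NormedSpace.exp (h • A) (u 0 - v 0)‖ ≤
      η * Real.exp ((‖A‖ + 1) * h) ^ 2 * ‖u 0 - v 0‖ := by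
  set K : ℝ := ‖A‖ + 1 with hK
  have hK1 : 1 ≤ K := by simp [hK]
  have hη' : (η : ℝ) ≤ 1 := mod_cast hη
  have hres : ∀ t ∈ Icc 0 h, ‖f (u t) - f (v t) - A (u t - v t)‖ ≤ η * ‖u t - v t‖ :=
    fun t ht ↦ hf _ (hus t ht) _ (hvs t ht)
  have hw : ∀ t ∈ Icc 0 h, HasDerivAt (fun t ↦ u t - v t) (f (u t) - f (v t)) t :=
    fun t ht ↦ (hu t ht).sub (hv t ht)
  have hgrowth : ∀ t ∈ Icc 0 h, ‖u t - v t‖ ≤ ‖u 0 - v 0‖ * Real.exp (K * h) := by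
    intro t ht
    have := norm_le_gronwallBound_of_norm_deriv_right_le (δ := ‖u 0 - v 0‖) (K := K) (ε := 0)
      (fun t ht ↦ (hw t ht).continuousAt.continuousWithinAt)
      (fun t ht ↦ (hw t (Ico_subset_Icc_self ht)).hasDerivWithinAt) le_rfl
      (fun t ht ↦ by
        have h1 := hres t (Ico_subset_Icc_self ht)
        have h2 := A.le_opNorm (u t - v t)
        have h3 := norm_le_norm_sub_add (f (u t) - f (v t)) (A (u t - v t))
        have h4 := mul_le_mul_of_nonneg_right hη' (norm_nonneg (u t - v t))
        rw [hK]; linarith) t ht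
    rw [gronwallBound_ε0, sub_zero] at this
    refine this.trans ?_
    gcongr
    exact ht.2
  have hexp : ∀ t : ℝ, HasDerivAt (fun t : ℝ ↦ NormedSpace.exp (t • A) (u 0 - v 0))
      (A (NormedSpace.exp (t • A) (u 0 - v 0))) t := fun t ↦ by
    simpa using (hasDerivAt_exp_smul_const' A t).clm_apply (hasDerivAt_const t (u 0 - v 0))
  have he : ∀ t ∈ Icc 0 h,
      HasDerivAt (fun t ↦ u t - v t - NormedSpace.exp (t • A) (u 0 - v 0))
        (f (u t) - f (v t) - A (NormedSpace.exp (t • A) (u 0 - v 0))) t :=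
    fun t ht ↦ (hw t ht).sub (hexp t)
  have := norm_le_gronwallBound_of_norm_deriv_right_le (δ := 0) (K := K)
      (ε := η * (‖u 0 - v 0‖ * Real.exp (K * h)))
      (fun t ht ↦ (he t ht).continuousAt.continuousWithinAt)
      (fun t ht ↦ (he t (Ico_subset_Icc_self ht)).hasDerivWithinAt) (by simp)
      (fun t ht ↦ by
        have ht' := Ico_subset_Icc_self ht
        have h1 := hres t ht'
        have h2 := A.le_opNorm (u t - v t - NormedSpace.exp (t • A) (u 0 - v 0))
        have h3 := norm_add_le (f (u t) - f (v t) - A (u t - v t))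
          (A (u t - v t - NormedSpace.exp (t • A) (u 0 - v 0)))
        rw [map_sub A (u t - v t), sub_add_sub_cancel, ← map_sub A] at h3
        rw [map_sub A (u t - v t)] at h2 h3
        have h4 := mul_le_mul_of_nonneg_left (hgrowth t ht') η.coe_nonneg
        have h5 := norm_nonneg (u t - v t - NormedSpace.exp (t • A) (u 0 - v 0))
        rw [hK] at h4 ⊢; linarith) h ⟨hh, le_rfl⟩
  refine this.trans ?_
  rw [gronwallBound_of_K_ne_0 (by positivity)]
  simp only [zero_mul, zero_add, sub_zero]
  set ρ := Real.exp (K * h)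
  have hρ : 1 ≤ ρ := Real.one_le_exp (by positivity)
  calc η * (‖u 0 - v 0‖ * ρ) / K * (ρ - 1) ≤ η * (‖u 0 - v 0‖ * ρ) / 1 * ρ := by
        gcongr; linarith
    _ = η * ρ ^ 2 * ‖u 0 - v 0‖ := by ring

end Flow

section Det

variable {E : Type*} [NormedAddCommGroup E] [NormedSpace ℝ E] [FiniteDimensional ℝ E]

theorem ContinuousLinearMap.differentiable_det :
    Differentiable ℝ (ContinuousLinearMap.det : (E →L[ℝ] E) → ℝ) := by
  let b := Module.finBasis ℝ E
  have h : (ContinuousLinearMap.det : (E →L[ℝ] E) → ℝ) = fun B ↦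
      ∑ σ : Equiv.Perm (Fin (Module.finrank ℝ E)), (Equiv.Perm.sign σ : ℤ) •
        ∏ i, b.coord (σ i) (B (b i)) := by
    ext B
    rw [ContinuousLinearMap.det, ← LinearMap.det_toMatrix b, Matrix.det_apply]
    simp [LinearMap.toMatrix_apply, Units.smul_def]
  rw [h]
  have hc : ∀ i j, Differentiable ℝ fun B : E →L[ℝ] E ↦ b.coord i (B (b j)) := fun i j ↦
    ((b.coord i).toContinuousLinearMap.comp
      (ContinuousLinearMap.apply ℝ E (b j))).differentiable
  fun_prop

theorem ContinuousLinearMap.hasDerivAt_det_one_add_smul (A : E →L[ℝ] E) :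
    HasDerivAt (fun t : ℝ ↦ (1 + t • A).det) (LinearMap.trace ℝ E A) 0 := by
  let b := Module.finBasis ℝ E
  set M := LinearMap.toMatrix b b (A : E →ₗ[ℝ] E)
  set p := Matrix.det (1 + (Polynomial.X : Polynomial ℝ) • M.map Polynomial.C)
  have h : (fun t : ℝ ↦ (1 + t • A).det) = fun t ↦ p.eval t := by
    ext t
    rw [ContinuousLinearMap.det, ← LinearMap.det_toMatrix b, ← Polynomial.coe_evalRingHom,
      RingHom.map_det]
    congr 1
    ext i j
    simp [M, LinearMap.toMatrix_apply, Matrix.one_apply, apply_ite, Finsupp.single_apply, eq_comm]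
    ring
  rw [h, LinearMap.trace_eq_matrix_trace ℝ b, ← Matrix.derivative_det_one_add_X_smul]
  exact p.hasDerivAt 0

theorem ContinuousLinearMap.hasDerivAt_det_exp_smul (A : E →L[ℝ] E) :
    HasDerivAt (fun t : ℝ ↦ (NormedSpace.exp (t • A)).det) (LinearMap.trace ℝ E A) 0 := by
  have : CompleteSpace E := FiniteDimensional.complete ℝ E
  have hD := (ContinuousLinearMap.differentiable_det (E := E) 1).hasFDerivAt
  have h1 : HasDerivAt (fun t : ℝ ↦ 1 + t • A) A 0 := by
    simpa using ((hasDerivAt_id (0 : ℝ)).smul_const A).const_add 1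
  have h2 : HasDerivAt (fun t : ℝ ↦ NormedSpace.exp (t • A)) A 0 := by
    simpa using hasDerivAt_exp_smul_const A (0 : ℝ)
  have e1 := HasFDerivAt.comp_hasDerivAt_of_eq (0 : ℝ) hD h1 (by simp)
  have e2 := HasFDerivAt.comp_hasDerivAt_of_eq (0 : ℝ) hD h2 (by simp)
  rwa [e1.unique A.hasDerivAt_det_one_add_smul] at e2

theorem ContinuousLinearMap.exists_pos_one_lt_det_exp_smul (A : E →L[ℝ] E)
    (hA : 0 < LinearMap.trace ℝ E A) : ∃ h > (0 : ℝ), 1 < (NormedSpace.exp (h • A)).det := by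
  have hd := A.hasDerivAt_det_exp_smul
  have hev := (hasDerivAt_iff_tendsto_slope.1 hd).mono_left (nhdsGT_le_nhdsNE 0)
    |>.eventually (lt_mem_nhds hA)
  obtain ⟨h, hlt, hpos⟩ := (hev.and self_mem_nhdsWithin).exists
  refine ⟨h, hpos, ?_⟩
  have h0 : (0 : ℝ) < h := hpos
  rw [slope_def_field, sub_zero, div_pos_iff_of_pos_right h0] at hlt
  have : (NormedSpace.exp ((0 : ℝ) • A)).det = 1 := by simp [ContinuousLinearMap.det]
  linarith

end Det

section Instability

variable {E : Type*} [NormedAddCommGroup E] [NormedSpace ℝ E] [FiniteDimensional ℝ E]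

/-- If no solution of `u' = f(u)` starting in `ball x₀ δ` reaches the sphere of radius `ε`, then
solutions starting in that ball exist on every `[0, T]` and remain in `closedBall x₀ ε`. -/
theorem exists_solution_mem_closedBall_of_forall_norm_lt {f : E → E} (hf : ContDiff ℝ 1 f)
    {x₀ : E} {ε δ : ℝ} (hε : 0 < ε) (hδε : δ ≤ ε)
    (hstable : ∀ T ≥ (0 : ℝ), ∀ u : ℝ → E, (∀ t ∈ Icc 0 T, HasDerivAt u (f (u t)) t) →
      ‖u 0 - x₀‖ < δ → ‖u T - x₀‖ < ε)
    {x : E} (hx : x ∈ ball x₀ δ) {T : ℝ} (hT : 0 ≤ T) :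
    ∃ u : ℝ → E, u 0 = x ∧
      ∀ t ∈ Icc 0 T, HasDerivAt u (f (u t)) t ∧ u t ∈ closedBall x₀ ε := by
  have : CompleteSpace E := FiniteDimensional.complete ℝ E
  let χ : ContDiffBump x₀ := ⟨ε, ε + 1, hε, by linarith⟩
  set g : E → E := fun y ↦ χ y • f y
  have hgf : ∀ y ∈ closedBall x₀ ε, g y = f y := fun y hy ↦ by
    simp [g, χ.one_of_mem_closedBall hy]
  have hg : ContDiff ℝ 1 g := χ.contDiff.smul hf
  have hgs : HasCompactSupport g := χ.hasCompactSupport.smul_right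
  obtain ⟨K, hK⟩ := hg.lipschitzWith_of_hasCompactSupport hgs one_ne_zero
  obtain ⟨L, hL⟩ := hgs.exists_bound_of_continuous hg.continuous
  obtain ⟨u, hu0, hu⟩ := hK.exists_forall_mem_Icc_hasDerivAt (L := L.toNNReal)
    (fun y ↦ (hL y).trans (Real.le_coe_toNNReal L)) x hT
  have hu0x : ‖u 0 - x₀‖ < δ := by rwa [hu0, ← dist_eq_norm]
  have hmem : ∀ t ∈ Icc 0 T, u t ∈ closedBall x₀ ε := by
    by_contra! ⟨t₁, ht₁, hout⟩
    have hcont : ContinuousOn (fun t ↦ ‖u t - x₀‖) (Icc 0 T) := fun t ht ↦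
      ((hu t ht).continuousAt.sub continuousAt_const).norm.continuousWithinAt
    set S := Icc 0 T ∩ (fun t ↦ ‖u t - x₀‖) ⁻¹' Ici ε
    have hS : IsCompact S :=
      isCompact_Icc.of_isClosed_subset (hcont.preimage_isClosed_of_isClosed isClosed_Icc isClosed_Ici)
        inter_subset_left
    rw [mem_closedBall, dist_eq_norm, not_le] at hout
    obtain ⟨τ, hτ, hmin⟩ := hS.exists_isLeast ⟨t₁, ht₁, hout.le⟩
    have hlt : ∀ t ∈ Ico 0 τ, ‖u t - x₀‖ < ε := fun t ht ↦ by
      by_contra! h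
      exact ht.2.not_ge (hmin ⟨⟨ht.1, ht.2.le.trans hτ.1.2⟩, h⟩)
    have hτ0 : 0 < τ := hτ.1.1.lt_of_ne fun h ↦ by
      have : ε ≤ ‖u τ - x₀‖ := hτ.2
      rw [← h] at this
      linarith
    have hle : ∀ t ∈ Icc 0 τ, ‖u t - x₀‖ ≤ ε := fun t ht ↦ by
      refine ContinuousWithinAt.closure_le (s := Ico 0 τ) (x := t) ?_ ?_
        continuousWithinAt_const fun t ht ↦ (hlt t ht).le
      · rwa [closure_Ico hτ0.ne]
      · exact (hcont t ⟨ht.1, ht.2.trans hτ.1.2⟩).mono fun s hs ↦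
          ⟨hs.1, hs.2.le.trans hτ.1.2⟩
    refine (hstable τ hτ0.le u (fun t ht ↦ ?_) hu0x).not_ge hτ.2
    rw [← hgf (u t) (by rw [mem_closedBall, dist_eq_norm]; exact hle t ht)]
    exact hu t ⟨ht.1, ht.2.trans hτ.1.2⟩
  exact ⟨u, hu0, fun t ht ↦ ⟨hgf _ (hmem t ht) ▸ hu t ht, hmem t ht⟩⟩

/-- If the derivative of `f` at `x₀` has positive trace, then for some `ε > 0` the set of initial
values of solutions staying in `closedBall x₀ ε` forever is null, since the flow expands volume. -/
theorem exists_pos_addHaar_forever_mem_closedBall_eq_zero [MeasurableSpace E] [BorelSpace E]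
    (μ : Measure E) [μ.IsAddHaarMeasure] {f : E → E} {A : E →L[ℝ] E} {x₀ : E}
    (hf : HasStrictFDerivAt f A x₀) (hA : 0 < LinearMap.trace ℝ E A) :
    ∃ ε > (0 : ℝ), μ {x | ∀ T ≥ (0 : ℝ), ∃ u : ℝ → E, u 0 = x ∧
      ∀ t ∈ Icc 0 T, HasDerivAt u (f (u t)) t ∧ u t ∈ closedBall x₀ ε} = 0 := by
  have : CompleteSpace E := FiniteDimensional.complete ℝ E
  obtain ⟨h, hh, hdet⟩ := A.exists_pos_one_lt_det_exp_smul hA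
  have hdet' : 1 < ENNReal.ofReal |(NormedSpace.exp (h • A)).det| := by
    rw [ENNReal.one_lt_ofReal]
    exact hdet.trans_le (le_abs_self _)
  obtain ⟨m, hm1, hm⟩ := ENNReal.lt_iff_exists_nnreal_btwn.1 hdet'
  obtain ⟨c, hc, hc0⟩ :=
    ((mul_le_addHaar_image_of_lt_det μ _ hm).and self_mem_nhdsWithin).exists
  replace hc0 : 0 < c := hc0
  set C : ℝ≥0 := (Real.exp ((‖A‖ + 1) * h) ^ 2).toNNReal with hC
  have hCpos : 0 < C := Real.toNNReal_pos.2 (by positivity)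
  set η : ℝ≥0 := min 1 (c / C)
  have hη0 : 0 < η := lt_min one_pos (div_pos hc0 hCpos)
  have hηC : η * C ≤ c := (le_div_iff₀ hCpos).1 (min_le_right _ _)
  obtain ⟨s, hs, hfs⟩ := hf.approximates_deriv_on_nhds (Or.inr hη0)
  obtain ⟨ε, hε, hεs⟩ := nhds_basis_closedBall.mem_iff.1 hs
  refine ⟨ε, hε, ?_⟩
  set G := {x | ∀ T ≥ (0 : ℝ), ∃ u : ℝ → E, u 0 = x ∧
    ∀ t ∈ Icc 0 T, HasDerivAt u (f (u t)) t ∧ u t ∈ closedBall x₀ ε} with hG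
  have hclose : ∀ u v : ℝ → E,
      (∀ t ∈ Icc 0 h, HasDerivAt u (f (u t)) t ∧ u t ∈ closedBall x₀ ε) →
      (∀ t ∈ Icc 0 h, HasDerivAt v (f (v t)) t ∧ v t ∈ closedBall x₀ ε) →
      ‖u h - v h - NormedSpace.exp (h • A) (u 0 - v 0)‖ ≤ c * ‖u 0 - v 0‖ := by
    intro u v hu hv
    refine (hfs.norm_sub_sub_exp_le (min_le_left _ _) hh.le (fun t ht ↦ (hu t ht).1)
      (fun t ht ↦ (hv t ht).1) (fun t ht ↦ hεs (hu t ht).2) fun t ht ↦ hεs (hv t ht).2).trans ?_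
    gcongr
    rw [← Real.coe_toNNReal (Real.exp ((‖A‖ + 1) * h) ^ 2) (by positivity)]
    exact_mod_cast hηC
  have hsol : ∀ x : G, ∃ u : ℝ → E, u 0 = x ∧
      ∀ t ∈ Icc 0 h, HasDerivAt u (f (u t)) t ∧ u t ∈ closedBall x₀ ε := fun x ↦ x.2 h hh.le
  choose U hU0 hU using hsol
  classical
  set φ : E → E := fun x ↦ if hx : x ∈ G then U ⟨x, hx⟩ h else x
  have hφ : ∀ x (hx : x ∈ G), φ x = U ⟨x, hx⟩ h := fun x hx ↦ by simp [φ, hx]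
  have happrox : ApproximatesLinearOn φ (NormedSpace.exp (h • A)) G c := fun x hx y hy ↦ by
    simpa [hφ, hx, hy, hU0] using hclose _ _ (hU ⟨x, hx⟩) (hU ⟨y, hy⟩)
  have hmaps : φ '' G ⊆ G := by
    rintro _ ⟨x, hx, rfl⟩ T hT
    obtain ⟨v, hv0, hv⟩ := hx (T + h) (by positivity)
    have hvh : v h = φ x := by
      have := hclose v _ (fun t ht ↦ hv t ⟨ht.1, by linarith [ht.2]⟩) (hU ⟨x, hx⟩)
      rw [hv0, hU0, sub_self, map_zero, norm_zero, mul_zero, sub_zero, norm_le_zero_iff,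
        sub_eq_zero] at this
      rw [this, hφ x hx]
    refine ⟨fun t ↦ v (t + h), by simpa using hvh, fun t ht ↦ ?_⟩
    obtain ⟨h1, h2⟩ := hv (t + h) ⟨by linarith [ht.1], by linarith [ht.2]⟩
    exact ⟨h1.comp_add_const t h, h2⟩
  have hfin : μ G ≠ ∞ := by
    refine measure_ne_top_of_subset (s := closedBall x₀ ε) (fun x hx ↦ ?_)
      measure_closedBall_lt_top.ne
    obtain ⟨u, rfl, hu⟩ := hx 0 le_rfl
    exact (hu 0 (by simp)).2
  by_contra h0
  have hle : m * μ G ≤ 1 * μ G := by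
    rw [one_mul]
    exact (hc G φ happrox).trans (measure_mono hmaps)
  exact hm1.not_ge ((ENNReal.mul_le_mul_iff_left h0 hfin).1 hle)

end Instability

theorem trace_jacobian {n : ℕ} (f : EuclideanSpace ℝ (Fin n) → EuclideanSpace ℝ (Fin n))
    (x : EuclideanSpace ℝ (Fin n)) :
    (jacobian f x).trace = LinearMap.trace ℝ (EuclideanSpace ℝ (Fin n)) (fderiv ℝ f x) := by
  rw [LinearMap.trace_eq_matrix_trace ℝ (EuclideanSpace.basisFun (Fin n) ℝ).toBasis]
  congr 1

/-- if `f` is `C¹`, `f x₀ = 0` and `div f(x₀) = trace Df(x₀) > 0`, then the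
stationary solution `x(t) ≡ x₀` is Lyapunov unstable. -/
theorem stationary_unstable_of_pos_div {n : ℕ}
    (f : EuclideanSpace ℝ (Fin n) → EuclideanSpace ℝ (Fin n))
    (hf : ContDiff ℝ 1 f) (x₀ : EuclideanSpace ℝ (Fin n)) (hx₀ : f x₀ = 0)
    (hdiv : 0 < (jacobian f x₀).trace) :
    ∃ ε > (0 : ℝ), ∀ δ > (0 : ℝ), ∃ T ≥ (0 : ℝ),
      ∃ u : ℝ → EuclideanSpace ℝ (Fin n),
        (∀ t ∈ Set.Icc (0 : ℝ) T, HasDerivAt u (f (u t)) t) ∧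
        ‖u 0 - x₀‖ < δ ∧ ε ≤ ‖u T - x₀‖ := by
  rw [trace_jacobian] at hdiv
  obtain ⟨ε, hε, hnull⟩ := exists_pos_addHaar_forever_mem_closedBall_eq_zero volume
    (hf.contDiffAt.hasStrictFDerivAt one_ne_zero) hdiv
  refine ⟨ε, hε, fun δ hδ ↦ ?_⟩
  by_contra! hstable
  refine (measure_ball_pos volume x₀ (lt_min hδ hε)).ne' (measure_mono_null ?_ hnull)
  intro x hx T hT
  exact exists_solution_mem_closedBall_of_forall_norm_lt hf hε (min_le_right δ ε)
    (fun T hT u hu hu0 ↦ hstable T hT u hu (hu0.trans_le (min_le_left _ _))) hx hT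
end
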